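/- If m and n are both odd positive integers, then cr(K_{1,1,m,n}) ≥ (1/2)(cr(K_{1,m+1,n+1}) + cr(K_{2,m,n}) − (1/4)(m+1)(n+1) + 1). -/

import Mathlib

open SimpleGraph

variable {V : Type*}

/-- A drawing of a simple graph in the plane: an injective placement of the
vertices in `ℝ²` together with, for each edge, a continuous arc joining the
positions of its endpoints (parametrised compatibly in both directions),
such that no arc passes through the position of a vertex other than its
endpoints. -/
structure Drawing (G : SimpleGraph V) where
  pos : V → ℝ × ℝ
  pos_inj : Function.Injective pos
  arc : V → V → ℝ → ℝ × ℝ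
  arc_cont : ∀ ⦃a b⦄, G.Adj a b → ContinuousOn (arc a b) (Set.Icc 0 1)
  arc_zero : ∀ ⦃a b⦄, G.Adj a b → arc a b 0 = pos a
  arc_one : ∀ ⦃a b⦄, G.Adj a b → arc a b 1 = pos b
  arc_symm : ∀ ⦃a b⦄, G.Adj a b → ∀ t, arc b a t = arc a b (1 - t)
  arc_avoid : ∀ ⦃a b⦄, G.Adj a b → ∀ c, c ≠ a → c ≠ b →
      pos c ∉ arc a b '' Set.Icc 0 1

namespace Drawing

variable {G : SimpleGraph V} (D : Drawing G)

/-- The set of points of the plane used by the edge `e`. -/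
def edgePoints (e : Sym2 V) : Set (ℝ × ℝ) :=
  {p | ∃ a b, e = s(a, b) ∧ G.Adj a b ∧ p ∈ D.arc a b '' Set.Icc 0 1}

/-- The positions of the endpoints of an edge. -/
def ends (e : Sym2 V) : Set (ℝ × ℝ) := {p | ∃ a ∈ e, p = D.pos a}

/-- `p` is a crossing of the (distinct) edges `e` and `f` in the drawing `D`:
a common point of the two edges other than an endpoint. -/
def IsCrossing (e f : Sym2 V) (p : ℝ × ℝ) : Prop :=
  e ∈ G.edgeSet ∧ f ∈ G.edgeSet ∧ e ≠ f ∧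
    p ∈ D.edgePoints e ∧ p ∈ D.edgePoints f ∧ p ∉ D.ends e ∧ p ∉ D.ends f

/-- The crossings between an edge of `A` and an edge of `B`: a crossing is
recorded as a point of the plane together with the unordered pair of edges
crossing there. -/
def crossings (A B : Set (Sym2 V)) : Set ((ℝ × ℝ) × Sym2 (Sym2 V)) :=
  {q | ∃ e f, q.2 = s(e, f) ∧ e ∈ A ∧ f ∈ B ∧ D.IsCrossing e f q.1}

/-- `cr_D(A, B)`: the number of crossings between an edge of `A` and an
edge of `B`. -/
noncomputable def crBetween (A B : Set (Sym2 V)) : ℕ := Nat.card (D.crossings A B)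

/-- `cr(D)`: the total number of crossings of the drawing `D`. -/
noncomputable def crNum : ℕ := D.crBetween G.edgeSet G.edgeSet

/-- A good drawing: no edge crosses itself (each arc is a simple arc),
no two adjacent edges cross, no two edges cross more than once, and no three
edges cross at a common point. -/
structure IsGood : Prop where
  arc_inj : ∀ ⦃a b⦄, G.Adj a b → Set.InjOn (D.arc a b) (Set.Icc 0 1)
  adj_no_cross : ∀ e f : Sym2 V, (∃ a, a ∈ e ∧ a ∈ f) → ∀ p, ¬ D.IsCrossing e f p
  cross_once : ∀ e f : Sym2 V, {p | D.IsCrossing e f p}.Subsingleton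
  no_triple : ∀ p, ∀ e f g : Sym2 V, e ≠ f → e ≠ g → f ≠ g →
      ¬ (D.IsCrossing e f p ∧ D.IsCrossing f g p ∧ D.IsCrossing e g p)

end Drawing

/-- The crossing number of a graph: the minimum number of crossings among
all good drawings of `G` in the plane. -/
noncomputable def crossingNumber (G : SimpleGraph V) : ℕ :=
  sInf {n | ∃ D : Drawing G, D.IsGood ∧ D.crNum = n}

/-- The Zarankiewicz function `Z(m,n) = ⌊m/2⌋⌊(m-1)/2⌋⌊n/2⌋⌊(n-1)/2⌋`. -/
def Z (m n : ℕ) : ℕ := m / 2 * ((m - 1) / 2) * (n / 2) * ((n - 1) / 2)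

/-- The complete bipartite graph `K_{a,b}`. -/
abbrev bipK (a b : ℕ) : SimpleGraph (Fin a ⊕ Fin b) :=
  completeBipartiteGraph (Fin a) (Fin b)

/-- The complete tripartite graph `K_{a,b,c}`. -/
abbrev triK (a b c : ℕ) : SimpleGraph (Σ i : Fin 3, ![Fin a, Fin b, Fin c] i) :=
  completeMultipartiteGraph ![Fin a, Fin b, Fin c]

/-- The complete 4-partite graph `K_{a,b,c,d}`. -/
abbrev quadK (a b c d : ℕ) : SimpleGraph (Σ i : Fin 4, ![Fin a, Fin b, Fin c, Fin d] i) :=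
  completeMultipartiteGraph ![Fin a, Fin b, Fin c, Fin d]

/-- `E(V₁, V₂)`: the set of pairs `{v₁, v₂}` with `v₁ ∈ V₁` and `v₂ ∈ V₂`. -/
def pairEdges {α : Type*} (V₁ V₂ : Set α) : Set (Sym2 α) :=
  {e | ∃ a ∈ V₁, ∃ b ∈ V₂, e = s(a, b)}

namespace CrAux
open Set

/-- `S` is a simple arc from `a` to `b`. -/
def IsArc (S : Set ℂ) (a b : ℂ) : Prop :=
  ∃ γ : ℝ → ℂ, ContinuousOn γ (Icc 0 1) ∧ InjOn γ (Icc 0 1) ∧ γ 0 = a ∧ γ 1 = b ∧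
    γ '' Icc 0 1 = S

theorem IsArc.of_Icc {S : Set ℂ} {u v : ℝ} (huv : u < v) (γ : ℝ → ℂ)
    (hc : ContinuousOn γ (Icc u v)) (hi : InjOn γ (Icc u v)) (hS : γ '' Icc u v = S) :
    IsArc S (γ u) (γ v) := by
  have hm : ∀ t ∈ Icc (0:ℝ) 1, u + t * (v - u) ∈ Icc u v := by
    rintro t ⟨h0, h1⟩
    constructor <;> nlinarith
  refine ⟨fun t => γ (u + t * (v - u)), ?_, ?_, by simp, by simp, ?_⟩
  · exact hc.comp (by fun_prop) hm
  · intro s hs t ht h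
    have := hi (hm s hs) (hm t ht) h
    have h2 : (s - t) * (v - u) = 0 := by linarith
    rcases mul_eq_zero.1 h2 with h | h <;> linarith
  · rw [← hS]
    ext p
    constructor
    · rintro ⟨t, ht, rfl⟩
      exact ⟨_, hm t ht, rfl⟩
    · rintro ⟨t, ht, rfl⟩
      refine ⟨(t - u) / (v - u), ⟨div_nonneg (by linarith [ht.1]) (by linarith), ?_⟩, ?_⟩
      · rw [div_le_one (by linarith)]; linarith [ht.2]
      · have : v - u ≠ 0 := by linarith
        simp only
        congr 1
        field_simp
        ring

theorem IsArc.symm {S : Set ℂ} {a b : ℂ} (h : IsArc S a b) : IsArc S b a := by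
  obtain ⟨γ, hc, hi, h0, h1, hS⟩ := h
  have hm : ∀ t ∈ Icc (0:ℝ) 1, 1 - t ∈ Icc (0:ℝ) 1 := by
    rintro t ⟨h0, h1⟩
    constructor <;> linarith
  refine ⟨fun t => γ (1 - t), hc.comp (by fun_prop) hm, ?_, by simp [h1], by simp [h0], ?_⟩
  · intro s hs t ht h
    have := hi (hm s hs) (hm t ht) h
    linarith
  · rw [← hS]
    ext p
    constructor
    · rintro ⟨t, ht, rfl⟩
      exact ⟨_, hm t ht, rfl⟩
    · rintro ⟨t, ht, rfl⟩
      exact ⟨1 - t, hm t ht, by simp⟩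

theorem IsArc.isCompact {S : Set ℂ} {a b : ℂ} (h : IsArc S a b) : IsCompact S := by
  obtain ⟨γ, hc, hi, h0, h1, rfl⟩ := h
  exact isCompact_Icc.image_of_continuousOn hc

theorem IsArc.isClosed {S : Set ℂ} {a b : ℂ} (h : IsArc S a b) : IsClosed S :=
  h.isCompact.isClosed

theorem IsArc.left_mem {S : Set ℂ} {a b : ℂ} (h : IsArc S a b) : a ∈ S := by
  obtain ⟨γ, hc, hi, h0, h1, rfl⟩ := h
  exact ⟨0, by simp, h0⟩

theorem IsArc.right_mem {S : Set ℂ} {a b : ℂ} (h : IsArc S a b) : b ∈ S := h.symm.left_mem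

theorem IsArc.ne {S : Set ℂ} {a b : ℂ} (h : IsArc S a b) : a ≠ b := by
  obtain ⟨γ, hc, hi, rfl, rfl, rfl⟩ := h
  intro h
  have := hi (by simp) (by simp) h
  norm_num at this

theorem IsArc.isPreconnected {S : Set ℂ} {a b : ℂ} (h : IsArc S a b) : IsPreconnected S := by
  obtain ⟨γ, hc, hi, rfl, rfl, rfl⟩ := h
  exact isPreconnected_Icc.image _ hc

theorem isArc_segment {a b : ℂ} (h : a ≠ b) : IsArc (segment ℝ a b) a b := by
  refine ⟨AffineMap.lineMap a b, ?_, ?_, by simp, by simp, ?_⟩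
  · exact (AffineMap.lineMap_continuous).continuousOn
  · exact (AffineMap.lineMap_injective ℝ h).injOn
  · rw [segment_eq_image_lineMap]

theorem IsArc.trans {S T : Set ℂ} {a b c : ℂ} (h : IsArc S a b) (h' : IsArc T b c)
    (hd : S ∩ T ⊆ {b}) : IsArc (S ∪ T) a c := by
  obtain ⟨γ, hc, hi, h0, h1, hS⟩ := h
  obtain ⟨δ, hc', hi', h0', h1', hT⟩ := h'
  let g : ℝ → ℂ := fun t => if t ≤ 1 then γ t else δ (t - 1)
  have g1 : ∀ t ∈ Icc (0:ℝ) 1, g t = γ t := fun t ht => by simp [g, ht.2]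
  have g2 : ∀ t ∈ Icc (1:ℝ) 2, g t = δ (t - 1) := by
    intro t ht
    by_cases h : t ≤ 1
    · have : t = 1 := le_antisymm h ht.1
      subst this
      simp [g, h1, h0']
    · simp [g, h]
  have hm2 : ∀ t ∈ Icc (1:ℝ) 2, t - 1 ∈ Icc (0:ℝ) 1 := by
    rintro t ⟨h0, h1⟩; constructor <;> linarith
  have hU : Icc (0:ℝ) 2 = Icc 0 1 ∪ Icc 1 2 := by
    rw [Icc_union_Icc_eq_Icc] <;> norm_num
  have e0 : g 0 = a := by rw [g1 0 (by simp), h0]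
  have e1 : g 2 = c := by rw [g2 2 (by norm_num)]; norm_num; exact h1'
  rw [← e0, ← e1]
  apply IsArc.of_Icc (by norm_num)
  · rw [hU]
    apply ContinuousOn.union_of_isClosed _ _ isClosed_Icc isClosed_Icc
    · exact hc.congr g1
    · exact (hc'.comp (by fun_prop) hm2).congr g2
  · have key : ∀ s ∈ Icc (0:ℝ) 1, ∀ t ∈ Icc (1:ℝ) 2, g s = g t → s = t := by
      intro s hs t ht hst
      rw [g1 s hs, g2 t ht] at hst
      have m1 : γ s ∈ S := by rw [← hS]; exact ⟨s, hs, rfl⟩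
      have m2 : γ s ∈ T := by rw [← hT, hst]; exact ⟨_, hm2 t ht, rfl⟩
      have hb := hd ⟨m1, m2⟩
      simp only [mem_singleton_iff] at hb
      have a1 : s = 1 := hi hs (by simp) (by rw [hb, h1])
      have a2 : t - 1 = 0 := hi' (hm2 t ht) (by simp) (by rw [← hst, hb, h0'])
      linarith
    rw [hU]
    rintro s (hs | hs) t (ht | ht) hst
    · rw [g1 s hs, g1 t ht] at hst; exact hi hs ht hst
    · exact key s hs t ht hst
    · exact (key t ht s hs hst.symm).symm
    · rw [g2 s hs, g2 t ht] at hst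
      have := hi' (hm2 s hs) (hm2 t ht) hst
      linarith
  · rw [hU, image_union]
    congr 1
    · rw [← hS]; exact image_congr g1
    · rw [← hT]
      ext p
      constructor
      · rintro ⟨t, ht, rfl⟩
        exact ⟨_, hm2 t ht, (g2 t ht).symm⟩
      · rintro ⟨t, ht, rfl⟩
        have : t + 1 ∈ Icc (1:ℝ) 2 := ⟨by linarith [ht.1], by linarith [ht.2]⟩
        exact ⟨t + 1, this, by rw [g2 _ this]; simp⟩

theorem IsArc.split {S : Set ℂ} {a b p : ℂ} (h : IsArc S a b) (hp : p ∈ S) (ha : p ≠ a)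
    (hb : p ≠ b) : ∃ S₁ S₂, S₁ ⊆ S ∧ S₂ ⊆ S ∧ IsArc S₁ a p ∧ IsArc S₂ p b ∧ S₁ ∩ S₂ ⊆ {p} := by
  obtain ⟨γ, hc, hi, rfl, rfl, rfl⟩ := h
  obtain ⟨t, ht, rfl⟩ := hp
  have h0 : 0 < t := lt_of_le_of_ne ht.1 (by rintro rfl; exact ha rfl)
  have h1 : t < 1 := lt_of_le_of_ne ht.2 (by rintro rfl; exact hb rfl)
  have s1 : Icc 0 t ⊆ Icc (0:ℝ) 1 := Icc_subset_Icc le_rfl ht.2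
  have s2 : Icc t 1 ⊆ Icc (0:ℝ) 1 := Icc_subset_Icc ht.1 le_rfl
  refine ⟨γ '' Icc 0 t, γ '' Icc t 1, image_mono s1, image_mono s2,
    IsArc.of_Icc h0 γ (hc.mono s1) (hi.mono s1) rfl,
    IsArc.of_Icc h1 γ (hc.mono s2) (hi.mono s2) rfl, ?_⟩
  rintro _ ⟨⟨u, hu, rfl⟩, ⟨v, hv, huv⟩⟩
  have : v = u := hi (s2 hv) (s1 hu) huv
  subst this
  have : v = t := le_antisymm hu.2 hv.1
  simp [this]

theorem IsArc.firstHit {S C : Set ℂ} {a b : ℂ} (h : IsArc S a b) (hC : IsClosed C)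
    (ha : a ∉ C) (hne : (S ∩ C).Nonempty) :
    ∃ T q, T ⊆ S ∧ IsArc T a q ∧ q ∈ C ∧ T ∩ C ⊆ {q} := by
  obtain ⟨γ, hc, hi, rfl, rfl, rfl⟩ := h
  set A : Set ℝ := Icc 0 1 ∩ γ ⁻¹' C with hA
  have hAc : IsCompact A :=
    isCompact_Icc.of_isClosed_subset (hc.preimage_isClosed_of_isClosed isClosed_Icc hC)
      inter_subset_left
  have hAne : A.Nonempty := by
    obtain ⟨_, ⟨t, ht, rfl⟩, h⟩ := hne
    exact ⟨t, ht, h⟩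
  obtain ⟨ht, htC⟩ := hAc.sInf_mem hAne
  set t := sInf A
  have hlow : ∀ u ∈ A, t ≤ u := fun u hu => csInf_le hAc.bddBelow hu
  have h0 : 0 < t := lt_of_le_of_ne ht.1 (by intro h; rw [← h] at htC; exact ha htC)
  have s1 : Icc 0 t ⊆ Icc (0:ℝ) 1 := Icc_subset_Icc le_rfl ht.2
  refine ⟨γ '' Icc 0 t, γ t, image_mono s1,
    IsArc.of_Icc h0 γ (hc.mono s1) (hi.mono s1) rfl, htC, ?_⟩
  rintro _ ⟨⟨u, hu, rfl⟩, huC⟩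
  have : u = t := le_antisymm hu.2 (hlow u ⟨s1 hu, huC⟩)
  simp [this]

/-- First hit of a closed ball is on the sphere. -/
theorem IsArc.firstHitBall {S : Set ℂ} {a b o : ℂ} {r : ℝ} (h : IsArc S a b)
    (ha : a ∉ Metric.closedBall o r) (hne : (S ∩ Metric.closedBall o r).Nonempty) :
    ∃ T q, T ⊆ S ∧ IsArc T a q ∧ q ∈ Metric.sphere o r ∧ T ∩ Metric.closedBall o r ⊆ {q} := by
  obtain ⟨T, q, h1, h2, h3, h4⟩ := h.firstHit Metric.isClosed_closedBall ha hne
  refine ⟨T, q, h1, h2, ?_, h4⟩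
  by_contra hq
  have hq' : q ∈ Metric.ball o r := by
    rw [Metric.mem_closedBall] at h3
    rw [Metric.mem_sphere] at hq
    exact lt_of_le_of_ne h3 hq
  -- T is connected, T \ {q} nonempty, {q} would be clopen
  have hconn := h2.isPreconnected
  have := hconn (Metric.ball o r) (Metric.closedBall o r)ᶜ Metric.isOpen_ball
    Metric.isClosed_closedBall.isOpen_compl (by
      intro p hp
      by_cases hpc : p ∈ Metric.closedBall o r
      · left
        have : p = q := h4 ⟨hp, hpc⟩
        rw [this]; exact hq'
      · right; exact hpc) ⟨q, h2.right_mem, hq'⟩ ⟨a, h2.left_mem, ha⟩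
  obtain ⟨p, _, hp1, hp2⟩ := this
  exact hp2 (Metric.ball_subset_closedBall hp1)

end CrAux

namespace CrAux
open Set

/-- A good system of arcs in `ℂ`: vertices `V`, edges indexed by `ι` with ends `s`, `t`. -/
structure ISys {V ι : Type} (s t : ι → V) where
  pos : V → ℂ
  inj : Function.Injective pos
  S : ι → Set ℂ
  arc : ∀ i, IsArc (S i) (pos (s i)) (pos (t i))
  avoid : ∀ i v, v ≠ s i → v ≠ t i → pos v ∉ S i
  adj : ∀ i j, i ≠ j → (s i = s j ∨ s i = t j ∨ t i = s j ∨ t i = t j) →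
    ∀ p, p ∈ S i → p ∈ S j → ∃ v, p = pos v
  once : ∀ i j, i ≠ j → ∀ p q, p ∈ S i → p ∈ S j → q ∈ S i → q ∈ S j →
    (∀ v, p ≠ pos v) → (∀ v, q ≠ pos v) → p = q
  triple : ∀ i j k, i ≠ j → i ≠ k → j ≠ k → ∀ p, p ∈ S i → p ∈ S j → p ∈ S k → ∃ v, p = pos v

variable {V ι : Type} {s t : ι → V}

def ISys.Cross (D : ISys s t) (i j : ι) : Prop :=
  i ≠ j ∧ ∃ p, p ∈ D.S i ∧ p ∈ D.S j ∧ ∀ v, p ≠ D.pos v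

theorem ISys.Cross.symm {D : ISys s t} {i j : ι} (h : D.Cross i j) : D.Cross j i := by
  obtain ⟨h, p, h1, h2, h3⟩ := h
  exact ⟨h.symm, p, h2, h1, h3⟩

/-- the number of ordered crossing pairs -/
noncomputable def ISys.cr (D : ISys s t) : ℕ := {q : ι × ι | D.Cross q.1 q.2}.ncard

theorem arc_image_symm {W : Type} {G : SimpleGraph W} (D : Drawing G) {a b : W}
    (h : G.Adj a b) : D.arc b a '' Icc 0 1 = D.arc a b '' Icc 0 1 := by
  have hm : ∀ t ∈ Icc (0:ℝ) 1, 1 - t ∈ Icc (0:ℝ) 1 := by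
    rintro t ⟨h0, h1⟩
    constructor <;> linarith
  ext p
  constructor
  · rintro ⟨t, ht, rfl⟩
    exact ⟨1 - t, hm t ht, (D.arc_symm h t).symm⟩
  · rintro ⟨t, ht, rfl⟩
    exact ⟨1 - t, hm t ht, by rw [D.arc_symm h]; simp⟩

theorem edgePoints_mk {W : Type} {G : SimpleGraph W} (D : Drawing G) {a b : W}
    (h : G.Adj a b) : D.edgePoints s(a, b) = D.arc a b '' Icc 0 1 := by
  ext p
  constructor
  · rintro ⟨c, d, he, hcd, hp⟩
    rw [Sym2.eq_iff] at he
    rcases he with ⟨rfl, rfl⟩ | ⟨rfl, rfl⟩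
    · exact hp
    · rwa [arc_image_symm D h] at hp
  · intro hp
    exact ⟨a, b, rfl, h, hp⟩

theorem finite_crossings {W : Type} [Finite W] {G : SimpleGraph W} (D : Drawing G)
    (hD : D.IsGood) (A B : Set (Sym2 W)) : Finite (D.crossings A B) := by
  apply Finite.of_injective (fun q : D.crossings A B => q.1.2)
  intro x y hcc
  obtain ⟨⟨p, c⟩, e, f, h1, hA, hB, h4⟩ := x
  obtain ⟨⟨p', c'⟩, e', f', h1', hA', hB', h4'⟩ := y
  replace hcc : c = c' := hcc
  simp only at h1 h1' h4 h4'
  subst hcc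
  have h4'' : D.IsCrossing e f p' := by
    rw [h1', Sym2.eq_iff] at h1
    rcases h1 with ⟨rfl, rfl⟩ | ⟨rfl, rfl⟩
    · exact h4'
    · obtain ⟨a, b, c, d, e, f, g⟩ := h4'
      exact ⟨b, a, c.symm, e, d, g, f⟩
  have := hD.cross_once e f h4 h4''
  simp [this]

/-- From good drawings to systems. -/
theorem exists_isys {W : Type} [Finite W] {G : SimpleGraph W} (D : Drawing G) (hD : D.IsGood)
    (σ : V ≃ W) (he : ∀ i, G.Adj (σ (s i)) (σ (t i)))
    (hinj : ∀ i j, s(s i, t i) = s(s j, t j) → i = j) :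
    ∃ D' : ISys s t, D'.cr ≤ 2 * D.crNum := by
  classical
  let Φ : ℂ ≃L[ℝ] ℝ × ℝ := Complex.equivRealProdCLM
  let ed : ι → Sym2 W := fun i => s(σ (s i), σ (t i))
  have hed : ∀ i j, ed i = ed j → i = j := by
    intro i j h
    apply hinj
    have : Sym2.map σ s(s i, t i) = Sym2.map σ s(s j, t j) := h
    exact Sym2.map.injective σ.injective this
  have hS : ∀ i p, Φ p ∈ D.edgePoints (ed i) ↔ p ∈ Φ ⁻¹' (D.arc (σ (s i)) (σ (t i)) '' Icc 0 1) := by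
    intro i p
    rw [edgePoints_mk D (he i)]; rfl
  have hcr : ∀ i j p, i ≠ j → p ∈ Φ ⁻¹' (D.arc (σ (s i)) (σ (t i)) '' Icc 0 1) →
      p ∈ Φ ⁻¹' (D.arc (σ (s j)) (σ (t j)) '' Icc 0 1) →
      (∀ v, p ≠ Φ.symm (D.pos (σ v))) → D.IsCrossing (ed i) (ed j) (Φ p) := by
    intro i j p hij h1 h2 h3
    have h3' : ∀ w, Φ p ≠ D.pos w := by
      intro w hw
      apply h3 (σ.symm w)
      simp [← hw]
    refine ⟨he i, he j, fun h => hij (hed _ _ h), (hS i p).2 h1, (hS j p).2 h2, ?_, ?_⟩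
    · rintro ⟨w, -, hw⟩; exact h3' w hw
    · rintro ⟨w, -, hw⟩; exact h3' w hw
  let D' : ISys s t :=
    { pos := fun v => Φ.symm (D.pos (σ v))
      inj := Φ.symm.injective.comp (D.pos_inj.comp σ.injective)
      S := fun i => Φ ⁻¹' (D.arc (σ (s i)) (σ (t i)) '' Icc 0 1)
      arc := by
        intro i
        refine ⟨fun u => Φ.symm (D.arc (σ (s i)) (σ (t i)) u), ?_, ?_, ?_, ?_, ?_⟩
        · exact Φ.symm.continuous.comp_continuousOn (D.arc_cont (he i))
        · exact Φ.symm.injective.comp_injOn (hD.arc_inj (he i))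
        · simp only [D.arc_zero (he i)]
        · simp only [D.arc_one (he i)]
        · ext p
          constructor
          · rintro ⟨u, hu, rfl⟩
            exact ⟨u, hu, by simp⟩
          · rintro ⟨u, hu, h⟩
            exact ⟨u, hu, by simp [h]⟩
      avoid := by
        intro i v h1 h2 h
        refine D.arc_avoid (he i) (σ v) (σ.injective.ne h1) (σ.injective.ne h2) ?_
        simpa using h
      adj := by
        intro i j hij hv p h1 h2
        by_contra! hcon
        refine hD.adj_no_cross (ed i) (ed j) ?_ (Φ p) (hcr i j p hij h1 h2 hcon)
        rcases hv with h | h | h | h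
        · exact ⟨σ (s i), by simp [ed], by simp [ed, h]⟩
        · exact ⟨σ (s i), by simp [ed], by simp [ed, h]⟩
        · exact ⟨σ (t i), by simp [ed], by simp [ed, h]⟩
        · exact ⟨σ (t i), by simp [ed], by simp [ed, h]⟩
      once := by
        intro i j hij p q h1 h2 h3 h4 h5 h6
        exact Φ.injective (hD.cross_once (ed i) (ed j) (hcr i j p hij h1 h2 h5)
          (hcr i j q hij h3 h4 h6))
      triple := by
        intro i j k hij hik hjk p h1 h2 h3
        by_contra! hcon
        exact hD.no_triple (Φ p) (ed i) (ed j) (ed k) (fun h => hij (hed _ _ h))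
          (fun h => hik (hed _ _ h)) (fun h => hjk (hed _ _ h))
          ⟨hcr i j p hij h1 h2 hcon, hcr j k p hjk h2 h3 hcon, hcr i k p hik h1 h3 hcon⟩ }
  refine ⟨D', ?_⟩
  have := finite_crossings D hD G.edgeSet G.edgeSet
  have hkey : ∀ q : {q : ι × ι | D'.Cross q.1 q.2}, ∃ p, ((p, s(ed q.1.1, ed q.1.2)) :
      (ℝ × ℝ) × Sym2 (Sym2 W)) ∈ D.crossings G.edgeSet G.edgeSet := by
    rintro ⟨⟨i, j⟩, hij, p, h1, h2, h3⟩
    exact ⟨Φ p, ed i, ed j, rfl, he i, he j, hcr i j p hij h1 h2 h3⟩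
  choose P hP using hkey
  let F : {q : ι × ι | D'.Cross q.1 q.2} → (D.crossings G.edgeSet G.edgeSet) × Bool :=
    fun q => (⟨_, hP q⟩, decide ((Quot.out s(ed q.1.1, ed q.1.2)) = (ed q.1.1, ed q.1.2)))
  have hF : Function.Injective F := by
    rintro ⟨⟨i, j⟩, hq⟩ ⟨⟨i', j'⟩, hq'⟩ h
    simp only [F, Prod.mk.injEq, Subtype.mk.injEq] at h
    obtain ⟨⟨-, h1⟩, h2⟩ := h
    have hout : ∀ c : Sym2 (Sym2 W), s((Quot.out c).1, (Quot.out c).2) = c := fun c => Quot.out_eq c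
    rw [Sym2.eq_iff] at h1
    rcases h1 with ⟨h1, h3⟩ | ⟨h1, h3⟩
    · simp [hed _ _ h1, hed _ _ h3]
    · exfalso
      rw [h1, h3, Sym2.eq_swap] at h2
      have e3 := hout s(ed i', ed j')
      have hne : ed i' ≠ ed j' := fun h => hq'.1 (hed _ _ h)
      generalize Quot.out s(ed i', ed j') = c at h2 e3
      rw [Sym2.eq_iff] at e3
      obtain ⟨c1, c2⟩ := c
      simp only at e3
      rcases e3 with ⟨rfl, rfl⟩ | ⟨rfl, rfl⟩
      · simp [hne] at h2
      · simp [hne.symm] at h2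
  have := Nat.card_le_card_of_injective F hF
  rw [Nat.card_prod] at this
  simp only [Nat.card_eq_fintype_card (α := Bool), Fintype.card_bool] at this
  rw [ISys.cr, ← Nat.card_coe_set_eq, Drawing.crNum, Drawing.crBetween]
  omega

/-- From systems to good drawings. -/
theorem exists_drawing [Finite ι] {W : Type} {G : SimpleGraph W} (D' : ISys s t)
    (σ : V ≃ W)
    (he : ∀ a b, G.Adj (σ a) (σ b) ↔ ∃ i, (s i = a ∧ t i = b) ∨ (s i = b ∧ t i = a))
    (hinj : ∀ i j, s(s i, t i) = s(s j, t j) → i = j) :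
    ∃ D : Drawing G, D.IsGood ∧ 2 * D.crNum ≤ D'.cr := by
  classical
  let Φ : ℂ ≃L[ℝ] ℝ × ℝ := Complex.equivRealProdCLM
  choose γ gc gi g0 g1 gS using D'.arc
  have he' : ∀ a b, G.Adj a b → ∃ i, (s i = σ.symm a ∧ t i = σ.symm b) ∨
      (s i = σ.symm b ∧ t i = σ.symm a) := by
    intro a b h
    rw [← he]; simpa using h
  let idx : ∀ a b, G.Adj a b → ι := fun a b h => (he' a b h).choose
  have hidx : ∀ a b (h : G.Adj a b), (s (idx a b h) = σ.symm a ∧ t (idx a b h) = σ.symm b) ∨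
      (s (idx a b h) = σ.symm b ∧ t (idx a b h) = σ.symm a) := fun a b h => (he' a b h).choose_spec
  have hidx_symm : ∀ a b (h : G.Adj a b), idx b a h.symm = idx a b h := by
    intro a b h
    apply hinj
    rw [Sym2.eq_iff]
    rcases hidx a b h with h1 | h1 <;> rcases hidx b a h.symm with h2 | h2 <;> 
      simp [h1, h2]
  let arc : W → W → ℝ → ℝ × ℝ := fun a b u =>
    if h : G.Adj a b then
      if s (idx a b h) = σ.symm a then Φ (γ (idx a b h) u) else Φ (γ (idx a b h) (1 - u))
    else 0
  have hm : ∀ t ∈ Icc (0:ℝ) 1, 1 - t ∈ Icc (0:ℝ) 1 := by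
    rintro t ⟨h0, h1⟩
    constructor <;> linarith
  have harc1 : ∀ a b (h : G.Adj a b), s (idx a b h) = σ.symm a →
      arc a b = fun u => Φ (γ (idx a b h) u) := by
    intro a b h hs; funext u; simp [arc, h, hs]
  have harc2 : ∀ a b (h : G.Adj a b), s (idx a b h) ≠ σ.symm a →
      arc a b = fun u => Φ (γ (idx a b h) (1 - u)) := by
    intro a b h hs; funext u; simp [arc, h, hs]
  have harcS : ∀ a b (h : G.Adj a b), arc a b '' Icc 0 1 = Φ '' (D'.S (idx a b h)) := by
    intro a b h
    rw [← gS]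
    by_cases hs : s (idx a b h) = σ.symm a
    · rw [harc1 a b h hs, image_image]
    · rw [harc2 a b h hs, image_image]
      ext p
      constructor
      · rintro ⟨u, hu, rfl⟩; exact ⟨1 - u, hm u hu, rfl⟩
      · rintro ⟨u, hu, rfl⟩; exact ⟨1 - u, hm u hu, by simp⟩
  let D : Drawing G :=
    { pos := fun w => Φ (D'.pos (σ.symm w))
      pos_inj := Φ.injective.comp (D'.inj.comp σ.symm.injective)
      arc := arc
      arc_cont := by
        intro a b h
        by_cases hs : s (idx a b h) = σ.symm a
        · rw [harc1 a b h hs]; exact Φ.continuous.comp_continuousOn (gc _)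
        · rw [harc2 a b h hs]
          exact Φ.continuous.comp_continuousOn ((gc _).comp (by fun_prop) hm)
      arc_zero := by
        intro a b h
        by_cases hs : s (idx a b h) = σ.symm a
        · rw [harc1 a b h hs]; simp [g0, hs]
        · rw [harc2 a b h hs]
          rcases hidx a b h with h1 | h1
          · exact absurd h1.1 hs
          · simp [g1, h1]
      arc_one := by
        intro a b h
        by_cases hs : s (idx a b h) = σ.symm a
        · rw [harc1 a b h hs]
          rcases hidx a b h with h1 | h1
          · simp [g1, h1]
          · exfalso
            rw [h1.1] at hs
            exact h.ne (σ.symm.injective hs).symm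
        · rw [harc2 a b h hs]
          rcases hidx a b h with h1 | h1
          · exact absurd h1.1 hs
          · simp [g0, h1]
      arc_symm := by
        intro a b h u
        have hne : σ.symm a ≠ σ.symm b := σ.symm.injective.ne h.ne
        by_cases hs : s (idx a b h) = σ.symm a
        · rw [harc1 a b h hs, harc2 b a h.symm (by rw [hidx_symm a b h, hs]; exact hne), hidx_symm a b h]
        · have hs' : s (idx b a h.symm) = σ.symm b := by
            rw [hidx_symm a b h]
            rcases hidx a b h with h1 | h1
            · exact absurd h1.1 hs
            · exact h1.1
          rw [harc2 a b h hs, harc1 b a h.symm hs', hidx_symm a b h]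
          simp
      arc_avoid := by
        intro a b h c hca hcb hc
        rw [harcS a b h] at hc
        obtain ⟨p, hp, hpc⟩ := hc
        have := Φ.injective hpc
        subst this
        refine D'.avoid _ (σ.symm c) ?_ ?_ hp
        · rcases hidx a b h with h1 | h1 <;> rw [h1.1] <;> exact σ.symm.injective.ne (by assumption)
        · rcases hidx a b h with h1 | h1 <;> rw [h1.2] <;> exact σ.symm.injective.ne (by assumption) }
  have hpos : ∀ w, D.pos w = Φ (D'.pos (σ.symm w)) := fun _ => rfl
  have hEP : ∀ a b (h : G.Adj a b), D.edgePoints s(a, b) = Φ '' (D'.S (idx a b h)) := by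
    intro a b h
    rw [edgePoints_mk D h]; exact harcS a b h
  -- every edge comes from a unique index
  have hex : ∀ e ∈ G.edgeSet, ∃ i, e = s(σ (s i), σ (t i)) ∧ D.edgePoints e = Φ '' D'.S i := by
    intro e
    induction e with
    | h a b =>
      intro h
      refine ⟨idx a b h, ?_, hEP a b h⟩
      rw [Sym2.eq_iff]
      rcases hidx a b h with h1 | h1 <;> simp [h1]
  have hcross : ∀ e f p, D.IsCrossing e f p → ∃ i j q, i ≠ j ∧ e = s(σ (s i), σ (t i)) ∧
      f = s(σ (s j), σ (t j)) ∧ p = Φ q ∧ q ∈ D'.S i ∧ q ∈ D'.S j ∧ ∀ v, q ≠ D'.pos v := by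
    rintro e f p ⟨h1, h2, h3, h4, h5, h6, h7⟩
    obtain ⟨i, rfl, hi⟩ := hex e h1
    obtain ⟨j, rfl, hj⟩ := hex f h2
    rw [hi] at h4
    rw [hj] at h5
    obtain ⟨q, hq, rfl⟩ := h4
    obtain ⟨q', hq', hqq⟩ := h5
    have := Φ.injective hqq
    subst this
    refine ⟨i, j, q', fun h => h3 (by rw [h]), rfl, rfl, rfl, hq, hq', ?_⟩
    rintro v rfl
    apply h6
    by_cases hv1 : v = s i
    · exact ⟨σ (s i), by simp, by rw [hpos]; simp [hv1]⟩
    by_cases hv2 : v = t i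
    · exact ⟨σ (t i), by simp, by rw [hpos]; simp [hv2]⟩
    exact absurd hq (D'.avoid i v hv1 hv2)
  have hedinj : ∀ i j, s(σ (s i), σ (t i)) = s(σ (s j), σ (t j)) → i = j := by
    intro i j h
    apply hinj
    have : Sym2.map σ s(s i, t i) = Sym2.map σ s(s j, t j) := h
    exact Sym2.map.injective σ.injective this
  have hgood : D.IsGood := by
    constructor
    · intro a b h
      change InjOn (arc a b) _
      by_cases hs : s (idx a b h) = σ.symm a
      · rw [harc1 a b h hs]; exact Φ.injective.comp_injOn (gi _)
      · rw [harc2 a b h hs]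
        refine Φ.injective.comp_injOn ?_
        intro u hu v hv huv
        have := gi _ (hm u hu) (hm v hv) huv
        linarith
    · rintro e f ⟨w, hw1, hw2⟩ p hp
      obtain ⟨i, j, q, hij, rfl, rfl, rfl, h1, h2, h3⟩ := hcross e f p hp
      have hsh : s i = s j ∨ s i = t j ∨ t i = s j ∨ t i = t j := by
        simp only [Sym2.mem_iff] at hw1 hw2
        rcases hw1 with rfl | rfl <;> rcases hw2 with h | h <;> have := σ.injective h <;> tauto
      obtain ⟨v, hv⟩ := D'.adj i j hij hsh q h1 h2
      exact h3 v hv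
    · intro e f p hp p' hp'
      obtain ⟨i, j, q, hij, e1, e2, rfl, h1, h2, h3⟩ := hcross e f p hp
      obtain ⟨i', j', q', hij', e1', e2', rfl, h1', h2', h3'⟩ := hcross e f p' hp'
      have := hedinj _ _ (e1.symm.trans e1')
      subst this
      have := hedinj _ _ (e2.symm.trans e2')
      subst this
      rw [D'.once i j hij q q' h1 h2 h1' h2' h3 h3']
    · rintro p e f g hef heg hfg ⟨c1, c2, c3⟩
      obtain ⟨i, j, q, hij, rfl, rfl, rfl, h1, h2, h3'⟩ := hcross e f p c1
      obtain ⟨i', j', q', hij', e1', rfl, e3, h1', h2', h3''⟩ := hcross _ _ _ c2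
      have := Φ.injective e3
      subst this
      obtain ⟨v, hv⟩ := D'.triple i j j' hij (by rintro rfl; exact heg rfl)
        (by rintro rfl; exact hfg rfl) q h1 h2 h2'
      exact h3' v hv
  refine ⟨D, hgood, ?_⟩
  -- counting
  have hkey : ∀ q : D.crossings G.edgeSet G.edgeSet, ∃ ij : ι × ι, D'.Cross ij.1 ij.2 ∧
      q.1.2 = s(s(σ (s ij.1), σ (t ij.1)), s(σ (s ij.2), σ (t ij.2))) ∧
      ∃ z, q.1.1 = Φ z ∧ z ∈ D'.S ij.1 ∧ z ∈ D'.S ij.2 ∧ ∀ v, z ≠ D'.pos v := by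
    rintro ⟨⟨p, c⟩, e, f, h1, -, -, h4⟩
    obtain ⟨i, j, q, hij, rfl, rfl, rfl, h1', h2, h3⟩ := hcross e f p h4
    exact ⟨(i, j), ⟨hij, q, h1', h2, h3⟩, h1, q, rfl, h1', h2, h3⟩
  choose P hP1 hP2 hP3 using hkey
  let F : (D.crossings G.edgeSet G.edgeSet) × Bool → {q : ι × ι | D'.Cross q.1 q.2} :=
    fun x => if x.2 then ⟨P x.1, hP1 x.1⟩ else ⟨(P x.1).swap, (hP1 x.1).symm⟩
  have hPinj : ∀ q q', (P q = P q' ∨ P q = (P q').swap) → q = q' := by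
    intro q q' h
    apply Subtype.ext
    obtain ⟨z, hz, hz1, hz2, hz3⟩ := hP3 q
    obtain ⟨z', hz', hz1', hz2', hz3'⟩ := hP3 q'
    rcases h with h | h
    · apply Prod.ext
      · rw [hz, hz']
        congr 1
        rw [h] at hz1 hz2
        exact D'.once _ _ (hP1 q').1 z z' hz1 hz2 hz1' hz2' hz3 hz3'
      · rw [hP2, hP2, h]
    · apply Prod.ext
      · rw [hz, hz']
        congr 1
        rw [h] at hz1 hz2
        exact D'.once _ _ (hP1 q').1 z z' hz2 hz1 hz1' hz2' hz3 hz3'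
      · rw [hP2, hP2, h, Sym2.eq_swap]; rfl
  have hF : Function.Injective F := by
    rintro ⟨q, b⟩ ⟨q', b'⟩ h
    have hsw : ∀ q, P q ≠ (P q).swap := by
      intro q h
      exact (hP1 q).1 (congrArg Prod.fst h)
    cases b <;> cases b' <;> simp only [F, Subtype.mk.injEq, if_true, Bool.false_eq_true, if_false] at h
    · rw [hPinj q q' (Or.inl (Prod.swap_injective h))]
    · have h' : q' = q := hPinj q' q (Or.inr h.symm)
      subst h'
      exact absurd h.symm (hsw _)
    · have h' : q = q' := hPinj q q' (Or.inr h)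
      subst h'
      exact absurd h (hsw _)
    · rw [hPinj q q' (Or.inl h)]
  have := Nat.card_le_card_of_injective F hF
  rw [Nat.card_prod] at this
  simp only [Nat.card_eq_fintype_card (α := Bool), Fintype.card_bool] at this
  rw [ISys.cr, ← Nat.card_coe_set_eq, Drawing.crNum, Drawing.crBetween]
  omega

theorem crossingNumber_le [Finite ι] {W : Type} {G : SimpleGraph W} (D' : ISys s t)
    (σ : V ≃ W)
    (he : ∀ a b, G.Adj (σ a) (σ b) ↔ ∃ i, (s i = a ∧ t i = b) ∨ (s i = b ∧ t i = a))
    (hinj : ∀ i j, s(s i, t i) = s(s j, t j) → i = j) :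
    2 * crossingNumber G ≤ D'.cr := by
  obtain ⟨D, hD, h⟩ := exists_drawing D' σ he hinj
  have : crossingNumber G ≤ D.crNum := Nat.sInf_le ⟨D, hD, rfl⟩
  omega

end CrAux

namespace CrAux
open Set Metric

theorem seg_ball {o q c z : ℂ} {r : ℝ} (hq : q ∈ sphere o r) (hc : c ∈ Metric.ball o r)
    (hz : z ∈ segment ℝ q c) (hne : z ≠ q) : z ∈ Metric.ball o r := by
  obtain ⟨a, b, ha, hb, hab, rfl⟩ := hz
  have hb' : 0 < b := by
    rcases hb.lt_or_eq with h | h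
    · exact h
    · exfalso; apply hne
      have : a = 1 := by linarith
      simp [← h, this]
  rw [Metric.mem_ball, dist_eq_norm] at hc ⊢
  rw [mem_sphere, dist_eq_norm] at hq
  have e : a • q + b • c - o = a • (q - o) + b • (c - o) := by
    have : o = (a + b) • o := by rw [hab, one_smul]
    nth_rewrite 1 [this]
    module
  rw [e]
  calc ‖a • (q - o) + b • (c - o)‖ ≤ ‖a • (q - o)‖ + ‖b • (c - o)‖ := norm_add_le _ _
    _ = a * r + b * ‖c - o‖ := by
        rw [norm_smul, norm_smul, hq, Real.norm_of_nonneg ha, Real.norm_of_nonneg hb]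
    _ < a * r + b * r := by nlinarith
    _ = r := by rw [← add_mul, hab, one_mul]

theorem seg_closedBall {o q c z : ℂ} {r : ℝ} (hq : q ∈ closedBall o r) (hc : c ∈ closedBall o r)
    (hz : z ∈ segment ℝ q c) : z ∈ closedBall o r :=
  (convex_closedBall o r).segment_subset hq hc hz

theorem seg_sphere {o q c z : ℂ} {r : ℝ} (hq : q ∈ sphere o r) (hc : c ∈ Metric.ball o r)
    (hz : z ∈ segment ℝ q c) (h : z ∈ sphere o r) : z = q := by
  by_contra hne
  have := seg_ball hq hc hz hne
  rw [Metric.mem_ball] at this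
  rw [mem_sphere] at h
  linarith

/-- Two truncated segments from different points of the sphere towards an interior point. -/
theorem seg_two {o q₁ q₂ b z : ℂ} {r s t : ℝ} (h1 : q₁ ∈ sphere o r) (h2 : q₂ ∈ sphere o r)
    (hne : q₁ ≠ q₂) (hb : b ∈ Metric.ball o r) (hs : s < 1) (ht : t < 1)
    (e1 : z = AffineMap.lineMap q₁ b s) (e2 : z = AffineMap.lineMap q₂ b t) : False := by
  wlog hst : t ≤ s generalizing q₁ q₂ s t
  · exact this h2 h1 hne.symm ht hs e2 e1 (le_of_not_ge hst)
  rw [AffineMap.lineMap_apply_module] at e1 e2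
  have e : (1 - s) • (q₁ - b) = (1 - t) • (q₂ - b) := by
    have : (1 - s) • q₁ + s • b = (1 - t) • q₂ + t • b := e1.symm.trans e2
    calc (1 - s) • (q₁ - b) = ((1 - s) • q₁ + s • b) - b := by module
      _ = (1 - t) • (q₂ - b) := by rw [this]; module
  have ht' : 0 < 1 - t := by linarith
  have : q₂ ∈ segment ℝ q₁ b := by
    refine ⟨(1 - s) / (1 - t), 1 - (1 - s) / (1 - t), by apply div_nonneg <;> linarith, ?_, by ring, ?_⟩
    · rw [sub_nonneg, div_le_one ht']; linarith
    · have e3 : q₂ = b + (1 - t)⁻¹ • ((1 - t) • (q₂ - b)) := by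
        rw [smul_smul, inv_mul_cancel₀ ht'.ne', one_smul]; ring
      rw [e3, ← e, smul_smul, inv_mul_eq_div]
      module
  exact hne (seg_sphere h1 hb this h2).symm

theorem seg_radial {o a b z : ℂ} {r : ℝ} (hr : 0 < r) (h1 : a ∈ sphere o r) (h2 : b ∈ sphere o r)
    (hne : a ≠ b) (hz1 : z ∈ segment ℝ o a) (hz2 : z ∈ segment ℝ o b) : z = o := by
  rw [segment_eq_image_lineMap] at hz1 hz2
  obtain ⟨s, hs, rfl⟩ := hz1
  obtain ⟨t, ht, h⟩ := hz2
  rw [AffineMap.lineMap_apply_module'] at *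
  rw [AffineMap.lineMap_apply_module'] at h
  have h' : t • (b - o) = s • (a - o) := by simpa using h
  rw [mem_sphere, dist_eq_norm] at h1 h2
  have hn := congrArg norm h'
  rw [norm_smul, norm_smul, h1, h2, Real.norm_of_nonneg hs.1, Real.norm_of_nonneg ht.1] at hn
  have hst : t = s := mul_right_cancel₀ hr.ne' hn
  subst hst
  by_cases h0 : t = 0
  · simp [h0]
  · exfalso; apply hne
    have := smul_right_injective ℂ h0 h'
    simp only [sub_left_inj] at this
    exact this.symm

theorem seg_chord {o q c f₁ f₂ : ℂ} {r : ℝ} (hq : q ∈ sphere o r) (h1 : f₁ ∈ sphere o r)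
    (h2 : f₂ ∈ sphere o r) (h12 : f₁ ≠ f₂) (hq1 : q ≠ f₁) (hq2 : q ≠ f₂) :
    (segment ℝ q c ∩ segment ℝ f₁ f₂).Subsingleton := by
  rintro u ⟨hu1, hu2⟩ v ⟨hv1, hv2⟩
  by_contra huv
  rw [segment_eq_image_lineMap] at hu1 hv1
  obtain ⟨s, hs, rfl⟩ := hu1
  obtain ⟨t, ht, rfl⟩ := hv1
  set u := AffineMap.lineMap q c s with hu
  set v := AffineMap.lineMap q c t with hv
  have hst : s ≠ t := by rintro rfl; exact huv rfl
  have hsub : segment ℝ f₁ f₂ ⊆ line[ℝ, f₁, f₂] := by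
    intro z hz
    rw [segment_eq_image_lineMap] at hz
    obtain ⟨k, -, rfl⟩ := hz
    exact AffineMap.lineMap_mem_affineSpan_pair k f₁ f₂
  have hqm : q ∈ line[ℝ, f₁, f₂] := by
    have : q = AffineMap.lineMap u v (s / (s - t)) := by
      rw [hu, hv]
      simp only [AffineMap.lineMap_apply_module']
      have hst' : s - t ≠ 0 := sub_ne_zero.2 hst
      have : (s / (s - t)) * (t - s) + s = 0 := by field_simp; ring
      calc q = ((s / (s - t)) * (t - s) + s) • (c - q) + q := by rw [this]; simp
        _ = _ := by module
    rw [this]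
    exact AffineMap.lineMap_mem _ (hsub hu2) (hsub hv2)
  have hcol : Collinear ℝ {q, f₁, f₂} := collinear_insert_of_mem_affineSpan_pair hqm
  have hcs : EuclideanGeometry.Cospherical ({q, f₁, f₂} : Set ℂ) := by
    refine ⟨o, r, ?_⟩
    rintro p (rfl | rfl | rfl)
    · exact hq
    · exact h1
    · exact h2
  have := hcs.affineIndependent_of_ne hq1 hq2 h12
  rw [affineIndependent_iff_not_collinear_set] at this
  exact this hcol

variable {κ : Type}

/-- An admissible arc: starting at `x`, meeting `K` only in `x` and every `F f` at most once. -/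
def Ok (x : ℂ) (K : Set ℂ) (F : κ → Set ℂ) (A : Set ℂ) (c : ℂ) : Prop :=
  IsArc A x c ∧ A ∩ K ⊆ {x} ∧ ∀ f, (A ∩ F f).Subsingleton

def Reach (x : ℂ) (K : Set ℂ) (F : κ → Set ℂ) (b : ℂ) : Prop :=
  ∀ δ > 0, ∃ A₁ A₂ c₁ c₂, Ok x K F A₁ c₁ ∧ Ok x K F A₂ c₂ ∧ A₁ ∩ A₂ ⊆ {x} ∧
    Dist.dist c₁ b < δ ∧ Dist.dist c₂ b < δ

/-- A disc in which we can move the endpoints of a pair. -/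
def StepDisc (x : ℂ) (K : Set ℂ) (F : κ → Set ℂ) (o : ℂ) (r : ℝ) : Prop :=
  x ∉ closedBall o r ∧ (∀ p ∈ Metric.ball o r, p ∉ K) ∧
  ∀ f, Disjoint (closedBall o r) (F f) ∨ (F f \ Metric.ball o r ⊆ K ∧ ∃ f₁ f₂,
    f₁ ∈ sphere o r ∧ f₂ ∈ sphere o r ∧ f₁ ≠ f₂ ∧ f₁ ∈ F f ∧ f₂ ∈ F f ∧
    F f ∩ closedBall o r ⊆ segment ℝ f₁ f₂)

/-- extending one arc -/
theorem step_one {x : ℂ} {K : Set ℂ} {F : κ → Set ℂ} {o : ℂ} {r : ℝ}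
    (hx : ∀ f, x ∉ F f) (hD : StepDisc x K F o r) {A T : Set ℂ} {c q b : ℂ} {s : ℝ}
    (hA : Ok x K F A c) (hTA : T ⊆ A) (hT : IsArc T x q) (hq : q ∈ sphere o r)
    (hTq : T ∩ closedBall o r ⊆ {q}) (hb : b ∈ Metric.ball o r) (hs0 : 0 < s) (hs1 : s < 1) :
    Ok x K F (T ∪ segment ℝ q (AffineMap.lineMap q b s)) (AffineMap.lineMap q b s) := by
  obtain ⟨hA1, hA2, hA3⟩ := hA
  obtain ⟨hD1, hD2, hD3⟩ := hD
  set c' : ℂ := AffineMap.lineMap q b s with hc'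
  have hqb : q ≠ b := by
    rintro rfl
    rw [Metric.mem_ball] at hb; rw [mem_sphere] at hq; linarith
  have hqc : q ≠ c' := by
    intro h
    rw [hc', eq_comm, AffineMap.lineMap_eq_left_iff] at h
    rcases h with h | h
    · exact hqb h
    · linarith
  have hc'seg : c' ∈ segment ℝ q b := by
    rw [segment_eq_image_lineMap]; exact ⟨s, ⟨hs0.le, hs1.le⟩, rfl⟩
  have hc'b : c' ∈ Metric.ball o r := seg_ball hq hb hc'seg hqc.symm
  have hqx : q ≠ x := by
    rintro rfl
    exact hD1 (sphere_subset_closedBall hq)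
  have hqK : q ∉ K := fun h => hqx (hA2 ⟨hTA hT.right_mem, h⟩)
  have hsegB : segment ℝ q c' ⊆ closedBall o r := fun z hz =>
    seg_closedBall (sphere_subset_closedBall hq) (ball_subset_closedBall hc'b) hz
  refine ⟨?_, ?_, ?_⟩
  · apply hT.trans (isArc_segment hqc)
    rintro z ⟨h1, h2⟩
    exact hTq ⟨h1, hsegB h2⟩
  · rintro z ⟨h1 | h1, h2⟩
    · exact hA2 ⟨hTA h1, h2⟩
    · exfalso
      by_cases hz : z = q
      · exact hqK (hz ▸ h2)
      · exact hD2 z (seg_ball hq hc'b h1 hz) h2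
  · intro f
    rcases hD3 f with h | ⟨hFK, f₁, f₂, g1, g2, g12, gF1, gF2, hF⟩
    · apply (hA3 f).anti
      rintro z ⟨h1 | h1, h2⟩
      · exact ⟨hTA h1, h2⟩
      · exact (Set.disjoint_left.1 h (hsegB h1) h2).elim
    · have hsph : ∀ p ∈ sphere o r, p ∉ Metric.ball o r := by
        intro p hp hp'
        rw [Metric.mem_ball] at hp'; rw [mem_sphere] at hp; linarith
      apply (seg_chord (c := c') hq g1 g2 g12 (fun h => hqK (h ▸ hFK ⟨gF1, hsph _ g1⟩))
        (fun h => hqK (h ▸ hFK ⟨gF2, hsph _ g2⟩))).anti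
      rintro z ⟨h1 | h1, h2⟩
      · exfalso
        by_cases hzb : z ∈ Metric.ball o r
        · have : z = q := hTq ⟨h1, ball_subset_closedBall hzb⟩
          subst this
          exact hsph _ hq hzb
        · have : z = x := hA2 ⟨hTA h1, hFK ⟨h2, hzb⟩⟩
          subst this
          exact hx f h2
      · exact ⟨h1, hF ⟨h2, hsegB h1⟩⟩

theorem step {x : ℂ} {K : Set ℂ} {F : κ → Set ℂ} {o : ℂ} {r : ℝ}
    (hx : ∀ f, x ∉ F f) (hD : StepDisc x K F o r) {b b' : ℂ} (hb : b ∈ Metric.ball o r)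
    (hb' : b' ∈ Metric.ball o r) (h : Reach x K F b) : Reach x K F b' := by
  intro δ hδ
  obtain ⟨ε, hε, hεb⟩ := Metric.isOpen_ball.mem_nhds hb |> Metric.mem_nhds_iff.1
  obtain ⟨A₁, A₂, c₁, c₂, h1, h2, h12, d1, d2⟩ := h ε hε
  have hc1 : c₁ ∈ closedBall o r := ball_subset_closedBall (hεb d1)
  have hc2 : c₂ ∈ closedBall o r := ball_subset_closedBall (hεb d2)
  obtain ⟨T₁, q₁, t1, u1, v1, w1⟩ := h1.1.firstHitBall hD.1 ⟨c₁, h1.1.right_mem, hc1⟩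
  obtain ⟨T₂, q₂, t2, u2, v2, w2⟩ := h2.1.firstHitBall hD.1 ⟨c₂, h2.1.right_mem, hc2⟩
  have hqx : ∀ q ∈ sphere o r, q ≠ x := by
    rintro q hq rfl
    exact hD.1 (sphere_subset_closedBall hq)
  have hq12 : q₁ ≠ q₂ := by
    intro h
    exact hqx q₁ v1 (h12 ⟨t1 u1.right_mem, h ▸ t2 u2.right_mem⟩)
  -- choose the parameter
  have hex : ∃ s : ℝ, 0 < s ∧ s < 1 ∧ Dist.dist (AffineMap.lineMap q₁ b' s : ℂ) b' < δ ∧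
      Dist.dist (AffineMap.lineMap q₂ b' s : ℂ) b' < δ := by
    have l1 : ∀ q : ℂ, ∀ᶠ s : ℝ in nhdsWithin 1 (Iio 1), Dist.dist (AffineMap.lineMap q b' s : ℂ) b' < δ := by
      intro q
      have : Filter.Tendsto (fun s : ℝ => (AffineMap.lineMap q b' s : ℂ)) (nhds 1) (nhds b') := by
        have := (AffineMap.lineMap_continuous (R := ℝ) (p := q) (q := b')).tendsto 1
        simpa using this
      exact (this.eventually (Metric.ball_mem_nhds b' hδ)).filter_mono nhdsWithin_le_nhds
    have l2 : ∀ᶠ s : ℝ in nhdsWithin 1 (Iio 1), 0 < s ∧ s < 1 := by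
      filter_upwards [self_mem_nhdsWithin, nhdsWithin_le_nhds (lt_mem_nhds (zero_lt_one' ℝ))] with s a b
      exact ⟨b, a⟩
    obtain ⟨s, ⟨a, b⟩, c, d⟩ := (l2.and ((l1 q₁).and (l1 q₂))).exists
    exact ⟨s, a, b, c, d⟩
  obtain ⟨s, s0, s1, e1, e2⟩ := hex
  refine ⟨_, _, _, _, step_one hx hD h1 t1 u1 v1 w1 hb' s0 s1,
    step_one hx hD h2 t2 u2 v2 w2 hb' s0 s1, ?_, e1, e2⟩
  have hin : ∀ q ∈ sphere o r, ∀ z, z ∈ segment ℝ q (AffineMap.lineMap q b' s : ℂ) →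
      ∃ k : ℝ, k < 1 ∧ z = AffineMap.lineMap q b' k := by
    intro q hq z hz
    rw [segment_eq_image_lineMap] at hz
    obtain ⟨k, hk, rfl⟩ := hz
    refine ⟨k * s, by nlinarith [hk.1, hk.2, s0, s1], ?_⟩
    simp only [AffineMap.lineMap_apply_module']
    module
  have hsub : ∀ q ∈ sphere o r, segment ℝ q (AffineMap.lineMap q b' s : ℂ) ⊆ segment ℝ q b' := by
    intro q hq
    apply (convex_segment q b').segment_subset (left_mem_segment ℝ q b')
    rw [segment_eq_image_lineMap]; exact ⟨s, ⟨s0.le, s1.le⟩, rfl⟩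
  have hcl : ∀ q ∈ sphere o r, segment ℝ q b' ⊆ closedBall o r := fun q hq z hz =>
    seg_closedBall (sphere_subset_closedBall hq) (ball_subset_closedBall hb') hz
  rintro z ⟨z1 | z1, z2 | z2⟩
  · exact h12 ⟨t1 z1, t2 z2⟩
  · exfalso
    have : z = q₁ := w1 ⟨z1, hcl _ v2 (hsub _ v2 z2)⟩
    subst this
    exact hq12 (seg_sphere v2 hb' (hsub _ v2 z2) v1)
  · exfalso
    have : z = q₂ := w2 ⟨z2, hcl _ v1 (hsub _ v1 z1)⟩
    subst this
    exact hq12 (seg_sphere v1 hb' (hsub _ v1 z1) v2).symm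
  · exfalso
    obtain ⟨k, hk, e⟩ := hin _ v1 z z1
    obtain ⟨k', hk', e'⟩ := hin _ v2 z z2
    exact seg_two v1 v2 hq12 hb' hk hk' e e'

theorem reach_all {x : ℂ} {K : Set ℂ} {F : κ → Set ℂ} (hx : ∀ f, x ∉ F f) {E : Set ℂ}
    (hE : IsPreconnected E)
    (hd : ∀ b ∈ E, ∃ o r, b ∈ Metric.ball o r ∧ StepDisc x K F o r) {b b' : ℂ} (hb : b ∈ E)
    (hb' : b' ∈ E) (h : Reach x K F b) : Reach x K F b' := by
  have := hE.induction₂ (fun u v => (Reach x K F u ↔ Reach x K F v)) (by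
    intro u hu
    obtain ⟨o, r, h1, h2⟩ := hd u hu
    filter_upwards [nhdsWithin_le_nhds (isOpen_ball.mem_nhds h1)] with v hv
    exact ⟨step hx h2 h1 hv, step hx h2 hv h1⟩) (by intro u v w _ _ _; exact Iff.trans)
    (by intro u v _ _; exact Iff.symm) hb hb'
  exact this.1 h

theorem reach_base {x : ℂ} {K : Set ℂ} {F : κ → Set ℂ} {r : ℝ} (hr : 0 < r)
    (hKc : IsClosed K) {Q : Set ℂ} (hQ : ∀ q ∈ Q, q ∈ sphere x r ∧ q ∈ K)
    (hK : ∀ p ∈ K, p ∈ closedBall x r → ∃ q ∈ Q, p ∈ segment ℝ x q)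
    (hF : ∀ f, Disjoint (closedBall x r) (F f)) {q₀ : ℂ} (h0 : q₀ ∈ sphere x r) (h0K : q₀ ∉ K) :
    Reach x K F q₀ := by
  have hok : ∀ q ∈ sphere x r, q ∉ K → Ok x K F (segment ℝ x q) q := by
    intro q hq hqK
    have hxq : x ≠ q := by
      rintro rfl
      rw [mem_sphere, _root_.dist_self] at hq; linarith
    have hsub : segment ℝ x q ⊆ closedBall x r := fun z hz =>
      seg_closedBall (mem_closedBall_self hr.le) (sphere_subset_closedBall hq) hz
    refine ⟨isArc_segment hxq, ?_, ?_⟩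
    · rintro z ⟨h1, h2⟩
      obtain ⟨q', hq', hz⟩ := hK z h2 (hsub h1)
      refine seg_radial hr hq (hQ q' hq').1 ?_ h1 hz
      rintro rfl
      exact hqK (hQ q hq').2
    · intro f z hz
      exact (Set.disjoint_left.1 (hF f) (hsub hz.1) hz.2).elim
  intro δ hδ
  have hex : ∃ q ∈ sphere x r, q ∉ K ∧ Dist.dist q q₀ < δ ∧ q ≠ q₀ := by
    have hcont : Filter.Tendsto (fun θ : ℝ => x + (q₀ - x) * Complex.exp (θ * Complex.I))
        (nhds 0) (nhds q₀) := by
      have : Continuous (fun θ : ℝ => x + (q₀ - x) * Complex.exp (θ * Complex.I)) := by fun_prop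
      have := this.tendsto 0
      simpa using this
    have e1 := hcont.eventually (Metric.ball_mem_nhds q₀ hδ)
    have e2 := hcont.eventually (hKc.isOpen_compl.mem_nhds h0K)
    have e3 : ∀ᶠ θ : ℝ in nhdsWithin 0 (Ioi 0), 0 < θ ∧ θ < 1 :=
      Ioo_mem_nhdsGT (by norm_num)
    obtain ⟨θ, ⟨a, b⟩, c, d⟩ := (e3.and ((e1.and e2).filter_mono nhdsWithin_le_nhds)).exists
    have hq0 : q₀ - x ≠ 0 := by
      intro h
      rw [mem_sphere, dist_eq_norm, h, norm_zero] at h0; linarith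
    refine ⟨_, ?_, d, c, ?_⟩
    · rw [mem_sphere, dist_eq_norm, add_sub_cancel_left, norm_mul, Complex.norm_exp_ofReal_mul_I,
        mul_one, ← dist_eq_norm]
      exact h0
    · intro h
      have h' : (q₀ - x) * Complex.exp (θ * Complex.I) = (q₀ - x) * 1 := by
        rw [mul_one]; rw [eq_sub_iff_add_eq, add_comm]; exact h
      have := mul_left_cancel₀ hq0 h'
      have him := congrArg Complex.im this
      rw [Complex.exp_ofReal_mul_I_im, Complex.one_im] at him
      have := Real.sin_pos_of_pos_of_lt_pi a (by linarith [Real.pi_gt_three])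
      linarith
  obtain ⟨q, hq, hqK, hqd, hqne⟩ := hex
  refine ⟨_, _, _, _, hok q₀ h0 h0K, hok q hq hqK, ?_, by simpa using hδ, hqd⟩
  rintro z ⟨h1, h2⟩
  exact seg_radial hr h0 hq hqne.symm h1 h2

end CrAux

namespace CrAux
open Set Metric

/-- polar coordinates around `y`, with reference direction (and unit) `u`. -/
noncomputable def pol (y u : ℂ) (ρ θ : ℝ) : ℂ := y + (ρ : ℂ) * u * Complex.exp (θ * Complex.I)

theorem pol_norm (y u : ℂ) {ρ : ℝ} (hρ : 0 ≤ ρ) (θ : ℝ) : Dist.dist (pol y u ρ θ) y = ρ * ‖u‖ := by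
  rw [dist_eq_norm, pol, add_sub_cancel_left, norm_mul, norm_mul, Complex.norm_exp_ofReal_mul_I,
    mul_one, Complex.norm_real, Real.norm_of_nonneg hρ]

theorem pol_zero (y u : ℂ) (θ : ℝ) : pol y u 0 θ = y := by simp [pol]

theorem pol_cont (y u : ℂ) : Continuous (fun p : ℝ × ℝ => pol y u p.1 p.2) := by
  unfold pol
  fun_prop

theorem pol_inj_left {y u : ℂ} (hu : u ≠ 0) {ρ ρ' θ θ' : ℝ} (hρ : 0 ≤ ρ) (hρ' : 0 ≤ ρ')
    (h : pol y u ρ θ = pol y u ρ' θ') : ρ = ρ' := by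
  have := congrArg (fun z => Dist.dist z y) h
  rw [pol_norm y u hρ, pol_norm y u hρ'] at this
  exact mul_right_cancel₀ (norm_ne_zero_iff.2 hu) this

theorem pol_inj_right {y u : ℂ} (hu : u ≠ 0) {ρ ρ' θ θ' : ℝ} (hρ : 0 < ρ) (hρ' : 0 ≤ ρ')
    (h1 : θ - θ' < 2 * Real.pi) (h2 : θ' - θ < 2 * Real.pi)
    (h : pol y u ρ θ = pol y u ρ' θ') : θ = θ' := by
  have e := pol_inj_left hu hρ.le hρ' h
  subst e
  have h3 : Complex.exp (θ * Complex.I) = Complex.exp (θ' * Complex.I) := by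
    have hne : (ρ : ℂ) * u ≠ 0 := mul_ne_zero (by exact_mod_cast hρ.ne') hu
    exact mul_left_cancel₀ hne (add_left_cancel h)
  rw [Complex.exp_eq_exp_iff_exists_int] at h3
  obtain ⟨n, hn⟩ := h3
  have h4 : θ = θ' + n * (2 * Real.pi) := by
    have := congrArg Complex.im hn
    simp at this
    convert this using 1
  have hpi := Real.pi_pos
  have hn0 : n = 0 := by
    have a1 : (n : ℝ) < 1 := by
      by_contra hh
      push Not at hh
      nlinarith
    have a2 : (-1 : ℝ) < n := by
      by_contra hh
      push Not at hh
      nlinarith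
    have b1 : n < 1 := by exact_mod_cast a1
    have b2 : -1 < n := by exact_mod_cast a2
    omega
  rw [h4, hn0]; simp

/-- radial segment of radius `R` -/
def spoke (y u : ℂ) (R θ : ℝ) : Set ℂ := (fun ρ => pol y u ρ θ) '' Icc 0 R

def spiral (y u : ℂ) (θ₀ θ : ℝ) : Set ℂ :=
  (fun t : ℝ => pol y u ((1 + t) / 2) ((1 - t) * θ₀ + t * θ)) '' Icc 0 1

theorem isArc_spoke {y u : ℂ} (hu : u ≠ 0) {R : ℝ} (hR : 0 < R) (θ : ℝ) :
    IsArc (spoke y u R θ) y (pol y u R θ) := by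
  have := IsArc.of_Icc hR (fun ρ => pol y u ρ θ)
    ((pol_cont y u).comp (by fun_prop : Continuous fun ρ : ℝ => (ρ, θ))).continuousOn
    (fun a ha b hb h => pol_inj_left hu ha.1 hb.1 h) rfl
  simp only [pol_zero] at this
  exact this

theorem isArc_spiral {y u : ℂ} (hu : u ≠ 0) (θ₀ θ : ℝ) :
    IsArc (spiral y u θ₀ θ) (pol y u (1 / 2) θ₀) (pol y u 1 θ) := by
  have := IsArc.of_Icc zero_lt_one (fun t : ℝ => pol y u ((1 + t) / 2) ((1 - t) * θ₀ + t * θ))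
    ((pol_cont y u).comp (by fun_prop :
      Continuous fun t : ℝ => ((1 + t) / 2, (1 - t) * θ₀ + t * θ))).continuousOn
    (fun a ha b hb h => by
      have := pol_inj_left hu (by linarith [ha.1]) (by linarith [hb.1]) h
      linarith) rfl
  convert this using 1
  · rfl
  · norm_num
  · norm_num

theorem spoke_sub {y u : ℂ} {R θ : ℝ} (hR : R ≤ 1) : spoke y u R θ ⊆ closedBall y ‖u‖ := by
  rintro _ ⟨ρ, h, rfl⟩
  rw [mem_closedBall, pol_norm y u h.1]
  have := norm_nonneg u
  nlinarith [h.1, h.2]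

theorem spiral_sub {y u : ℂ} {θ₀ θ : ℝ} : spiral y u θ₀ θ ⊆ closedBall y ‖u‖ := by
  rintro _ ⟨t, h, rfl⟩
  simp only
  rw [mem_closedBall, pol_norm y u (by linarith [h.1])]
  have := norm_nonneg u
  nlinarith [h.1, h.2]

theorem spoke_sphere {y u : ℂ} (hu : u ≠ 0) {θ : ℝ} {p : ℂ} (hp : p ∈ spoke y u 1 θ)
    (h : p ∈ sphere y ‖u‖) : p = pol y u 1 θ := by
  obtain ⟨ρ, hρ, rfl⟩ := hp
  simp only at h ⊢
  rw [mem_sphere, pol_norm y u hρ.1] at h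
  have : ρ = 1 := by
    have hn := norm_ne_zero_iff.2 hu
    field_simp at h; exact h
  rw [this]

theorem small_spoke_sphere {y u : ℂ} (hu : u ≠ 0) {θ : ℝ} {p : ℂ} (hp : p ∈ spoke y u (1 / 2) θ)
    (h : p ∈ sphere y ‖u‖) : False := by
  obtain ⟨ρ, hρ, rfl⟩ := hp
  simp only at h
  rw [mem_sphere, pol_norm y u hρ.1] at h
  have : ρ = 1 := by
    have hn := norm_ne_zero_iff.2 hu
    field_simp at h; exact h
  linarith [hρ.2]

theorem spiral_sphere {y u : ℂ} (hu : u ≠ 0) {θ₀ θ : ℝ} {p : ℂ} (hp : p ∈ spiral y u θ₀ θ)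
    (h : p ∈ sphere y ‖u‖) : p = pol y u 1 θ := by
  obtain ⟨t, ht, rfl⟩ := hp
  simp only at h ⊢
  rw [mem_sphere, pol_norm y u (by linarith [ht.1])] at h
  have : (1 + t) / 2 = 1 := by
    have hn := norm_ne_zero_iff.2 hu
    field_simp at h ⊢; exact h
  have h1 : t = 1 := by linarith
  subst h1; norm_num

theorem spoke_spoke {y u : ℂ} (hu : u ≠ 0) {R R' θ θ' : ℝ} (hne : θ ≠ θ')
    (h1 : θ - θ' < 2 * Real.pi) (h2 : θ' - θ < 2 * Real.pi) {p : ℂ}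
    (hp : p ∈ spoke y u R θ) (hp' : p ∈ spoke y u R' θ') : p = y := by
  obtain ⟨ρ, hρ, rfl⟩ := hp
  obtain ⟨ρ', hρ', e⟩ := hp'
  rcases hρ.1.eq_or_lt with h | h
  · simp only [← h, pol_zero]
  · exact (hne (pol_inj_right hu h hρ'.1 h1 h2 e.symm)).elim

theorem spiral_spiral {y u : ℂ} (hu : u ≠ 0) {θ₀ θ θ' : ℝ} (hne : θ ≠ θ')
    (h1 : θ - θ' < 2 * Real.pi) (h2 : θ' - θ < 2 * Real.pi) {p : ℂ}
    (hp : p ∈ spiral y u θ₀ θ) (hp' : p ∈ spiral y u θ₀ θ') : p = pol y u (1 / 2) θ₀ := by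
  obtain ⟨t, ht, rfl⟩ := hp
  obtain ⟨t', ht', e⟩ := hp'
  simp only at e ⊢
  have := pol_inj_left hu (by linarith [ht'.1]) (by linarith [ht.1]) e
  have e' : t' = t := by linarith
  subst e'
  have hpi := Real.pi_pos
  have h0 := ht.1
  have h1' := ht.2
  have := pol_inj_right hu (by linarith) (by linarith) (by nlinarith) (by nlinarith) e
  have h3 : t' * (θ - θ') = 0 := by linarith
  rcases mul_eq_zero.1 h3 with h | h
  · subst h; norm_num
  · exact (hne (by linarith)).elim

/-- if all angles in a window, a spiral meets a spoke at most once and only if between -/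
theorem spiral_spoke {y u : ℂ} (hu : u ≠ 0) {w R θ₀ θ α : ℝ} (h0 : θ₀ ∈ Ioo w (w + 2 * Real.pi))
    (h1 : θ ∈ Ioo w (w + 2 * Real.pi)) (h2 : α ∈ Ioo w (w + 2 * Real.pi)) {p : ℂ}
    (hp : p ∈ spiral y u θ₀ θ) (hp' : p ∈ spoke y u R α) :
    ∃ t ∈ Icc (0:ℝ) 1, p = pol y u ((1 + t) / 2) α ∧ α = (1 - t) * θ₀ + t * θ := by
  obtain ⟨t, ht, rfl⟩ := hp
  obtain ⟨ρ, hρ, e⟩ := hp'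
  simp only at e
  have e0 := pol_inj_left hu (hρ.1) (by linarith [ht.1]) e
  have hi : (1 - t) * θ₀ + t * θ ∈ Ioo w (w + 2 * Real.pi) := by
    have := (convex_Ioo w (w + 2 * Real.pi)) h0 h1 (by linarith [ht.2] : 0 ≤ 1 - t) ht.1 (by ring)
    simpa using this
  have := pol_inj_right hu (by linarith [ht.1]) (by linarith [ht.1])
    (by linarith [h2.1, h2.2, hi.1, hi.2]) (by linarith [h2.1, h2.2, hi.1, hi.2]) e
  refine ⟨t, ht, ?_, this⟩
  simp only [this]

theorem spiral_spoke_once {y u : ℂ} (hu : u ≠ 0) {w R θ₀ θ α : ℝ}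
    (h0 : θ₀ ∈ Ioo w (w + 2 * Real.pi))
    (h1 : θ ∈ Ioo w (w + 2 * Real.pi)) (h2 : α ∈ Ioo w (w + 2 * Real.pi)) (hne : θ ≠ θ₀) {p p' : ℂ}
    (hp : p ∈ spiral y u θ₀ θ) (hp' : p ∈ spoke y u R α)
    (hq : p' ∈ spiral y u θ₀ θ) (hq' : p' ∈ spoke y u R α) : p = p' := by
  obtain ⟨t, ht, rfl, e⟩ := spiral_spoke hu h0 h1 h2 hp hp'
  obtain ⟨s, hs, rfl, e'⟩ := spiral_spoke hu h0 h1 h2 hq hq'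
  have : (t - s) * (θ - θ₀) = 0 := by linarith
  rcases mul_eq_zero.1 this with h | h
  · rw [sub_eq_zero.1 h]
  · exact (hne (by linarith)).elim

def Btw (θ₀ θ α : ℝ) : Prop := (θ₀ < α ∧ α < θ) ∨ (θ < α ∧ α < θ₀)

theorem spiral_spoke_btw {y u : ℂ} (hu : u ≠ 0) {w R θ₀ θ α : ℝ}
    (h0 : θ₀ ∈ Ioo w (w + 2 * Real.pi))
    (h1 : θ ∈ Ioo w (w + 2 * Real.pi)) (h2 : α ∈ Ioo w (w + 2 * Real.pi))
    (hα : α ≠ θ) (hα' : α ≠ θ₀) {p : ℂ}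
    (hp : p ∈ spiral y u θ₀ θ) (hp' : p ∈ spoke y u R α) : Btw θ₀ θ α := by
  obtain ⟨t, ht, rfl, e⟩ := spiral_spoke hu h0 h1 h2 hp hp'
  have t0 : 0 < t := lt_of_le_of_ne ht.1 (by rintro rfl; apply hα'; linarith)
  have t1 : t < 1 := lt_of_le_of_ne ht.2 (by rintro rfl; apply hα; linarith)
  rcases lt_trichotomy θ₀ θ with h | h | h
  · left; constructor <;> nlinarith
  · exfalso; subst h; apply hα; linarith
  · right; constructor <;> nlinarith

theorem small_spoke_spiral {y u : ℂ} (hu : u ≠ 0) {θ₀ θ : ℝ} {p : ℂ}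
    (hp : p ∈ spoke y u (1 / 2) θ₀) (hp' : p ∈ spiral y u θ₀ θ) : p = pol y u (1 / 2) θ₀ := by
  obtain ⟨ρ, hρ, rfl⟩ := hp
  obtain ⟨t, ht, e⟩ := hp'
  simp only at e ⊢
  have := pol_inj_left hu (by linarith [ht.1]) hρ.1 e
  have : ρ = 1 / 2 := by linarith [ht.1, hρ.2]
  rw [this]

theorem center_not_spiral {y u : ℂ} (hu : u ≠ 0) {θ₀ θ : ℝ} : y ∉ spiral y u θ₀ θ := by
  rintro ⟨t, ht, e⟩
  simp only at e
  have := pol_inj_left (y := y) (θ' := 0) hu (by linarith [ht.1]) le_rfl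
    (e.trans (pol_zero y u 0).symm)
  linarith [ht.1]

end CrAux

namespace CrAux
open Set Metric

inductive OV (M N : Type)
  | x | y | b (c : M ⊕ N)

inductive EE (M N : Type)
  | x (c : M ⊕ N) | y (c : M ⊕ N) | f (i : M) (j : N)

inductive NV (M N : Type)
  | x | z | w | b (c : M ⊕ N)

inductive NE (M N : Type)
  | xz | xw | zw | o (e : EE M N)

variable {M N : Type}

def es : EE M N → OV M N
  | .x _ => .x | .y _ => .y | .f i _ => .b (.inl i)
def et : EE M N → OV M N
  | .x c => .b c | .y c => .b c | .f _ j => .b (.inr j)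

def os : Option (EE M N) → OV M N
  | none => .x | some e => es e
def ot : Option (EE M N) → OV M N
  | none => .y | some e => et e

def ns : NE M N → NV M N
  | .xz => .x | .xw => .x | .zw => .z
  | .o (.x _) => .x
  | .o (.y (.inl _)) => .z
  | .o (.y (.inr _)) => .w
  | .o (.f i _) => .b (.inl i)
def nt : NE M N → NV M N
  | .xz => .z | .xw => .w | .zw => .w
  | .o (.x c) => .b c
  | .o (.y c) => .b c
  | .o (.f _ j) => .b (.inr j)

/-- dropping the edge `xy`. -/
def restr (D : ISys (os (M := M) (N := N)) ot) : ISys (es (M := M) (N := N)) et where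
  pos := D.pos
  inj := D.inj
  S := fun e => D.S (some e)
  arc := fun e => D.arc (some e)
  avoid := fun e => D.avoid (some e)
  adj := fun i j h => D.adj (some i) (some j) (by simpa using h)
  once := fun i j h => D.once (some i) (some j) (by simpa using h)
  triple := fun i j k h h' h'' => D.triple (some i) (some j) (some k) (by simpa using h)
    (by simpa using h') (by simpa using h'')

structure Outer (D : ISys (os (M := M) (N := N)) ot) where
  u : ℂ
  hu : u ≠ 0
  T : EE M N → Set ℂ
  A : Bool → Set ℂ
  ang : M ⊕ N → ℝ
  eps : Bool → ℝ
  TX : ∀ c, IsArc (T (.x c)) (D.pos .x) (D.pos (.b c))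
  TF : ∀ i j, IsArc (T (.f i j)) (D.pos (.b (.inl i))) (D.pos (.b (.inr j)))
  TY : ∀ c, IsArc (T (.y c)) (D.pos (.b c)) (pol (D.pos .y) u 1 (ang c))
  AA : ∀ k, IsArc (A k) (D.pos .x) (pol (D.pos .y) u 1 (eps k))
  TXd : ∀ c, ∀ p ∈ T (.x c), p ∉ closedBall (D.pos .y) ‖u‖
  TFd : ∀ i j, ∀ p ∈ T (.f i j), p ∉ closedBall (D.pos .y) ‖u‖
  TYd : ∀ c, ∀ p ∈ T (.y c), p ∈ closedBall (D.pos .y) ‖u‖ → p = pol (D.pos .y) u 1 (ang c)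
  Ad : ∀ k, ∀ p ∈ A k, p ∈ closedBall (D.pos .y) ‖u‖ → p = pol (D.pos .y) u 1 (eps k)
  TT : ∀ i j, i ≠ j → ∀ p, p ∈ T i → p ∈ T j → p ∈ D.S (some i) ∧ p ∈ D.S (some j)
  TV : ∀ i v, v ≠ es i → v ≠ et i → D.pos v ∉ T i
  AX : ∀ k c p, p ∈ A k → p ∈ T (.x c) → p = D.pos .x
  AY : ∀ k c p, p ∈ A k → p ∉ T (.y c)
  AF : ∀ k i j p p', p ∈ A k → p ∈ T (.f i j) → p' ∈ A k → p' ∈ T (.f i j) → p = p'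
  AFc : ∀ k i j p, p ∈ A k → p ∈ T (.f i j) → D.Cross none (some (.f i j))
  AFF : ∀ k i j i' j' p, p ∈ A k → p ∈ T (.f i j) → p ∈ T (.f i' j') → i = i' ∧ j = j'
  AAx : ∀ p, p ∈ A false → p ∈ A true → p = D.pos .x
  eps_lt : eps false < eps true
  ang_gt : ∀ c, eps true < ang c
  ang_lt : ∀ c, ang c < eps false + 2 * Real.pi
  ang_inj : Function.Injective ang

inductive IK (M N : Type)
  | no | Z (a : Option M) | Y (b : Option N) | W

inductive OK (M N : Type)
  | no | A (k : Bool) | T (e : EE M N)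

def inn : NE M N → IK M N
  | .xz => .Z none | .xw => .Y none | .zw => .W
  | .o (.x _) => .no
  | .o (.y (.inl i)) => .Z (some i)
  | .o (.y (.inr j)) => .Y (some j)
  | .o (.f _ _) => .no

def out (k : Bool) : NE M N → OK M N
  | .xz => .A k | .xw => .A (!k) | .zw => .no
  | .o e => .T e

/-- The chosen lifts of the angles. -/
structure Lifts {D : ISys (os (M := M) (N := N)) ot} (O : Outer D) (k : Bool) where
  w : ℝ
  θ : ℝ
  α : Option M → ℝ
  β : Option N → ℝ
  hθ : θ ∈ Ioo w (w + 2 * Real.pi)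
  hα : ∀ a, α a ∈ Ioo w (w + 2 * Real.pi)
  hβ : ∀ b, β b ∈ Ioo w (w + 2 * Real.pi)
  αi : Function.Injective α
  βi : Function.Injective β
  αβ : ∀ a b, α a ≠ β b
  αθ : ∀ a, α a ≠ θ
  βθ : ∀ b, β b ≠ θ
  nb : ¬ Btw θ (β none) (α none)
  p1 : pol (D.pos .y) O.u 1 (α none) = pol (D.pos .y) O.u 1 (O.eps k)
  p2 : ∀ i, pol (D.pos .y) O.u 1 (α (some i)) = pol (D.pos .y) O.u 1 (O.ang (.inl i))
  p3 : pol (D.pos .y) O.u 1 (β none) = pol (D.pos .y) O.u 1 (O.eps !k)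
  p4 : ∀ j, pol (D.pos .y) O.u 1 (β (some j)) = pol (D.pos .y) O.u 1 (O.ang (.inr j))

variable {D : ISys (os (M := M) (N := N)) ot} {O : Outer D} {k : Bool}

namespace Lifts
variable (L : Lifts O k)

def Inn : IK M N → Set ℂ
  | .no => ∅
  | .Z a => spoke (D.pos .y) O.u 1 (L.α a)
  | .Y b => spiral (D.pos .y) O.u L.θ (L.β b)
  | .W => spoke (D.pos .y) O.u (1 / 2) L.θ

noncomputable def wp : ℂ := pol (D.pos .y) O.u (1 / 2) L.θ

def InC : IK M N → IK M N → Prop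
  | .Z a, .Y b => Btw L.θ (L.β b) (L.α a)
  | .Y b, .Z a => Btw L.θ (L.β b) (L.α a)
  | _, _ => False

theorem diff {w a b : ℝ} (ha : a ∈ Ioo w (w + 2 * Real.pi)) (hb : b ∈ Ioo w (w + 2 * Real.pi)) :
    a - b < 2 * Real.pi := by linarith [ha.1, ha.2, hb.1, hb.2]

theorem inn_pair {κ κ' : IK M N} (hne : κ ≠ κ') {p : ℂ} (h : p ∈ L.Inn κ) (h' : p ∈ L.Inn κ') :
    p = D.pos .y ∨ p = L.wp ∨ L.InC κ κ' := by
  have hu := O.hu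
  rcases κ with _ | a | b | _ <;> rcases κ' with _ | a' | b' | _
  all_goals try exact h.elim
  all_goals try exact h'.elim
  · exact Or.inl (spoke_spoke hu (fun h => hne (by rw [L.αi h])) (diff (L.hα _) (L.hα _))
      (diff (L.hα _) (L.hα _)) h h')
  · exact Or.inr (Or.inr (spiral_spoke_btw hu L.hθ (L.hβ _) (L.hα _) (L.αβ _ _) (L.αθ _) h' h))
  · exact Or.inl (spoke_spoke hu (L.αθ _) (diff (L.hα _) L.hθ) (diff L.hθ (L.hα _)) h h')
  · exact Or.inr (Or.inr (spiral_spoke_btw hu L.hθ (L.hβ _) (L.hα _) (L.αβ _ _) (L.αθ _) h h'))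
  · exact Or.inr (Or.inl (spiral_spiral hu (fun h => hne (by rw [L.βi h])) (diff (L.hβ _) (L.hβ _))
      (diff (L.hβ _) (L.hβ _)) h h'))
  · exact Or.inr (Or.inl (small_spoke_spiral hu h' h))
  · exact Or.inl (spoke_spoke hu (L.αθ _).symm (diff L.hθ (L.hα _)) (diff (L.hα _) L.hθ) h h')
  · exact Or.inr (Or.inl (small_spoke_spiral hu h h'))
  · exact (hne rfl).elim

theorem inn_once {κ κ' : IK M N} (hc : L.InC κ κ') {p p' : ℂ} (h : p ∈ L.Inn κ) (h' : p ∈ L.Inn κ')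
    (g : p' ∈ L.Inn κ) (g' : p' ∈ L.Inn κ') : p = p' := by
  rcases κ with _ | a | b | _ <;> rcases κ' with _ | a' | b' | _
  all_goals try exact hc.elim
  · exact spiral_spoke_once O.hu L.hθ (L.hβ _) (L.hα _) (L.βθ _) h' h g' g
  · exact spiral_spoke_once O.hu L.hθ (L.hβ _) (L.hα _) (L.βθ _) h h' g g'

theorem inC_triple {κ κ' κ'' : IK M N} (h1 : L.InC κ κ') (h2 : L.InC κ κ'') (h3 : L.InC κ' κ'') :
    False := by
  rcases κ with _ | a | b | _ <;> rcases κ' with _ | a' | b' | _ <;>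
    rcases κ'' with _ | a'' | b'' | _ <;> first | exact h1 | exact h2 | exact h3

theorem inn_sub (κ : IK M N) : L.Inn κ ⊆ closedBall (D.pos .y) ‖O.u‖ := by
  rcases κ with _ | a | b | _
  · exact empty_subset _
  · exact spoke_sub le_rfl
  · exact spiral_sub
  · exact spoke_sub (by norm_num)

def R : IK M N → Set ℂ
  | .no => ∅
  | .Z a => {pol (D.pos .y) O.u 1 (L.α a)}
  | .Y b => {pol (D.pos .y) O.u 1 (L.β b)}
  | .W => ∅

theorem inn_sphere (κ : IK M N) : L.Inn κ ∩ sphere (D.pos .y) ‖O.u‖ ⊆ L.R κ := by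
  rintro p ⟨h1, h2⟩
  rcases κ with _ | a | b | _
  · exact h1
  · exact spoke_sphere O.hu h1 h2
  · exact spiral_sphere O.hu h1 h2
  · exact (small_spoke_sphere O.hu h1 h2).elim

theorem R_sphere (κ : IK M N) : L.R κ ⊆ sphere (D.pos .y) ‖O.u‖ := by
  have : ∀ t, pol (D.pos .y) O.u 1 t ∈ sphere (D.pos .y) ‖O.u‖ := fun t => by
    rw [mem_sphere, pol_norm _ _ zero_le_one, one_mul]
  rcases κ with _ | a | b | _
  · exact empty_subset _
  · exact singleton_subset_iff.2 (this _)
  · exact singleton_subset_iff.2 (this _)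
  · exact empty_subset _

theorem R_disj {κ κ' : IK M N} (hne : κ ≠ κ') {p : ℂ} (h : p ∈ L.R κ) (h' : p ∈ L.R κ') : False := by
  have key : ∀ s t, s ∈ Ioo L.w (L.w + 2 * Real.pi) → t ∈ Ioo L.w (L.w + 2 * Real.pi) →
      p = pol (D.pos .y) O.u 1 s → p = pol (D.pos .y) O.u 1 t → s = t := by
    intro s t hs ht h1 h2
    exact pol_inj_right O.hu zero_lt_one zero_le_one (diff hs ht) (diff ht hs) (h1.symm.trans h2)
  rcases κ with _ | a | b | _ <;> rcases κ' with _ | a' | b' | _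
  all_goals try exact h.elim
  all_goals try exact h'.elim
  · exact hne (by rw [L.αi (key _ _ (L.hα _) (L.hα _) h h')])
  · exact L.αβ _ _ (key _ _ (L.hα _) (L.hβ _) h h')
  · exact L.αβ _ _ (key _ _ (L.hβ _) (L.hα _) h h').symm
  · exact hne (by rw [L.βi (key _ _ (L.hβ _) (L.hβ _) h h')])

end Lifts

namespace Outer
variable (O)

def Out : OK M N → Set ℂ
  | .no => ∅
  | .A k => O.A k
  | .T e => O.T e

def OutC (_ : Outer D) : OK M N → OK M N → Prop
  | .T e, .T e' => D.Cross (some e) (some e')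
  | .A _, .T (.f i j) => D.Cross none (some (.f i j))
  | .T (.f i j), .A _ => D.Cross none (some (.f i j))
  | _, _ => False

theorem y_not_T (e : EE M N) : D.pos .y ∉ O.T e := by
  intro h
  have hc : D.pos .y ∈ closedBall (D.pos .y) ‖O.u‖ := mem_closedBall_self (norm_nonneg _)
  rcases e with c | c | ⟨i, j⟩
  · exact O.TXd c _ h hc
  · have h0 := pol_inj_left O.hu le_rfl zero_le_one
      ((pol_zero (D.pos .y) O.u 0).trans (O.TYd c (D.pos .y) h hc))
    norm_num at h0
  · exact O.TFd i j _ h hc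

theorem out_pair {κ κ' : OK M N} (hne : κ ≠ κ') {p : ℂ} (h : p ∈ O.Out κ) (h' : p ∈ O.Out κ')
    (hx : p ≠ D.pos .x) (hb : ∀ c, p ≠ D.pos (.b c)) : O.OutC κ κ' := by
  rcases κ with _ | k | e <;> rcases κ' with _ | k' | e'
  all_goals try exact h.elim
  all_goals try exact h'.elim
  · exfalso
    have hkk : k ≠ k' := fun h => hne (by rw [h])
    rcases k <;> rcases k'
    · exact hkk rfl
    · exact hx (O.AAx p h h')
    · exact hx (O.AAx p h' h)
    · exact hkk rfl
  · rcases e' with c | c | ⟨i, j⟩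
    · exact (hx (O.AX _ _ _ h h')).elim
    · exact (O.AY _ _ _ h h').elim
    · exact O.AFc _ _ _ _ h h'
  · rcases e with c | c | ⟨i, j⟩
    · exact (hx (O.AX _ _ _ h' h)).elim
    · exact (O.AY _ _ _ h' h).elim
    · exact O.AFc _ _ _ _ h' h
  · have hee : e ≠ e' := fun h => hne (by rw [h])
    obtain ⟨h1, h2⟩ := O.TT e e' hee p h h'
    refine ⟨by simpa using hee, p, h1, h2, ?_⟩
    rintro (_ | _ | c) hv
    · exact hx hv
    · rw [hv] at h
      exact O.y_not_T e h
    · exact hb c hv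

theorem out_once {κ κ' : OK M N} (hne : κ ≠ κ') {p p' : ℂ} (h : p ∈ O.Out κ) (h' : p ∈ O.Out κ')
    (g : p' ∈ O.Out κ) (g' : p' ∈ O.Out κ')
    (hx : p ≠ D.pos .x) (hb : ∀ c, p ≠ D.pos (.b c))
    (gx : p' ≠ D.pos .x) (gb : ∀ c, p' ≠ D.pos (.b c)) : p = p' := by
  have hc := O.out_pair hne h h' hx hb
  rcases κ with _ | k | e <;> rcases κ' with _ | k' | e'
  all_goals try exact h.elim
  all_goals try exact h'.elim
  · exact hc.elim
  · rcases e' with c | c | ⟨i, j⟩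
    · exact hc.elim
    · exact hc.elim
    · exact O.AF _ _ _ _ _ h h' g g'
  · rcases e with c | c | ⟨i, j⟩
    · exact hc.elim
    · exact hc.elim
    · exact O.AF _ _ _ _ _ h' h g' g
  · have hee : e ≠ e' := fun h => hne (by rw [h])
    obtain ⟨h1, h2⟩ := O.TT e e' hee p h h'
    obtain ⟨g1, g2⟩ := O.TT e e' hee p' g g'
    refine D.once (some e) (some e') (by simpa using hee) p p' h1 h2 g1 g2 ?_ ?_
    · rintro (_ | _ | c) hv
      · exact hx hv
      · rw [hv] at h
        exact O.y_not_T e h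
      · exact hb c hv
    · rintro (_ | _ | c) hv
      · exact gx hv
      · rw [hv] at g
        exact O.y_not_T e g
      · exact gb c hv

theorem out_triple {κ κ' κ'' : OK M N} (h1 : κ ≠ κ') (h2 : κ ≠ κ'') (h3 : κ' ≠ κ'') {p : ℂ}
    (h : p ∈ O.Out κ) (h' : p ∈ O.Out κ') (h'' : p ∈ O.Out κ'')
    (hx : p ≠ D.pos .x) (hb : ∀ c, p ≠ D.pos (.b c)) : False := by
  have c1 := O.out_pair h1 h h' hx hb
  have c2 := O.out_pair h2 h h'' hx hb
  have c3 := O.out_pair h3 h' h'' hx hb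
  have key : ∀ k e e', e ≠ e' → O.OutC (.A k) (.T e) → O.OutC (.A k) (.T e') → p ∈ O.A k →
      p ∈ O.T e → p ∈ O.T e' → False := by
    intro k e e' hne d1 d2 m1 m2 m3
    rcases e with c | c | ⟨i, j⟩
    · exact d1
    · exact d1
    rcases e' with c | c | ⟨i', j'⟩
    · exact d2
    · exact d2
    obtain ⟨rfl, rfl⟩ := O.AFF _ _ _ _ _ _ m1 m2 m3
    exact hne rfl
  have sy : ∀ k e, O.OutC (.T e) (.A k) → O.OutC (.A k) (.T e) := by
    intro k e h
    rcases e with c | c | ⟨i, j⟩ <;> exact h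
  have ne' : ∀ {e e' : EE M N}, OK.T e ≠ .T e' → e ≠ e' := fun h h' => h (by rw [h'])
  rcases κ with _ | k | e
  · exact h
  · rcases κ' with _ | k' | e'
    · exact h'
    · exact c1
    rcases κ'' with _ | k'' | e''
    · exact h''
    · exact c2
    exact key k _ _ (ne' h3) c1 c2 h h' h''
  · rcases κ' with _ | k' | e'
    · exact h'
    · rcases κ'' with _ | k'' | e''
      · exact h''
      · exact c3
      exact key k' _ _ (ne' h2) (sy _ _ c1) c3 h' h h''
    rcases κ'' with _ | k'' | e''
    · exact h''
    · exact key k'' _ _ (ne' h1) (sy _ _ c2) (sy _ _ c3) h'' h h'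
    · obtain ⟨a1, a2⟩ := O.TT _ _ (ne' h1) p h h'
      obtain ⟨_, a3⟩ := O.TT _ _ (ne' h2) p h h''
      obtain ⟨v, hv⟩ := D.triple (some e) (some e') (some e'') (by simpa using ne' h1)
        (by simpa using ne' h2) (by simpa using ne' h3) p a1 a2 a3
      rcases v with _ | _ | c
      · exact hx hv
      · rw [hv] at h
        exact O.y_not_T e h
      · exact hb c hv

end Outer
end CrAux

namespace CrAux
open Set Metric

variable {M N : Type} {D : ISys (os (M := M) (N := N)) ot} {O : Outer D} {k : Bool}

theorem old_cross_nadj {e e' : EE M N} (h : D.Cross (some e) (some e'))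
    (ha : es e = es e' ∨ es e = et e' ∨ et e = es e' ∨ et e = et e') : False := by
  obtain ⟨hne, p, h1, h2, h3⟩ := h
  obtain ⟨v, hv⟩ := D.adj _ _ hne ha p h1 h2
  exact h3 v hv

theorem outC_adj {i j : NE M N} (h : O.OutC (out k i) (out k j))
    (ha : ns i = ns j ∨ ns i = nt j ∨ nt i = ns j ∨ nt i = nt j) : False := by
  rcases i with _ | _ | _ | (c | (c | c) | ⟨a, b⟩) <;>
  rcases j with _ | _ | _ | (c' | (c' | c') | ⟨a', b'⟩)
  all_goals first | exact h | skip
  all_goals simp only [ns, nt, reduceCtorEq, or_self, or_false, false_or, NV.b.injEq,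
    Sum.inl.injEq, Sum.inr.injEq] at ha
  all_goals exact old_cross_nadj h (by simp [es, et, ha])

namespace Lifts
variable (L : Lifts O k)

theorem inC_adj {i j : NE M N} (h : L.InC (inn i) (inn j))
    (ha : ns i = ns j ∨ ns i = nt j ∨ nt i = ns j ∨ nt i = nt j) : False := by
  rcases i with _ | _ | _ | (c | (c | c) | ⟨a, b⟩) <;>
  rcases j with _ | _ | _ | (c' | (c' | c') | ⟨a', b'⟩)
  all_goals first | exact h | exact L.nb h | skip
  all_goals simp [ns, nt] at ha

theorem outC_inC {i j : NE M N} (h : O.OutC (out k i) (out k j)) (h' : L.InC (inn i) (inn j)) :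
    False := by
  rcases i with _ | _ | _ | (c | (c | c) | ⟨a, b⟩) <;>
  rcases j with _ | _ | _ | (c' | (c' | c') | ⟨a', b'⟩)
  all_goals first | exact h | exact h' | skip
  all_goals exact old_cross_nadj h (by simp [es, et])

theorem inn_inj {i j : NE M N} (hne : i ≠ j) (h : inn i = inn j) : inn i = .no := by
  rcases i with _ | _ | _ | (c | (c | c) | ⟨a, b⟩) <;>
  rcases j with _ | _ | _ | (c' | (c' | c') | ⟨a', b'⟩)
  all_goals simp_all [inn]

theorem out_inj {i j : NE M N} (hne : i ≠ j) : out k i ≠ out k j := by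
  rcases k <;> rcases i with _ | _ | _ | e <;> rcases j with _ | _ | _ | e' <;> simp_all [out]

theorem out_rim (i : NE M N) {p : ℂ} (h : p ∈ O.Out (out k i))
    (hc : p ∈ closedBall (D.pos .y) ‖O.u‖) : p ∈ L.R (inn i) := by
  rcases i with _ | _ | _ | (c | (c | c) | ⟨a, b⟩)
  · exact (O.Ad k p h hc).trans L.p1.symm
  · exact (O.Ad (!k) p h hc).trans L.p3.symm
  · exact h
  · exact (O.TXd c p h hc).elim
  · exact (O.TYd _ p h hc).trans (L.p2 _).symm
  · exact (O.TYd _ p h hc).trans (L.p4 _).symm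
  · exact (O.TFd a b p h hc).elim

theorem out_inn {i j : NE M N} (hne : i ≠ j) {p : ℂ} (h : p ∈ O.Out (out k i))
    (h' : p ∈ L.Inn (inn j)) : False := by
  have hc := L.inn_sub _ h'
  have h1 := L.out_rim i h hc
  have h2 := L.inn_sphere _ ⟨h', L.R_sphere _ h1⟩
  by_cases he : inn i = inn j
  · have := inn_inj hne he
    rw [this] at h1
    exact h1
  · exact L.R_disj he h1 h2

noncomputable def npos : NV M N → ℂ
  | .x => D.pos .x
  | .z => D.pos .y
  | .w => L.wp
  | .b c => D.pos (.b c)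

theorem x_out : D.pos .x ∉ closedBall (D.pos .y) ‖O.u‖ := fun h =>
  (O.AA false).ne (O.Ad false _ (O.AA false).left_mem h)

theorem b_out (c : M ⊕ N) : D.pos (.b c) ∉ closedBall (D.pos .y) ‖O.u‖ :=
  O.TXd c _ (O.TX c).right_mem

theorem u_pos : 0 < ‖O.u‖ := norm_pos_iff.2 O.hu

theorem y_ball : D.pos .y ∈ Metric.ball (D.pos .y) ‖O.u‖ := Metric.mem_ball_self u_pos

theorem w_ball : L.wp ∈ Metric.ball (D.pos .y) ‖O.u‖ := by
  rw [Metric.mem_ball, wp, pol_norm _ _ (by norm_num)]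
  have := u_pos (O := O)
  linarith

theorem w_ne : L.wp ≠ D.pos .y := by
  intro h
  have := pol_inj_left (θ' := 0) O.hu (by norm_num) le_rfl (h.trans (pol_zero (D.pos .y) O.u 0).symm)
  norm_num at this

theorem ball_not_out (L : Lifts O k) {i : NE M N} {p : ℂ} (h : p ∈ Metric.ball (D.pos .y) ‖O.u‖) :
    p ∉ O.Out (out k i) := by
  intro h'
  have := L.R_sphere _ (L.out_rim i h' (ball_subset_closedBall h))
  rw [Metric.mem_ball] at h; rw [mem_sphere] at this
  linarith

theorem npos_inj : Function.Injective L.npos := by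
  have hx := x_out (O := O)
  have hy := ball_subset_closedBall (y_ball (O := O))
  have hw := ball_subset_closedBall (L.w_ball)
  have hwn := L.w_ne
  have hb := b_out (O := O)
  intro a b h
  rcases a with _ | _ | _ | c <;> rcases b with _ | _ | _ | c'
  all_goals simp only [npos] at h
  all_goals first
    | rfl
    | exact (hx (h ▸ hy)).elim
    | exact (hx (h ▸ hw)).elim
    | exact (hb _ (h ▸ hy)).elim
    | exact (hb _ (h ▸ hw)).elim
    | exact (hwn h).elim
    | exact (hwn h.symm).elim
    | (have := D.inj h; simp_all)

def Sn (i : NE M N) : Set ℂ := O.Out (out k i) ∪ L.Inn (inn i)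

theorem sn_pair {i j : NE M N} (hne : i ≠ j) {p : ℂ} (h : p ∈ L.Sn i) (h' : p ∈ L.Sn j) :
    (p ∈ O.Out (out k i) ∧ p ∈ O.Out (out k j)) ∨ (p ∈ L.Inn (inn i) ∧ p ∈ L.Inn (inn j)) := by
  rcases h with h | h <;> rcases h' with h' | h'
  · exact Or.inl ⟨h, h'⟩
  · exact (L.out_inn hne h h').elim
  · exact (L.out_inn hne.symm h' h).elim
  · exact Or.inr ⟨h, h'⟩

theorem inn_pair' {i j : NE M N} (hne : i ≠ j) {p : ℂ} (h : p ∈ L.Inn (inn i))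
    (h' : p ∈ L.Inn (inn j)) (hv : ∀ v, p ≠ L.npos v) : L.InC (inn i) (inn j) := by
  by_cases he : inn i = inn j
  · rw [inn_inj hne he] at h
    exact h.elim
  · rcases L.inn_pair he h h' with e | e | e
    · exact (hv .z e).elim
    · exact (hv .w e).elim
    · exact e

theorem sn_arc (i : NE M N) : IsArc (L.Sn i) (L.npos (ns i)) (L.npos (nt i)) := by
  have hR : ∀ i : NE M N, O.Out (out k i) ∩ L.Inn (inn i) ⊆ L.R (inn i) := fun i p hp =>
    L.out_rim i hp.1 (L.inn_sub _ hp.2)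
  rcases i with _ | _ | _ | (c | (c | c) | ⟨a, b⟩)
  · refine (O.AA k).trans (b := pol (D.pos .y) O.u 1 (O.eps k)) ?_ ((hR .xz).trans ?_)
    · have := (isArc_spoke (y := D.pos .y) O.hu zero_lt_one (L.α none)).symm
      rw [L.p1] at this
      exact this
    · exact singleton_subset_singleton.2 L.p1
  · refine (O.AA (!k)).trans (b := pol (D.pos .y) O.u 1 (O.eps !k)) ?_ ((hR .xw).trans ?_)
    · have := (isArc_spiral (y := D.pos .y) O.hu L.θ (L.β none)).symm
      rw [L.p3] at this
      exact this
    · exact singleton_subset_singleton.2 L.p3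
  · have := (isArc_spoke (y := D.pos .y) O.hu (by norm_num : (0:ℝ) < 1 / 2) L.θ)
    have e : L.Sn .zw = spoke (D.pos .y) O.u (1 / 2) L.θ := empty_union _
    rw [e]; exact this
  · have e : L.Sn (.o (.x c)) = O.T (.x c) := union_empty _
    rw [e]; exact O.TX c
  · have := (O.TY (.inl c)).trans (c := D.pos .y) (T := L.Inn (.Z (some c))) ?_ ((hR (.o (.y (.inl c)))).trans ?_)
    · exact this.symm
    · have := (isArc_spoke (y := D.pos .y) O.hu zero_lt_one (L.α (some c))).symm
      rw [L.p2] at this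
      exact this
    · exact singleton_subset_singleton.2 (L.p2 c)
  · have := (O.TY (.inr c)).trans (c := L.wp) (T := L.Inn (.Y (some c))) ?_ ((hR (.o (.y (.inr c)))).trans ?_)
    · exact this.symm
    · have := (isArc_spiral (y := D.pos .y) O.hu L.θ (L.β (some c))).symm
      rw [L.p4] at this
      exact this
    · exact singleton_subset_singleton.2 (L.p4 c)
  · have e : L.Sn (.o (.f a b)) = O.T (.f a b) := union_empty _
    rw [e]; exact O.TF a b

theorem sn_avoid (i : NE M N) (v : NV M N) (h1 : v ≠ ns i) (h2 : v ≠ nt i) : L.npos v ∉ L.Sn i := by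
  have hbA : ∀ c k, D.pos (.b c) ∉ O.A k := fun c k h => by
    have := D.inj (O.AX k c _ h (O.TX c).right_mem)
    simp at this
  rintro (h | h)
  · rcases v with _ | _ | _ | c
    · rcases i with _ | _ | _ | (c | (c | c) | ⟨a, b⟩)
      · exact h1 rfl
      · exact h1 rfl
      · exact h
      · exact h1 rfl
      · exact O.TV _ _ (by simp [es]) (by simp [et]) h
      · exact O.TV _ _ (by simp [es]) (by simp [et]) h
      · exact O.TV _ _ (by simp [es]) (by simp [et]) h
    · exact L.ball_not_out y_ball h
    · exact L.ball_not_out L.w_ball h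
    · rcases i with _ | _ | _ | (c' | (c' | c') | ⟨a, b⟩)
      · exact hbA _ _ h
      · exact hbA _ _ h
      · exact h
      all_goals exact O.TV _ _ (by simpa [es, ns, nt] using h1) (by simpa [et, ns, nt] using h2) h
  · rcases v with _ | _ | _ | c
    · exact x_out (L.inn_sub _ h)
    · rcases i with _ | _ | _ | (c' | (c' | c') | ⟨a, b⟩)
      · exact h2 rfl
      · exact center_not_spiral O.hu h
      · exact h1 rfl
      · exact h
      · exact h1 rfl
      · exact center_not_spiral O.hu h
      · exact h
    · have key : ∀ a, L.wp ∉ spoke (D.pos .y) O.u 1 (L.α a) := fun a h =>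
        L.w_ne (spoke_spoke O.hu (L.αθ a) (diff (L.hα _) L.hθ) (diff L.hθ (L.hα _)) h
          (isArc_spoke O.hu (by norm_num) L.θ).right_mem)
      rcases i with _ | _ | _ | (c' | (c' | c') | ⟨a, b⟩)
      · exact key _ h
      · exact h2 rfl
      · exact h2 rfl
      · exact h
      · exact key _ h
      · exact h1 rfl
      · exact h
    · exact b_out c (L.inn_sub _ h)

noncomputable def newSys : ISys (ns (M := M) (N := N)) nt where
  pos := L.npos
  inj := L.npos_inj
  S := L.Sn
  arc := L.sn_arc
  avoid := L.sn_avoid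
  adj := by
    intro i j hne ha p h h'
    by_contra hv
    push Not at hv
    rcases L.sn_pair hne h h' with ⟨g, g'⟩ | ⟨g, g'⟩
    · exact outC_adj (O.out_pair (out_inj hne) g g' (hv .x) (fun c => hv (.b c))) ha
    · exact L.inC_adj (L.inn_pair' hne g g' hv) ha
  once := by
    intro i j hne p q h1 h2 h3 h4 hp hq
    rcases L.sn_pair hne h1 h2 with ⟨g, g'⟩ | ⟨g, g'⟩ <;>
      rcases L.sn_pair hne h3 h4 with ⟨f, f'⟩ | ⟨f, f'⟩
    · exact O.out_once (out_inj hne) g g' f f' (hp .x) (fun c => hp (.b c)) (hq .x) (fun c => hq (.b c))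
    · exact (L.outC_inC (O.out_pair (out_inj hne) g g' (hp .x) (fun c => hp (.b c)))
        (L.inn_pair' hne f f' hq)).elim
    · exact (L.outC_inC (O.out_pair (out_inj hne) f f' (hq .x) (fun c => hq (.b c)))
        (L.inn_pair' hne g g' hp)).elim
    · exact L.inn_once (L.inn_pair' hne g g' hp) g g' f f'
  triple := by
    intro i j l h1 h2 h3 p g1 g2 g3
    by_contra hv
    push Not at hv
    rcases L.sn_pair h1 g1 g2 with ⟨a, a'⟩ | ⟨a, a'⟩ <;>
      rcases g3 with b | b
    · exact O.out_triple (out_inj h1) (out_inj h2) (out_inj h3) a a' b (hv .x) (fun c => hv (.b c))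
    · exact L.out_inn h2 a b
    · exact L.out_inn h2.symm b a
    · exact L.inC_triple (L.inn_pair' h1 a a' hv) (L.inn_pair' h2 a b hv) (L.inn_pair' h3 a' b hv)

theorem new_cross {i j : NE M N} (h : L.newSys.Cross i j) :
    O.OutC (out k i) (out k j) ∨ L.InC (inn i) (inn j) := by
  obtain ⟨hne, p, h1, h2, hv⟩ := h
  rcases L.sn_pair hne h1 h2 with ⟨g, g'⟩ | ⟨g, g'⟩
  · exact Or.inl (O.out_pair (out_inj hne) g g' (hv .x) (fun c => hv (.b c)))
  · exact Or.inr (L.inn_pair' hne g g' hv)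

def ZE : Option M → NE M N
  | none => .xz | some i => .o (.y (.inl i))
def YE : Option N → NE M N
  | none => .xw | some j => .o (.y (.inr j))

theorem new_cr [Finite M] [Finite N] : L.newSys.cr ≤ (restr D).cr +
    4 * {q : M × N | D.Cross none (some (.f q.1 q.2))}.ncard +
    2 * {q : Option M × Option N | Btw L.θ (L.β q.2) (L.α q.1)}.ncard := by
  have : Finite (EE M N) := by
    let g : EE M N → (M ⊕ N) ⊕ (M ⊕ N) ⊕ (M × N) := fun e => match e with
      | .x c => .inl c | .y c => .inr (.inl c) | .f i j => .inr (.inr (i, j))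
    apply Finite.of_injective g
    rintro (c | c | ⟨i, j⟩) (c' | c' | ⟨i', j'⟩) h <;> simp_all [g]
  set E : Set (M × N) := {q : M × N | D.Cross none (some (.f q.1 q.2))} with hE
  set B : Set (Option M × Option N) := {q | Btw L.θ (L.β q.2) (L.α q.1)} with hB
  set C : Set (EE M N × EE M N) := {q | (restr D).Cross q.1 q.2} with hC
  have hsub : {q : NE M N × NE M N | L.newSys.Cross q.1 q.2} ⊆
      ((fun q : EE M N × EE M N => (NE.o q.1, NE.o q.2)) '' C) ∪
      (((fun q : M × N => (NE.xz, NE.o (.f q.1 q.2))) '' E) ∪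
      (((fun q : M × N => (NE.xw, NE.o (.f q.1 q.2))) '' E) ∪
      (((fun q : M × N => (NE.o (.f q.1 q.2), NE.xz)) '' E) ∪
      (((fun q : M × N => (NE.o (.f q.1 q.2), NE.xw)) '' E) ∪
      (((fun q : Option M × Option N => (ZE q.1, YE q.2)) '' B) ∪
      ((fun q : Option M × Option N => (YE q.2, ZE q.1)) '' B)))))) := by
    rintro ⟨i, j⟩ h
    rcases L.new_cross h with h | h
    · rcases i with _ | _ | _ | e <;> rcases j with _ | _ | _ | e'
      all_goals first | exact h.elim | skip
      · rcases e' with c | c | ⟨a, b⟩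
        · exact h.elim
        · exact h.elim
        · exact Or.inr (Or.inl ⟨(a, b), h, rfl⟩)
      · rcases e' with c | c | ⟨a, b⟩
        · exact h.elim
        · exact h.elim
        · exact Or.inr (Or.inr (Or.inl ⟨(a, b), h, rfl⟩))
      · rcases e with c | c | ⟨a, b⟩
        · exact h.elim
        · exact h.elim
        · exact Or.inr (Or.inr (Or.inr (Or.inl ⟨(a, b), h, rfl⟩)))
      · rcases e with c | c | ⟨a, b⟩
        · exact h.elim
        · exact h.elim
        · exact Or.inr (Or.inr (Or.inr (Or.inr (Or.inl ⟨(a, b), h, rfl⟩))))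
      · refine Or.inl ⟨(e, e'), ?_, rfl⟩
        obtain ⟨h1, h2⟩ := (h : D.Cross (some e) (some e'))
        exact ⟨fun h => h1 (by simp only at h; rw [h]), h2⟩
    · have z1 : ∀ i : NE M N, ∀ a, inn i = .Z a → i = ZE a := by
        intro i a h
        rcases i with _ | _ | _ | (c | (c | c) | ⟨_, _⟩) <;> simp [inn] at h <;> subst h <;> rfl
      have y1 : ∀ i : NE M N, ∀ a, inn i = .Y a → i = YE a := by
        intro i a h
        rcases i with _ | _ | _ | (c | (c | c) | ⟨_, _⟩) <;> simp [inn] at h <;> subst h <;> rfl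
      simp only at h
      generalize ha : inn i = a at h
      generalize hb : inn j = b at h
      right; right; right; right; right
      rcases a with _ | a | a | _ <;> rcases b with _ | b | b | _
      all_goals first | exact h.elim | skip
      · rw [z1 i a ha, y1 j b hb]
        exact Or.inl ⟨(a, b), h, rfl⟩
      · rw [y1 i a ha, z1 j b hb]
        exact Or.inr ⟨(b, a), h, rfl⟩
  have i1 := ncard_image_le (f := fun q : EE M N × EE M N => (NE.o q.1, NE.o q.2)) (s := C) (Set.toFinite _)
  have i2 := ncard_image_le (f := fun q : M × N => ((NE.xz, NE.o (.f q.1 q.2)) : NE M N × NE M N)) (s := E) (Set.toFinite _)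
  have i3 := ncard_image_le (f := fun q : M × N => ((NE.xw, NE.o (.f q.1 q.2)) : NE M N × NE M N)) (s := E) (Set.toFinite _)
  have i4 := ncard_image_le (f := fun q : M × N => ((NE.o (.f q.1 q.2), NE.xz) : NE M N × NE M N)) (s := E) (Set.toFinite _)
  have i5 := ncard_image_le (f := fun q : M × N => ((NE.o (.f q.1 q.2), NE.xw) : NE M N × NE M N)) (s := E) (Set.toFinite _)
  have i6 := ncard_image_le (f := fun q : Option M × Option N => ((ZE q.1, YE q.2) : NE M N × NE M N)) (s := B) (Set.toFinite _)
  have i7 := ncard_image_le (f := fun q : Option M × Option N => ((YE q.2, ZE q.1) : NE M N × NE M N)) (s := B) (Set.toFinite _)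
  have hle := ncard_le_ncard hsub (by
    iterate 6 refine Set.Finite.union (Set.Finite.image _ (Set.toFinite _)) ?_
    exact Set.Finite.image _ (Set.toFinite _))
  have u1 := fun (a b : Set (NE M N × NE M N)) => ncard_union_le a b
  have e1 : L.newSys.cr = {q : NE M N × NE M N | L.newSys.Cross q.1 q.2}.ncard := rfl
  have e2 : (restr D).cr = C.ncard := rfl
  rw [e1, e2]
  refine hle.trans ((u1 _ _).trans ?_)
  have := (u1 ((fun q : M × N => ((NE.xz, NE.o (.f q.1 q.2)) : NE M N × NE M N)) '' E) _).trans
    (Nat.add_le_add i2 ((u1 ((fun q : M × N => ((NE.xw, NE.o (.f q.1 q.2)) : NE M N × NE M N)) '' E) _).trans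
    (Nat.add_le_add i3 ((u1 ((fun q : M × N => ((NE.o (.f q.1 q.2), NE.xz) : NE M N × NE M N)) '' E) _).trans
    (Nat.add_le_add i4 ((u1 ((fun q : M × N => ((NE.o (.f q.1 q.2), NE.xw) : NE M N × NE M N)) '' E) _).trans
    (Nat.add_le_add i5 ((u1 _ _).trans (Nat.add_le_add i6 i7)))))))))
  refine (Nat.add_le_add i1 this).trans ?_
  omega

end Lifts

/-- the old drawing's crossings -/
theorem old_cr [Finite M] [Finite N] (D : ISys (os (M := M) (N := N)) ot) :
    (restr D).cr + 2 * {q : M × N | D.Cross none (some (.f q.1 q.2))}.ncard ≤ D.cr := by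
  have : Finite (EE M N) := by
    let g : EE M N → (M ⊕ N) ⊕ (M ⊕ N) ⊕ (M × N) := fun e => match e with
      | .x c => .inl c | .y c => .inr (.inl c) | .f i j => .inr (.inr (i, j))
    apply Finite.of_injective g
    rintro (c | c | ⟨i, j⟩) (c' | c' | ⟨i', j'⟩) h <;> simp_all [g]
  set E : Set (M × N) := {q : M × N | D.Cross none (some (.f q.1 q.2))} with hE
  set C : Set (EE M N × EE M N) := {q | (restr D).Cross q.1 q.2} with hC
  let f1 : EE M N × EE M N → Option (EE M N) × Option (EE M N) := fun q => (some q.1, some q.2)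
  let f2 : M × N → Option (EE M N) × Option (EE M N) := fun q => (none, some (.f q.1 q.2))
  let f3 : M × N → Option (EE M N) × Option (EE M N) := fun q => (some (.f q.1 q.2), none)
  have j1 : Function.Injective f1 := by rintro ⟨a, b⟩ ⟨c, d⟩ h; simpa [f1] using h
  have j2 : Function.Injective f2 := by rintro ⟨a, b⟩ ⟨c, d⟩ h; simpa [f2] using h
  have j3 : Function.Injective f3 := by rintro ⟨a, b⟩ ⟨c, d⟩ h; simpa [f3] using h
  have hsub : f1 '' C ∪ (f2 '' E ∪ f3 '' E) ⊆
      {q : Option (EE M N) × Option (EE M N) | D.Cross q.1 q.2} := by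
    rintro _ (⟨⟨e, e'⟩, ⟨h, h'⟩, rfl⟩ | ⟨⟨a, b⟩, h, rfl⟩ | ⟨⟨a, b⟩, h, rfl⟩)
    · exact ⟨by simpa [f1] using h, h'⟩
    · exact h
    · exact ISys.Cross.symm h
  have := ncard_le_ncard hsub (Set.toFinite _)
  rw [ncard_union_eq _ (Set.toFinite _) (Set.toFinite _),
    ncard_union_eq _ (Set.toFinite _) (Set.toFinite _), ncard_image_of_injective _ j1,
    ncard_image_of_injective _ j2, ncard_image_of_injective _ j3] at this
  · have e1 : D.cr = {q : Option (EE M N) × Option (EE M N) | D.Cross q.1 q.2}.ncard := rfl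
    have e2 : (restr D).cr = C.ncard := rfl
    omega
  · rw [Set.disjoint_left]
    rintro _ ⟨⟨a, b⟩, h, rfl⟩ ⟨⟨c, d⟩, h', e⟩
    simp [f2, f3] at e
  · rw [Set.disjoint_left]
    rintro _ ⟨⟨a, b⟩, h, rfl⟩ (⟨⟨c, d⟩, h', e⟩ | ⟨⟨c, d⟩, h', e⟩)
    · simp [f1, f2] at e
    · simp [f1, f3] at e

end CrAux

namespace CrAux
open Set Metric Filter Topology

theorem reroute {S : Set ℂ} {a b p : ℂ} {r : ℝ} (hS : IsArc S a b) (hp : p ∈ S) (hr : 0 < r)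
    (ha : a ∉ closedBall p r) (hb : b ∉ closedBall p r) :
    ∃ T g₁ g₂, IsArc T a b ∧ T \ Metric.ball p r ⊆ S ∧ g₁ ∈ sphere p r ∧ g₂ ∈ sphere p r ∧ g₁ ≠ g₂ ∧
      g₁ ∈ T ∧ g₂ ∈ T ∧ T ∩ closedBall p r ⊆ segment ℝ g₁ g₂ := by
  have hpp : p ∈ closedBall p r := mem_closedBall_self hr.le
  have hsp : ∀ g ∈ sphere p r, g ≠ p := by
    rintro g hg rfl
    rw [mem_sphere, _root_.dist_self] at hg
    linarith
  obtain ⟨S₁, S₂, h1, h2, A1, A2, h12⟩ := hS.split hp (fun h => ha (h ▸ hpp)) (fun h => hb (h ▸ hpp))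
  obtain ⟨T₁, g₁, s1, B1, m1, c1⟩ := A1.firstHitBall ha ⟨p, A1.right_mem, hpp⟩
  obtain ⟨T₂, g₂, s2, B2, m2, c2⟩ := A2.symm.firstHitBall hb ⟨p, A2.left_mem, hpp⟩
  have hseg : segment ℝ g₁ g₂ ⊆ closedBall p r := fun z hz =>
    seg_closedBall (sphere_subset_closedBall m1) (sphere_subset_closedBall m2) hz
  have hTT : ∀ z, z ∈ T₁ → z ∈ T₂ → False := by
    intro z z1 z2
    have : z = p := h12 ⟨s1 z1, s2 z2⟩
    subst this
    exact hsp _ m1 (c1 ⟨z1, hpp⟩ : z = g₁).symm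
  have hne : g₁ ≠ g₂ := fun h => hTT g₁ B1.right_mem (h ▸ B2.right_mem)
  have hA : IsArc (T₁ ∪ segment ℝ g₁ g₂) a g₂ := B1.trans (isArc_segment hne)
    (fun z hz => c1 ⟨hz.1, hseg hz.2⟩)
  refine ⟨(T₁ ∪ segment ℝ g₁ g₂) ∪ T₂, g₁, g₂, hA.trans B2.symm ?_, ?_, m1, m2, hne,
    Or.inl (Or.inl B1.right_mem), Or.inr B2.right_mem, ?_⟩
  · rintro z ⟨z1 | z1, z2⟩
    · exact (hTT z z1 z2).elim
    · exact c2 ⟨z2, hseg z1⟩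
  · rintro z ⟨(z1 | z1) | z1, z2⟩
    · exact h1 (s1 z1)
    · by_cases e1 : z = g₁
      · rw [e1]; exact h1 (s1 B1.right_mem)
      by_cases e2 : z = g₂
      · rw [e2]; exact h2 (s2 B2.right_mem)
      exfalso
      apply z2
      apply openSegment_subset_ball_of_ne (sphere_subset_closedBall m1) (sphere_subset_closedBall m2) hne
      exact mem_openSegment_of_ne_left_right (Ne.symm e1) (Ne.symm e2) z1
    · exact h2 (s2 z1)
  · rintro z ⟨(z1 | z1) | z1, z2⟩
    · rw [show z = g₁ from c1 ⟨z1, z2⟩]; exact left_mem_segment ℝ _ _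
    · exact z1
    · rw [show z = g₂ from c2 ⟨z1, z2⟩]; exact right_mem_segment ℝ _ _

theorem ev_disj {o : ℂ} {C : Set ℂ} (hC : IsClosed C) (h : o ∉ C) :
    ∀ᶠ r in 𝓝[>] (0:ℝ), Disjoint (closedBall o r) C := by
  obtain ⟨ε, hε, hb⟩ := Metric.isOpen_iff.1 hC.isOpen_compl o h
  filter_upwards [Ioo_mem_nhdsGT hε] with r hr
  rw [Set.disjoint_left]
  intro z hz
  exact hb (lt_of_le_of_lt hz hr.2)

theorem ev_disj2 {a b : ℂ} (h : a ≠ b) :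
    ∀ᶠ r in 𝓝[>] (0:ℝ), Disjoint (closedBall a r) (closedBall b r) := by
  filter_upwards [Ioo_mem_nhdsGT (half_pos (dist_pos.2 h))] with r hr
  apply closedBall_disjoint_closedBall
  linarith [hr.2]

theorem ev_imp {p : Prop} {Q : ℝ → Prop} (h : p → ∀ᶠ r in 𝓝[>] (0:ℝ), Q r) :
    ∀ᶠ r in 𝓝[>] (0:ℝ), p → Q r := by
  by_cases hp : p
  · filter_upwards [h hp] with r hr _ using hr
  · filter_upwards with r h using (hp h).elim

theorem stepDisc_small {κ : Type} [Finite κ] {x : ℂ} {K : Set ℂ} {F : κ → Set ℂ} (hK : IsClosed K)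
    (hF : ∀ f, IsClosed (F f)) {b : ℂ} (hb : b ∉ K) (hbF : ∀ f, b ∉ F f) (hbx : b ≠ x) :
    ∃ ρ, 0 < ρ ∧ StepDisc x K F b ρ := by
  have e1 := ev_disj hK hb
  have e2 := eventually_all.2 (fun f => ev_disj (hF f) (hbF f))
  have e3 : ∀ᶠ r in 𝓝[>] (0:ℝ), Disjoint (closedBall b r) {x} := ev_disj isClosed_singleton hbx
  have e4 : ∀ᶠ r in 𝓝[>] (0:ℝ), 0 < r := self_mem_nhdsWithin
  obtain ⟨r, h1, h2, h3, h4⟩ := (e1.and (e2.and (e3.and e4))).exists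
  exact ⟨r, h4, fun h => Set.disjoint_left.1 h3 h rfl,
    fun p hp => Set.disjoint_left.1 h1 (ball_subset_closedBall hp), fun f => Or.inl (h2 f)⟩

theorem pol_arg {y u a : ℂ} (hu : u ≠ 0) (ha : a ∈ sphere y ‖u‖) :
    pol y u 1 (Complex.arg ((a - y) / u)) = a := by
  rw [mem_sphere, dist_eq_norm] at ha
  have hn : ‖(a - y) / u‖ = 1 := by
    rw [norm_div, ha, div_self (norm_ne_zero_iff.2 hu)]
  have := Complex.norm_mul_exp_arg_mul_I ((a - y) / u)
  rw [hn] at this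
  rw [pol]
  simp only [Complex.ofReal_one, one_mul] at this ⊢
  rw [this]
  field_simp
  ring

theorem pol_two_pi (y u : ℂ) (ρ θ : ℝ) : pol y u ρ (θ + 2 * Real.pi) = pol y u ρ θ := by
  simp only [pol]
  congr 2
  push_cast
  rw [add_mul, Complex.exp_add, Complex.exp_two_pi_mul_I, mul_one]

/-- lifted angle in `(0, 2π)` -/
theorem exists_angle {y u a : ℂ} (hu : u ≠ 0) (ha : a ∈ sphere y ‖u‖) (hne : a ≠ y + u) :
    ∃ θ, 0 < θ ∧ θ < 2 * Real.pi ∧ pol y u 1 θ = a := by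
  have h0 := pol_arg hu ha
  have h1 := Complex.arg_le_pi ((a - y) / u)
  have h2 := Complex.neg_pi_lt_arg ((a - y) / u)
  have hpi := Real.pi_pos
  set φ := Complex.arg ((a - y) / u) with hφ
  have hne0 : φ ≠ 0 := by
    intro h
    rw [h] at h0
    apply hne
    rw [← h0]; simp [pol]
  rcases lt_or_gt_of_ne hne0 with h | h
  · exact ⟨φ + 2 * Real.pi, by linarith, by linarith, by rw [pol_two_pi]; exact h0⟩
  · exact ⟨φ, h, by linarith, h0⟩

theorem exists_eta {y u : ℂ} (hu : u ≠ 0) {δ : ℝ} (hδ : 0 < δ) : ∃ η, 0 < η ∧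
    ∀ a ∈ sphere y ‖u‖, Dist.dist a (y + u) < η → ∃ ε, |ε| < δ ∧ pol y u 1 ε = a := by
  have hc : ContinuousAt (fun a : ℂ => Complex.arg ((a - y) / u)) (y + u) := by
    have h1 : ContinuousAt Complex.arg (((y + u) - y) / u) := by
      apply Complex.continuousAt_arg
      rw [add_sub_cancel_left, div_self hu]
      exact Complex.one_mem_slitPlane
    exact ContinuousAt.comp (f := fun a : ℂ => (a - y) / u) h1
      ((continuous_id.sub continuous_const).div_const u).continuousAt
  rw [Metric.continuousAt_iff] at hc
  obtain ⟨η, hη, h⟩ := hc δ hδ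
  refine ⟨η, hη, fun a ha had => ⟨_, ?_, pol_arg hu ha⟩⟩
  have := h had
  rw [add_sub_cancel_left, div_self hu, Complex.arg_one, Real.dist_0_eq_abs] at this
  exact this

end CrAux

namespace CrAux
open Set Metric Filter Topology

variable {M N : Type}

theorem sphere_not_ball {o p : ℂ} {r : ℝ} (h : p ∈ sphere o r) : p ∉ Metric.ball o r := by
  intro h'
  rw [Metric.mem_ball] at h'; rw [mem_sphere] at h; linarith

theorem exists_outer [Finite M] [Finite N] (D : ISys (os (M := M) (N := N)) ot) :
    Nonempty (Outer D) := by
  classical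
  -- abbreviations
  obtain ⟨x, hxdef⟩ : ∃ x, x = D.pos .x := ⟨_, rfl⟩
  obtain ⟨y, hydef⟩ : ∃ y, y = D.pos .y := ⟨_, rfl⟩
  obtain ⟨E, hE⟩ : ∃ E, E = D.S none := ⟨_, rfl⟩
  let SX : M ⊕ N → Set ℂ := fun c => D.S (some (.x c))
  let SY : M ⊕ N → Set ℂ := fun c => D.S (some (.y c))
  let SF : M × N → Set ℂ := fun q => D.S (some (.f q.1 q.2))
  let bp : M ⊕ N → ℂ := fun c => D.pos (.b c)
  let Cr : M × N → Prop := fun q => D.Cross none (some (.f q.1 q.2))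
  have hxy : x ≠ y := by
    rw [hxdef, hydef]; intro h; have := D.inj h; simp at this
  have Earc : IsArc E x y := by rw [hE, hxdef, hydef]; exact D.arc none
  have SXarc : ∀ c, IsArc (SX c) x (bp c) := by rw [hxdef]; exact fun c => D.arc (some (.x c))
  have SYarc : ∀ c, IsArc (SY c) y (bp c) := by rw [hydef]; exact fun c => D.arc (some (.y c))
  have SFarc : ∀ q, IsArc (SF q) (bp (.inl q.1)) (bp (.inr q.2)) :=
    fun q => D.arc (some (.f q.1 q.2))
  have xSY : ∀ c, x ∉ SY c := fun c => by
    rw [hxdef]; exact D.avoid (some (.y c)) .x (by simp [os, es]) (by simp [ot, et])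
  have ySX : ∀ c, y ∉ SX c := fun c => by
    rw [hydef]; exact D.avoid (some (.x c)) .y (by simp [os, es]) (by simp [ot, et])
  have xSF : ∀ c, x ∉ SF c := fun c => by
    rw [hxdef]; exact D.avoid (some (.f c.1 c.2)) .x (by simp [os, es]) (by simp [ot, et])
  have ySF : ∀ c, y ∉ SF c := fun c => by
    rw [hydef]; exact D.avoid (some (.f c.1 c.2)) .y (by simp [os, es]) (by simp [ot, et])
  have bE : ∀ c, bp c ∉ E := fun c => by
    rw [hE]; exact D.avoid none (.b c) (by simp [os]) (by simp [ot])
  have ESX : ∀ c p, p ∈ E → p ∈ SX c → p = x := by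
    intro c p h1 h2
    rw [hE] at h1
    obtain ⟨v, hv⟩ := D.adj none (some (.x c)) (by simp) (by simp [os, es]) p h1 h2
    rcases v with _ | _ | c'
    · rw [hv, hxdef]
    · rw [hv, ← hydef] at h2; exact (ySX c h2).elim
    · rw [hv, ← hE] at h1; exact (bE c' h1).elim
  have ESY : ∀ c p, p ∈ E → p ∈ SY c → p = y := by
    intro c p h1 h2
    rw [hE] at h1
    obtain ⟨v, hv⟩ := D.adj none (some (.y c)) (by simp) (by simp [os, ot, es]) p h1 h2
    rcases v with _ | _ | c'
    · rw [hv, ← hxdef] at h2; exact (xSY c h2).elim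
    · rw [hv, hydef]
    · rw [hv, ← hE] at h1; exact (bE c' h1).elim
  have EFv : ∀ q p, p ∈ E → p ∈ SF q → ∀ v, p ≠ D.pos v := by
    intro q p h1 h2 v hv
    rcases v with _ | _ | c'
    · rw [hv, ← hxdef] at h2; exact xSF q h2
    · rw [hv, ← hydef] at h2; exact ySF q h2
    · rw [hv] at h1; exact bE c' h1
  have ESF : ∀ q p, p ∈ E → p ∈ SF q → Cr q := by
    intro q p h1 h2
    exact ⟨by simp, p, hE ▸ h1, h2, EFv q p h1 h2⟩
  have hP : ∀ q, ∃ p, Cr q → p ∈ E ∧ p ∈ SF q := by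
    intro q
    by_cases h : Cr q
    · obtain ⟨_, p, h1, h2, h3⟩ := id h
      exact ⟨p, fun _ => ⟨hE ▸ h1, h2⟩⟩
    · exact ⟨0, fun h' => (h h').elim⟩
  choose P hP using hP
  have ESF1 : ∀ q p, p ∈ E → p ∈ SF q → p = P q := by
    intro q p h1 h2
    have hc := ESF q p h1 h2
    obtain ⟨h3, h4⟩ := hP q hc
    exact D.once none (some (.f q.1 q.2)) (by simp) p (P q) (hE ▸ h1) h2 (hE ▸ h3) h4
      (EFv q p h1 h2) (EFv q _ h3 h4)
  have PSF : ∀ q q', q ≠ q' → Cr q → P q ∉ SF q' := by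
    intro q q' hne hc h
    obtain ⟨h3, h4⟩ := hP q hc
    have hne' : some (EE.f q.1 q.2) ≠ some (EE.f q'.1 q'.2) := by
      intro h
      apply hne
      simp only [Option.some.injEq, EE.f.injEq] at h
      exact Prod.ext h.1 h.2
    obtain ⟨v, hv⟩ := D.triple none (some (.f q.1 q.2)) (some (.f q'.1 q'.2)) (by simp) (by simp)
      hne' (P q) (hE ▸ h3) h4 h
    exact EFv q _ h3 h4 v hv
  have Px : ∀ q, Cr q → P q ≠ x := fun q hc h => xSF q (h ▸ (hP q hc).2)
  have Py : ∀ q, Cr q → P q ≠ y := fun q hc h => ySF q (h ▸ (hP q hc).2)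
  -- choose the radius
  have ev : ∃ r : ℝ, 0 < r ∧ (∀ c, Disjoint (closedBall x r) (SY c)) ∧
      (∀ q, Disjoint (closedBall x r) (SF q)) ∧ Disjoint (closedBall x r) (closedBall y r) ∧
      (∀ c, Disjoint (closedBall y r) (SX c)) ∧ (∀ q, Disjoint (closedBall y r) (SF q)) ∧
      (∀ q, Cr q → ∀ c, Disjoint (closedBall (P q) r) (SX c)) ∧
      (∀ q, Cr q → ∀ c, Disjoint (closedBall (P q) r) (SY c)) ∧
      (∀ q, Cr q → ∀ q', q ≠ q' → Disjoint (closedBall (P q) r) (SF q')) ∧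
      (∀ q, Cr q → Disjoint (closedBall (P q) r) (closedBall x r)) ∧
      (∀ q, Cr q → Disjoint (closedBall (P q) r) (closedBall y r)) ∧
      (∀ q, Cr q → ∀ q', q ≠ q' → Cr q' → Disjoint (closedBall (P q) r) (closedBall (P q') r)) := by
    apply Eventually.exists (f := 𝓝[>] (0:ℝ))
    refine Eventually.and self_mem_nhdsWithin ?_
    refine Eventually.and (eventually_all.2 fun c => ev_disj (SYarc c).isClosed (xSY c)) ?_
    refine Eventually.and (eventually_all.2 fun c => ev_disj (SFarc c).isClosed (xSF c)) ?_
    refine Eventually.and (ev_disj2 hxy) ?_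
    refine Eventually.and (eventually_all.2 fun c => ev_disj (SXarc c).isClosed (ySX c)) ?_
    refine Eventually.and (eventually_all.2 fun c => ev_disj (SFarc c).isClosed (ySF c)) ?_
    refine Eventually.and (eventually_all.2 fun q => ev_imp fun hc => eventually_all.2 fun c =>
      ev_disj (SXarc c).isClosed fun h => Px q hc (ESX c _ (hP q hc).1 h)) ?_
    refine Eventually.and (eventually_all.2 fun q => ev_imp fun hc => eventually_all.2 fun c =>
      ev_disj (SYarc c).isClosed fun h => Py q hc (ESY c _ (hP q hc).1 h)) ?_
    refine Eventually.and (eventually_all.2 fun q => ev_imp fun hc => eventually_all.2 fun q' =>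
      ev_imp fun hne => ev_disj (SFarc q').isClosed (PSF q q' hne hc)) ?_
    refine Eventually.and (eventually_all.2 fun q => ev_imp fun hc => ev_disj2 (Px q hc)) ?_
    refine Eventually.and (eventually_all.2 fun q => ev_imp fun hc => ev_disj2 (Py q hc)) ?_
    refine eventually_all.2 fun q => ev_imp fun hc => eventually_all.2 fun q' =>
      ev_imp fun hne => ev_imp fun hc' => ev_disj2 fun h => PSF q q' hne hc (h ▸ (hP q' hc').2)
  obtain ⟨r, hr, a1, a2, a3, b1, b2, d1, d2, d3, d4, d5, d6⟩ := ev
  simp only [Set.disjoint_left] at a1 a2 a3 b1 b2 d1 d2 d3 d4 d5 d6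
  have bX : ∀ c, bp c ∉ closedBall x r := fun c h => a1 c h (SYarc c).right_mem
  have bY : ∀ c, bp c ∉ closedBall y r := fun c h => b1 c h (SXarc c).right_mem
  have bD : ∀ q, Cr q → ∀ c, bp c ∉ closedBall (P q) r := fun q hc c h => d1 q hc c h (SXarc c).right_mem
  have xX : x ∈ closedBall x r := mem_closedBall_self hr.le
  have yY : y ∈ closedBall y r := mem_closedBall_self hr.le
  have hsp : ∀ o g : ℂ, g ∈ sphere o r → g ≠ o := by
    rintro o g hg rfl
    rw [mem_sphere, _root_.dist_self] at hg
    linarith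
  -- the edges at x
  have hX : ∀ c, ∃ T q, IsArc T x (bp c) ∧ q ∈ sphere x r ∧ q ∈ SX c ∧ q ∈ T ∧
      (∀ p ∈ T, p ∈ closedBall x r → p ∈ segment ℝ x q) ∧ (∀ p ∈ T, p ∉ Metric.ball x r → p ∈ SX c) := by
    intro c
    obtain ⟨T, q, h1, h2, h3, h4⟩ := (SXarc c).symm.firstHitBall (bX c) ⟨x, (SXarc c).left_mem, xX⟩
    have hxq : x ≠ q := (hsp x q h3).symm
    have hseg : segment ℝ x q ⊆ closedBall x r := fun z hz =>
      seg_closedBall xX (sphere_subset_closedBall h3) hz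
    refine ⟨segment ℝ x q ∪ T, q, (isArc_segment hxq).trans h2.symm ?_, h3, h1 h2.right_mem,
      Or.inl (right_mem_segment ℝ _ _), ?_, ?_⟩
    · rintro z ⟨z1, z2⟩
      exact h4 ⟨z2, hseg z1⟩
    · rintro p (hp | hp) hb
      · exact hp
      · rw [show p = q from h4 ⟨hp, hb⟩]; exact right_mem_segment ℝ _ _
    · rintro p (hp | hp) hb
      · have : p = q := by
          rw [segment_symm] at hp
          by_contra hne
          exact hb (seg_ball h3 (Metric.mem_ball_self hr) hp hne)
        rw [this]; exact h1 h2.right_mem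
      · exact h1 hp
  choose TX qx TXarc qxs qxS qxT TXb TXS using hX
  have hY : ∀ c, ∃ T q, T ⊆ SY c ∧ IsArc T (bp c) q ∧ q ∈ sphere y r ∧ T ∩ closedBall y r ⊆ {q} :=
    fun c => (SYarc c).symm.firstHitBall (bY c) ⟨y, (SYarc c).left_mem, yY⟩
  choose TY qy TYS TYarc qys TYb using hY
  have hF : ∀ q, ∃ T, IsArc T (bp (.inl q.1)) (bp (.inr q.2)) ∧ (¬ Cr q → T = SF q) ∧
      (Cr q → T \ Metric.ball (P q) r ⊆ SF q ∧ ∃ g₁ g₂, g₁ ∈ sphere (P q) r ∧ g₂ ∈ sphere (P q) r ∧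
        g₁ ≠ g₂ ∧ g₁ ∈ T ∧ g₂ ∈ T ∧ T ∩ closedBall (P q) r ⊆ segment ℝ g₁ g₂) := by
    intro q
    by_cases h : Cr q
    · obtain ⟨T, g₁, g₂, h1, h2, h3⟩ := reroute (SFarc q) (hP q h).2 hr (bD q h _) (bD q h _)
      exact ⟨T, h1, fun h' => (h' h).elim, fun _ => ⟨h2, g₁, g₂, h3⟩⟩
    · exact ⟨SF q, SFarc q, fun _ => rfl, fun h' => (h h').elim⟩
  choose TF TFarc TFn TFc using hF
  have TFs : ∀ q p, p ∈ TF q → p ∈ SF q ∨ (Cr q ∧ p ∈ Metric.ball (P q) r) := by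
    intro q p h
    by_cases hc : Cr q
    · by_cases hb : p ∈ Metric.ball (P q) r
      · exact Or.inr ⟨hc, hb⟩
      · exact Or.inl ((TFc q hc).1 ⟨h, hb⟩)
    · rw [TFn q hc] at h; exact Or.inl h
  have TFX : ∀ q p, p ∈ TF q → p ∉ closedBall x r := by
    intro q p h hb
    rcases TFs q p h with h | ⟨hc, h⟩
    · exact a2 q hb h
    · exact d4 q hc (ball_subset_closedBall h) hb
  have TFY : ∀ q p, p ∈ TF q → p ∉ closedBall y r := by
    intro q p h hb
    rcases TFs q p h with h | ⟨hc, h⟩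
    · exact b2 q hb h
    · exact d5 q hc (ball_subset_closedBall h) hb
  have TFD : ∀ q q' p, q ≠ q' → Cr q → p ∈ TF q' → p ∉ closedBall (P q) r := by
    intro q q' p hne hc h hb
    rcases TFs q' p h with h | ⟨hc', h⟩
    · exact d3 q hc q' hne hb h
    · exact d6 q hc q' hne hc' hb (ball_subset_closedBall h)
  have TXs : ∀ c p, p ∈ TX c → p ∈ SX c ∨ p ∈ Metric.ball x r := by
    intro c p h
    by_cases hb : p ∈ Metric.ball x r
    · exact Or.inr hb
    · exact Or.inl (TXS c p h hb)
  have TXY : ∀ c p, p ∈ TX c → p ∉ closedBall y r := by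
    intro c p h hb
    rcases TXs c p h with h | h
    · exact b1 c hb h
    · exact a3 (ball_subset_closedBall h) hb
  have TXD : ∀ c q p, Cr q → p ∈ TX c → p ∉ closedBall (P q) r := by
    intro c q p hc h hb
    rcases TXs c p h with h | h
    · exact d1 q hc c hb h
    · exact d4 q hc hb (ball_subset_closedBall h)
  have xTF : ∀ q, x ∉ TF q := fun q h => TFX q x h xX
  -- the middle part of the edge `e`
  have hyX : y ∉ closedBall x r := fun h => a3 h yY
  have hxY : x ∉ closedBall y r := fun h => a3 xX h
  obtain ⟨E1, q0, hE1, E1arc, q0s, E1b⟩ := Earc.symm.firstHitBall hyX ⟨x, Earc.left_mem, xX⟩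
  obtain ⟨E2, q', hE2, E2arc, q's, E2b⟩ := E1arc.symm.firstHitBall (o := y) (r := r)
    (fun h => a3 (sphere_subset_closedBall q0s) h) ⟨y, E1arc.left_mem, yY⟩
  have E2E : E2 ⊆ E := hE2.trans hE1
  have E2x : ∀ p ∈ E2, p ∉ Metric.ball x r := by
    intro p hp hb
    have : p = q0 := E1b ⟨hE2 hp, ball_subset_closedBall hb⟩
    exact sphere_not_ball (this ▸ q0s) hb
  have E2y : ∀ p ∈ E2, p ∉ Metric.ball y r := by
    intro p hp hb
    have : p = q' := E2b ⟨hp, ball_subset_closedBall hb⟩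
    exact sphere_not_ball (this ▸ q's) hb
  obtain ⟨u, hudef⟩ : ∃ u, u = q' - y := ⟨_, rfl⟩
  have hur : ‖u‖ = r := by
    rw [mem_sphere, dist_eq_norm] at q's
    rw [hudef]; exact q's
  have hu : u ≠ 0 := norm_pos_iff.1 (hur ▸ hr)
  have hyu : y + u = q' := by rw [hudef]; ring
  have qyq' : ∀ c, qy c ≠ q' := by
    intro c h
    have h1 : q' ∈ SY c := h ▸ TYS c (TYarc c).right_mem
    exact hsp y q' q's (ESY c q' (E2E E2arc.right_mem) h1)
  have hang : ∀ c, ∃ θ, 0 < θ ∧ θ < 2 * Real.pi ∧ pol y u 1 θ = qy c := fun c =>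
    exists_angle hu (hur ▸ qys c) (hyu ▸ qyq' c)
  choose ang ang0 ang2 angp using hang
  obtain ⟨δ, hδ, hδc⟩ : ∃ δ : ℝ, 0 < δ ∧ ∀ c, δ < ang c ∧ ang c < 2 * Real.pi - δ := by
    apply Eventually.exists (f := 𝓝[>] (0:ℝ))
    refine Eventually.and self_mem_nhdsWithin (eventually_all.2 fun c => ?_)
    have := Ioo_mem_nhdsGT (lt_min (ang0 c) (sub_pos.2 (ang2 c)))
    filter_upwards [this] with t ht
    have h2 := lt_min_iff.1 ht.2
    exact ⟨h2.1, by linarith [h2.2]⟩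
  obtain ⟨η, hη, hηa⟩ := exists_eta (y := y) hu hδ
  rw [hur, hyu] at hηa
  -- the obstacle
  let K : Set ℂ := (⋃ c, TX c) ∪ (⋃ c, TY c) ∪ (⋃ q, (TF q \ (if Cr q then Metric.ball (P q) r else ∅))) ∪
    (closedBall y r \ Metric.ball q' η)
  have KX : ∀ c, TX c ⊆ K := fun c p hp => Or.inl (Or.inl (Or.inl (mem_iUnion.2 ⟨c, hp⟩)))
  have KY : ∀ c, TY c ⊆ K := fun c p hp => Or.inl (Or.inl (Or.inr (mem_iUnion.2 ⟨c, hp⟩)))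
  have KF : ∀ q p, p ∈ TF q → ¬ (Cr q ∧ p ∈ Metric.ball (P q) r) → p ∈ K := by
    intro q p h1 h2
    refine Or.inl (Or.inr (mem_iUnion.2 ⟨q, h1, ?_⟩))
    split_ifs with hc
    · exact fun h => h2 ⟨hc, h⟩
    · exact fun h => h
  have KB : ∀ p ∈ closedBall y r, p ∉ Metric.ball q' η → p ∈ K := fun p h1 h2 => Or.inr ⟨h1, h2⟩
  have Kel : ∀ p ∈ K, (∃ c, p ∈ TX c) ∨ (∃ c, p ∈ TY c) ∨
      (∃ q, p ∈ TF q ∧ ¬ (Cr q ∧ p ∈ Metric.ball (P q) r)) ∨ (p ∈ closedBall y r ∧ p ∉ Metric.ball q' η) := by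
    rintro p (((h | h) | h) | h)
    · exact Or.inl (mem_iUnion.1 h)
    · exact Or.inr (Or.inl (mem_iUnion.1 h))
    · obtain ⟨q, h1, h2⟩ := mem_iUnion.1 h
      refine Or.inr (Or.inr (Or.inl ⟨q, h1, ?_⟩))
      rintro ⟨hc, hb⟩
      rw [if_pos hc] at h2
      exact h2 hb
    · exact Or.inr (Or.inr (Or.inr h))
  have Kcl : IsClosed K := by
    refine ((IsClosed.union ?_ ?_).union ?_).union ?_
    · exact isClosed_iUnion_of_finite fun c => (TXarc c).isClosed
    · exact isClosed_iUnion_of_finite fun c => (TYarc c).isClosed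
    · refine isClosed_iUnion_of_finite fun q => (TFarc q).isClosed.sdiff ?_
      split_ifs
      · exact isOpen_ball
      · exact isOpen_empty
    · exact isClosed_closedBall.sdiff isOpen_ball
  clear_value K
  have E2K : ∀ p ∈ E2, p ∉ K := by
    intro p hp hK
    rcases Kel p hK with ⟨c, h⟩ | ⟨c, h⟩ | ⟨q, h, h'⟩ | ⟨h, h'⟩
    · have := ESX c p (E2E hp) (TXS c p h (E2x p hp))
      exact E2x p hp (this ▸ Metric.mem_ball_self hr)
    · have := ESY c p (E2E hp) (TYS c h)
      exact E2y p hp (this ▸ Metric.mem_ball_self hr)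
    · rcases TFs q p h with g | g
      · have hc := ESF q p (E2E hp) g
        have := ESF1 q p (E2E hp) g
        exact h' ⟨hc, this ▸ Metric.mem_ball_self hr⟩
      · exact h' g
    · have : p = q' := E2b ⟨hp, h⟩
      exact h' (this ▸ Metric.mem_ball_self hη)
  have hbase : Reach x K TF q0 := by
    refine reach_base hr Kcl (Q := range qx) ?_ ?_ ?_ q0s (E2K q0 E2arc.left_mem)
    · rintro _ ⟨c, rfl⟩
      exact ⟨qxs c, KX c (qxT c)⟩
    · intro p hK hb
      rcases Kel p hK with ⟨c, h⟩ | ⟨c, h⟩ | ⟨q, h, h'⟩ | ⟨h, h'⟩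
      · exact ⟨qx c, ⟨c, rfl⟩, TXb c p h hb⟩
      · exact (a1 c hb (TYS c h)).elim
      · exact (TFX q p h hb).elim
      · exact (a3 hb h).elim
    · intro q
      rw [Set.disjoint_left]
      exact fun p h1 h2 => TFX q p h2 h1
  have hE2F : ∀ b ∈ E2, (∀ q, Cr q → b ∉ Metric.ball (P q) r) → ∀ q, b ∉ TF q := by
    intro b hb hn q h
    exact E2K b hb (KF q b h (fun h' => hn q h'.1 h'.2))
  have hE2x : ∀ b ∈ E2, b ≠ x := by
    rintro b hb rfl
    exact E2x b hb (Metric.mem_ball_self hr)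
  have hstep : Reach x K TF q' := by
    refine reach_all xTF E2arc.isPreconnected ?_ E2arc.left_mem E2arc.right_mem hbase
    intro b hb
    by_cases hn : ∀ q, Cr q → b ∉ Metric.ball (P q) r
    · obtain ⟨ρ, hρ, hsd⟩ := stepDisc_small (x := x) Kcl (fun q => (TFarc q).isClosed) (E2K b hb)
        (hE2F b hb hn) (hE2x b hb)
      exact ⟨b, ρ, Metric.mem_ball_self hρ, hsd⟩
    · push Not at hn
      obtain ⟨q, hc, hbq⟩ := hn
      refine ⟨P q, r, hbq, fun h => d4 q hc h xX, ?_, ?_⟩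
      · intro p hp hK
        have hp' := ball_subset_closedBall hp
        rcases Kel p hK with ⟨c, h⟩ | ⟨c, h⟩ | ⟨q1, h, h'⟩ | ⟨h, h'⟩
        · exact TXD c q p hc h hp'
        · exact d2 q hc c hp' (TYS c h)
        · by_cases he : q = q1
          · subst he; exact h' ⟨hc, hp⟩
          · exact TFD q q1 p he hc h hp'
        · exact d5 q hc hp' h
      · intro q1
        by_cases he : q = q1
        · subst he
          right
          refine ⟨fun p hp => KF q p hp.1 (fun h => hp.2 h.2), (TFc q hc).2⟩
        · left
          rw [Set.disjoint_left]
          exact fun p h1 h2 => TFD q q1 p he hc h2 h1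
  have hq'n : ∀ q, Cr q → q' ∉ Metric.ball (P q) r := fun q hc h =>
    d5 q hc (ball_subset_closedBall h) (sphere_subset_closedBall q's)
  have hq'E := E2arc.right_mem
  obtain ⟨ρ, hρ, hsd⟩ := stepDisc_small (x := x) Kcl (fun q => (TFarc q).isClosed) (E2K q' hq'E)
    (hE2F q' hq'E hq'n) (hE2x q' hq'E)
  obtain ⟨b', hb'1, hb'2⟩ : ∃ b', b' ∈ Metric.ball q' ρ ∧ b' ∈ Metric.ball y r := by
    have hcl : q' ∈ closure (Metric.ball y r) := by
      rw [closure_ball y hr.ne']; exact sphere_subset_closedBall q's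
    obtain ⟨b', h1, h2⟩ := Metric.mem_closure_iff.1 hcl ρ hρ
    exact ⟨b', by rw [Metric.mem_ball, _root_.dist_comm]; exact h2, h1⟩
  have hreach := step xTF hsd (Metric.mem_ball_self hρ) hb'1 hstep
  obtain ⟨δ', hδ', hδb⟩ := Metric.isOpen_iff.1 (isOpen_ball (x := y) (ε := r)) b' hb'2
  obtain ⟨A₁, A₂, c₁, c₂, o1, o2, o12, e1, e2⟩ := hreach δ' hδ'
  have fin : ∀ A c, Ok x K TF A c → Dist.dist c b' < δ' → ∃ A' ε, A' ⊆ A ∧ IsArc A' x (pol y u 1 ε) ∧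
      |ε| < δ ∧ ∀ p ∈ A', p ∈ closedBall y r → p = pol y u 1 ε := by
    intro A c hok hd
    obtain ⟨A', a, h1, h2, h3, h4⟩ := hok.1.firstHitBall hxY
      ⟨c, hok.1.right_mem, ball_subset_closedBall (hδb hd)⟩
    have haK : a ∉ K := by
      intro h
      have : a = x := hok.2.1 ⟨h1 h2.right_mem, h⟩
      exact hxY (this ▸ sphere_subset_closedBall h3)
    have had : Dist.dist a q' < η := by
      by_contra hh
      exact haK (KB a (sphere_subset_closedBall h3) hh)
    obtain ⟨ε, hε, hεa⟩ := hηa a h3 had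
    rw [← hεa] at h2 h4
    exact ⟨A', ε, h1, h2, hε, fun p hp hb => h4 ⟨hp, hb⟩⟩
  obtain ⟨B₁, ε₁, s1, f1, g1, k1⟩ := fin A₁ c₁ o1 e1
  obtain ⟨B₂, ε₂, s2, f2, g2, k2⟩ := fin A₂ c₂ o2 e2
  have pY : ∀ ε, pol y u 1 ε ∈ closedBall y r := fun ε => by
    rw [mem_closedBall, pol_norm y u zero_le_one, hur, one_mul]
  have hεne : ε₁ ≠ ε₂ := by
    intro h
    have : pol y u 1 ε₁ = x := o12 ⟨s1 f1.right_mem, s2 (h ▸ f2.right_mem)⟩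
    exact hxY (this ▸ pY ε₁)
  -- order the two arcs
  obtain ⟨A, eps, AK, AF, Aarc, epsd, Ab, Adis, epslt⟩ : ∃ (A : Bool → Set ℂ) (eps : Bool → ℝ),
      (∀ k p, p ∈ A k → p ∈ K → p = x) ∧ (∀ k q, (A k ∩ TF q).Subsingleton) ∧
      (∀ k, IsArc (A k) x (pol y u 1 (eps k))) ∧ (∀ k, |eps k| < δ) ∧
      (∀ k, ∀ p ∈ A k, p ∈ closedBall y r → p = pol y u 1 (eps k)) ∧
      (∀ p, p ∈ A false → p ∈ A true → p = x) ∧ eps false < eps true := by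
    have t1 : ∀ p, p ∈ B₁ → p ∈ K → p = x := fun p h h' => o1.2.1 ⟨s1 h, h'⟩
    have t2 : ∀ p, p ∈ B₂ → p ∈ K → p = x := fun p h h' => o2.2.1 ⟨s2 h, h'⟩
    have v1 : ∀ q, (B₁ ∩ TF q).Subsingleton := fun q => (o1.2.2 q).anti (inter_subset_inter_left _ s1)
    have v2 : ∀ q, (B₂ ∩ TF q).Subsingleton := fun q => (o2.2.2 q).anti (inter_subset_inter_left _ s2)
    have w : ∀ p, p ∈ B₁ → p ∈ B₂ → p = x := fun p h h' => o12 ⟨s1 h, s2 h'⟩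
    rcases lt_or_gt_of_ne hεne with h | h
    · refine ⟨fun k => if k then B₂ else B₁, fun k => if k then ε₂ else ε₁, ?_, ?_, ?_, ?_, ?_, ?_, ?_⟩
      all_goals simp only [Bool.forall_bool, if_true, if_false, Bool.false_eq_true]
      exacts [⟨t1, t2⟩, ⟨v1, v2⟩, ⟨f1, f2⟩, ⟨g1, g2⟩, ⟨k1, k2⟩, w, h]
    · refine ⟨fun k => if k then B₁ else B₂, fun k => if k then ε₁ else ε₂, ?_, ?_, ?_, ?_, ?_, ?_, ?_⟩
      all_goals simp only [Bool.forall_bool, if_true, if_false, Bool.false_eq_true]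
      exacts [⟨t2, t1⟩, ⟨v2, v1⟩, ⟨f2, f1⟩, ⟨g2, g1⟩, ⟨k2, k1⟩, fun p h h' => w p h' h, h]
  have AFb : ∀ k q p, p ∈ A k → p ∈ TF q → Cr q ∧ p ∈ Metric.ball (P q) r := by
    intro k q p h1 h2
    by_contra hn
    have := AK k p h1 (KF q p h2 hn)
    exact xTF q (this ▸ h2)
  have TXX : ∀ c c' p, c ≠ c' → p ∈ TX c → p ∈ TX c' → p ∈ SX c ∧ p ∈ SX c' := by
    intro c c' p hne h h'
    by_cases hb : p ∈ Metric.ball x r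
    · have hq : qx c ≠ qx c' := by
        intro he
        obtain ⟨v, hv⟩ := D.adj (some (.x c)) (some (.x c')) (by simpa using hne) (by simp [os, es])
          (qx c) (qxS c) (he ▸ qxS c')
        rcases v with _ | _ | c''
        · rw [← hxdef] at hv
          exact hsp x _ (qxs c) hv
        · rw [← hydef] at hv
          exact hyX (hv ▸ sphere_subset_closedBall (qxs c))
        · exact bX c'' (show D.pos (.b c'') ∈ closedBall x r from hv ▸ sphere_subset_closedBall (qxs c))
      have hb' := ball_subset_closedBall hb
      have := seg_radial hr (qxs c) (qxs c') hq (TXb c p h hb') (TXb c' p h' hb')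
      rw [this]
      exact ⟨(SXarc c).left_mem, (SXarc c').left_mem⟩
    · exact ⟨TXS c p h hb, TXS c' p h' hb⟩
  have TXYp : ∀ c c' p, p ∈ TX c → p ∈ TY c' → p ∈ SX c ∧ p ∈ SY c' := by
    intro c c' p h h'
    exact ⟨TXS c p h (fun hb => a1 c' (ball_subset_closedBall hb) (TYS c' h')), TYS c' h'⟩
  have TXFp : ∀ c q p, p ∈ TX c → p ∈ TF q → p ∈ SX c ∧ p ∈ SF q := by
    intro c q p h h'
    have h1 := TXS c p h (fun hb => TFX q p h' (ball_subset_closedBall hb))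
    refine ⟨h1, ?_⟩
    rcases TFs q p h' with g | ⟨hc, g⟩
    · exact g
    · exact (d1 q hc c (ball_subset_closedBall g) h1).elim
  have TYFp : ∀ c q p, p ∈ TY c → p ∈ TF q → p ∈ SY c ∧ p ∈ SF q := by
    intro c q p h h'
    refine ⟨TYS c h, ?_⟩
    rcases TFs q p h' with g | ⟨hc, g⟩
    · exact g
    · exact (d2 q hc c (ball_subset_closedBall g) (TYS c h)).elim
  have TFFp : ∀ q q' p, q ≠ q' → p ∈ TF q → p ∈ TF q' → p ∈ SF q := by
    intro q q' p hne h h'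
    rcases TFs q p h with g | ⟨hc, g⟩
    · exact g
    · exact (TFD q q' p hne hc h' (ball_subset_closedBall g)).elim
  have ang_inj : Function.Injective ang := by
    intro c c' h
    by_contra hne
    have he : qy c = qy c' := by rw [← angp c, ← angp c', h]
    obtain ⟨v, hv⟩ := D.adj (some (.y c)) (some (.y c')) (by simpa using hne) (by simp [os, es])
      (qy c) (TYS c (TYarc c).right_mem) (he ▸ TYS c' (TYarc c').right_mem)
    rcases v with _ | _ | c''
    · rw [← hxdef] at hv
      exact hxY (hv ▸ sphere_subset_closedBall (qys c))
    · rw [← hydef] at hv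
      exact hsp y _ (qys c) hv
    · exact bY c'' (show D.pos (.b c'') ∈ closedBall y r from hv ▸ sphere_subset_closedBall (qys c))
  have hqne : ∀ {i i' : M} {j j' : N}, EE.f i j ≠ EE.f i' j' → (i, j) ≠ (i', j') := by
    intro i i' j j' h h'
    apply h
    rw [Prod.mk.injEq] at h'
    rw [h'.1, h'.2]
  subst hxdef hydef hur
  refine ⟨{ u := u, hu := hu, T := fun e => match e with
              | .x c => TX c | .y c => TY c | .f i j => TF (i, j)
            A := A, ang := ang, eps := eps, TX := TXarc, TF := fun i j => TFarc (i, j)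
            TY := fun c => by rw [angp]; exact TYarc c
            AA := Aarc
            TXd := TXY
            TFd := fun i j => TFY (i, j)
            TYd := fun c p hp hb => by rw [angp]; exact TYb c ⟨hp, hb⟩
            Ad := Ab
            TT := ?_, TV := ?_
            AX := fun k c p h h' => AK k p h (KX c h')
            AY := fun k c p h h' => by
              have := AK k p h (KY c h')
              exact xSY c (this ▸ TYS c h')
            AF := fun k i j p p' h1 h2 h3 h4 => AF k (i, j) ⟨h1, h2⟩ ⟨h3, h4⟩
            AFc := fun k i j p h h' => (AFb k (i, j) p h h').1
            AFF := fun k i j i' j' p h1 h2 h3 => by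
              by_contra hne
              have hne' : (i, j) ≠ (i', j') := by simpa using hne
              obtain ⟨hc, hb⟩ := AFb k (i, j) p h1 h2
              exact TFD _ _ p hne' hc h3 (ball_subset_closedBall hb)
            AAx := Adis, eps_lt := epslt
            ang_gt := fun c => by
              have := abs_lt.1 (epsd true)
              linarith [(hδc c).1]
            ang_lt := fun c => by
              have := abs_lt.1 (epsd false)
              linarith [(hδc c).2]
            ang_inj := ang_inj }⟩
  · rintro (c | c | ⟨i, j⟩) (c' | c' | ⟨i', j'⟩) hne p h h'
    · exact TXX c c' p (fun h => hne (by rw [h])) h h'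
    · exact TXYp c c' p h h'
    · exact TXFp c (i', j') p h h'
    · exact (TXYp c' c p h' h).symm
    · exact ⟨TYS c h, TYS c' h'⟩
    · exact TYFp c (i', j') p h h'
    · exact (TXFp c' (i, j) p h' h).symm
    · exact (TYFp c' (i, j) p h' h).symm
    · exact ⟨TFFp (i, j) (i', j') p (hqne hne) h h', TFFp (i', j') (i, j) p (hqne hne).symm h' h⟩
  · intro e v h1 h2 hv
    refine D.avoid (some e) v h1 h2 ?_
    rcases e with c | c | ⟨i, j⟩
    · refine TXS c _ hv ?_
      rcases v with _ | _ | c'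
      · exact (h1 rfl).elim
      · exact fun h => hyX (ball_subset_closedBall h)
      · exact fun h => bX c' (ball_subset_closedBall h)
    · exact TYS c hv
    · rcases TFs (i, j) _ hv with g | ⟨hc, g⟩
      · exact g
      · exfalso
        have g' := ball_subset_closedBall g
        rcases v with _ | _ | c'
        · exact d4 _ hc g' xX
        · exact d5 _ hc g' yY
        · exact bD _ hc c' g'

end CrAux

namespace CrAux
open Set

theorem exists_median {k m : ℕ} (hm : m = 2 * k + 1) (a : Fin m → ℝ) (ha : Function.Injective a) :
    ∃ i, (Finset.univ.filter fun i' => a i' ≤ a i).card ≤ k + 1 ∧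
      (Finset.univ.filter fun i' => a i < a i').card ≤ k := by
  classical
  set s : Finset ℝ := Finset.univ.image a with hs
  have hc : s.card = m := by
    rw [hs, Finset.card_image_of_injective _ ha]; simp
  set e := s.orderEmbOfFin hc with he
  have hmem : ∀ j, ∃ i, a i = e j := by
    intro j
    have : e j ∈ s := Finset.orderEmbOfFin_mem s hc j
    simpa [hs] using this
  have hmem' : ∀ i, ∃ j, e j = a i := by
    intro i
    have h1 : a i ∈ s := by simp [hs]
    have h2 : a i ∈ Set.range e := by
      rw [he, Finset.range_orderEmbOfFin]; exact h1
    exact h2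
  have hk : k < m := by omega
  obtain ⟨i, hi⟩ := hmem ⟨k, hk⟩
  choose g hg using hmem'
  have gi : Function.Injective g := by
    intro i j h
    apply ha
    rw [← hg, ← hg, h]
  refine ⟨i, ?_, ?_⟩
  · calc _ ≤ (Finset.Iic (⟨k, hk⟩ : Fin m)).card := by
          apply Finset.card_le_card_of_injOn g _ gi.injOn
          intro i' h
          have h : a i' ≤ a i := by simpa using h
          rw [hi, ← hg] at h
          simpa using h
      _ = k + 1 := by simp
  · calc _ ≤ (Finset.Ioi (⟨k, hk⟩ : Fin m)).card := by
          apply Finset.card_le_card_of_injOn g _ gi.injOn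
          intro i' h
          have h : a i < a i' := by simpa using h
          rw [hi, ← hg] at h
          simpa using h
      _ = k := by simp; omega

theorem exists_between_fin {c : Type} [Finite c] (f : c → ℝ) (v B : ℝ) (h : v < B) :
    ∃ θ, v < θ ∧ θ < B ∧ ∀ i, f i ≤ v ∨ θ < f i := by
  have hev : ∀ᶠ θ in nhdsWithin v (Ioi v), ∀ i, f i ≤ v ∨ θ < f i := by
    rw [Filter.eventually_all]
    intro i
    by_cases hi : f i ≤ v
    · exact Filter.Eventually.of_forall fun _ => Or.inl hi
    · push Not at hi
      filter_upwards [Ioo_mem_nhdsGT hi] with θ hθ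
      exact Or.inr hθ.2
  obtain ⟨θ, h1, h2⟩ := (hev.and (Ioo_mem_nhdsGT h)).exists
  exact ⟨θ, h2.1, h2.2, h1⟩

theorem exists_lifts {k l m n : ℕ} (hm : m = 2 * k + 1) (hn : n = 2 * l + 1)
    {D : ISys (os (M := Fin m) (N := Fin n)) ot} (O : Outer D) :
    ∃ b, ∃ L : Lifts O b, {q : Option (Fin m) × Option (Fin n) |
      Btw L.θ (L.β q.2) (L.α q.1)}.ncard ≤ l * (k + 1) + k := by
  classical
  obtain ⟨i₀, hlo, hhi⟩ := exists_median hm (fun i => O.ang (.inl i))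
    (fun i j h => by simpa using O.ang_inj h)
  obtain ⟨t, ht1, ht2, ht⟩ := exists_between_fin O.ang (O.ang (.inl i₀)) _ (O.ang_lt _)
  have hlo' : (Finset.univ.filter fun i' => O.ang (.inl i') < t).card ≤ k + 1 := by
    refine le_trans (Finset.card_le_card ?_) hlo
    intro i hi
    simp only [Finset.mem_filter, Finset.mem_univ, true_and] at hi ⊢
    rcases ht (.inl i) with h | h
    · exact h
    · linarith
  have hhi' : (Finset.univ.filter fun i' => t < O.ang (.inl i')).card ≤ k := by
    refine le_trans (Finset.card_le_card ?_) hhi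
    intro i hi
    simp only [Finset.mem_filter, Finset.mem_univ, true_and] at hi ⊢
    linarith
  have hne : ∀ c, O.ang c ≠ t := by
    intro c h
    rcases ht c with h' | h' <;> linarith
  have hg := O.ang_gt
  have hl := O.ang_lt
  have he := O.eps_lt
  have hte := hg (.inl i₀)
  have hpi := Real.pi_pos
  obtain ⟨κ, hκ1, hκ2⟩ := exists_between he
  have hp : ∀ θ, pol (D.pos .y) O.u 1 (θ - 2 * Real.pi) = pol (D.pos .y) O.u 1 θ := by
    intro θ
    rw [← pol_two_pi _ _ _ (θ - 2 * Real.pi)]; congr 1; ring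
  let f : Fin m ⊕ Fin n → ℝ := fun c => if O.ang c < t then O.ang c else O.ang c - 2 * Real.pi
  have hf1 : ∀ c, O.ang c < t → f c = O.ang c := fun c h => by simp [f, h]
  have hf2 : ∀ c, t < O.ang c → f c = O.ang c - 2 * Real.pi := fun c h => by
    simp [f, not_lt.2 h.le]
  have hfd : ∀ c, (O.ang c < t ∧ f c = O.ang c) ∨ (t < O.ang c ∧ f c = O.ang c - 2 * Real.pi) := by
    intro c
    rcases lt_or_gt_of_ne (hne c) with h | h
    · exact Or.inl ⟨h, hf1 c h⟩
    · exact Or.inr ⟨h, hf2 c h⟩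
  have hfi : Function.Injective f := by
    intro c d h
    apply O.ang_inj
    rcases hfd c with ⟨h1, h2⟩ | ⟨h1, h2⟩ <;> rcases hfd d with ⟨h3, h4⟩ | ⟨h3, h4⟩ <;>
      linarith [hg c, hg d, hl c, hl d]
  have hfp : ∀ c, pol (D.pos .y) O.u 1 (f c) = pol (D.pos .y) O.u 1 (O.ang c) := by
    intro c
    rcases hfd c with ⟨h1, h2⟩ | ⟨h1, h2⟩ <;> rw [h2]
    exact hp _
  have hfw : ∀ c, f c ∈ Ioo (t - 2 * Real.pi) (t - 2 * Real.pi + 2 * Real.pi) := by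
    intro c
    rcases hfd c with ⟨h1, h2⟩ | ⟨h1, h2⟩ <;> rw [h2] <;> constructor <;> linarith [hg c, hl c]
  have hfe : ∀ c, f c < O.eps false ∨ O.eps true < f c := by
    intro c
    rcases hfd c with ⟨h1, h2⟩ | ⟨h1, h2⟩ <;> rw [h2]
    · exact Or.inr (hg c)
    · left; linarith [hl c]
  let L1 : Lifts O false :=
    { w := t - 2 * Real.pi
      θ := κ
      α := fun a => a.elim (O.eps false) fun i => f (.inl i)
      β := fun b => b.elim (O.eps true) fun j => f (.inr j)
      hθ := by constructor <;> linarith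
      hα := by
        rintro (_ | i)
        · constructor <;> simp <;> linarith
        · exact hfw _
      hβ := by
        rintro (_ | i)
        · constructor <;> simp <;> linarith
        · exact hfw _
      αi := by
        rintro (_ | i) (_ | j) h
        · rfl
        · simp at h; rcases hfe (.inl j) with h' | h' <;> linarith
        · simp at h; rcases hfe (.inl i) with h' | h' <;> linarith
        · simpa using hfi h
      βi := by
        rintro (_ | i) (_ | j) h
        · rfl
        · simp at h; rcases hfe (.inr j) with h' | h' <;> linarith
        · simp at h; rcases hfe (.inr i) with h' | h' <;> linarith
        · simpa using hfi h
      αβ := by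
        rintro (_ | i) (_ | j) h
        · simp at h; linarith
        · simp at h; rcases hfe (.inr j) with h' | h' <;> linarith
        · simp at h; rcases hfe (.inl i) with h' | h' <;> linarith
        · simpa using hfi h
      αθ := by
        rintro (_ | i) h
        · simp at h; linarith
        · simp at h; rcases hfe (.inl i) with h' | h' <;> linarith
      βθ := by
        rintro (_ | i) h
        · simp at h; linarith
        · simp at h; rcases hfe (.inr i) with h' | h' <;> linarith
      nb := by
        rintro (⟨h1, h2⟩ | ⟨h1, h2⟩) <;> simp at h1 h2 <;> linarith
      p1 := rfl
      p2 := fun i => hfp _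
      p3 := rfl
      p4 := fun i => hfp _ }
  let L2 : Lifts O true :=
    { w := κ
      θ := t
      α := fun a => a.elim (O.eps true) fun i => O.ang (.inl i)
      β := fun b => b.elim (O.eps false + 2 * Real.pi) fun j => O.ang (.inr j)
      hθ := by constructor <;> linarith
      hα := by
        rintro (_ | i)
        · constructor <;> simp <;> linarith
        · constructor <;> simp <;> linarith [hg (.inl i), hl (.inl i)]
      hβ := by
        rintro (_ | i)
        · constructor <;> simp <;> linarith
        · constructor <;> simp <;> linarith [hg (.inr i), hl (.inr i)]
      αi := by
        rintro (_ | i) (_ | j) h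
        · rfl
        · simp at h; linarith [hg (.inl j)]
        · simp at h; linarith [hg (.inl i)]
        · simpa using O.ang_inj h
      βi := by
        rintro (_ | i) (_ | j) h
        · rfl
        · simp at h; linarith [hl (.inr j)]
        · simp at h; linarith [hl (.inr i)]
        · simpa using O.ang_inj h
      αβ := by
        rintro (_ | i) (_ | j) h
        · simp at h; linarith
        · simp at h; linarith [hg (.inr j)]
        · simp at h; linarith [hl (.inl i)]
        · simpa using O.ang_inj h
      αθ := by
        rintro (_ | i) h
        · simp at h; linarith
        · exact hne _ h
      βθ := by
        rintro (_ | i) h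
        · simp at h; linarith
        · exact hne _ h
      nb := by
        rintro (⟨h1, h2⟩ | ⟨h1, h2⟩) <;> simp at h1 h2 <;> linarith
      p1 := rfl
      p2 := fun i => rfl
      p3 := pol_two_pi _ _ _ _
      p4 := fun i => rfl }
  set S1 := {q : Option (Fin m) × Option (Fin n) | Btw L1.θ (L1.β q.2) (L1.α q.1)} with hS1
  set S2 := {q : Option (Fin m) × Option (Fin n) | Btw L2.θ (L2.β q.2) (L2.α q.1)} with hS2
  let Lo : Finset (Option (Fin m)) := (Finset.univ.filter fun i' => O.ang (.inl i') < t).image some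
  let Hi : Finset (Option (Fin m)) := (Finset.univ.filter fun i' => t < O.ang (.inl i')).image some
  let Bl : Finset (Option (Fin n)) := (Finset.univ.filter fun i' => O.ang (.inr i') < t).image some
  let Bh : Finset (Option (Fin n)) :=
    (Finset.univ.filter fun i' => ¬ O.ang (.inr i') < t).image some
  let T : Finset (Option (Fin m) × Option (Fin n)) :=
    (Lo ×ˢ Bl) ∪ (insert none Hi ×ˢ Bh) ∪ (Hi ×ˢ {none})
  have key : ∀ q, (q ∈ S1 → q ∈ T ∧ q ∉ S2) ∧ (q ∈ S2 → q ∈ T) := by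
    rintro ⟨_ | i, _ | j⟩
    · refine ⟨?_, ?_⟩
      · rintro (⟨h1, h2⟩ | ⟨h1, h2⟩) <;> exfalso <;> simp [L1] at h1 h2 <;> linarith
      · rintro (⟨h1, h2⟩ | ⟨h1, h2⟩) <;> exfalso <;> simp [L2] at h1 h2 <;> linarith
    · refine ⟨?_, ?_⟩
      · intro h
        refine ⟨?_, ?_⟩
        · rcases hfd (.inr j) with ⟨h3, h4⟩ | ⟨h3, h4⟩
          · rcases h with ⟨h1, h2⟩ | ⟨h1, h2⟩ <;> exfalso <;> simp [L1] at h1 h2 <;>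
              linarith [hg (.inr j)]
          · simp [T, Lo, Hi, Bl, Bh, h3.le]
        · rintro (⟨h1, h2⟩ | ⟨h1, h2⟩) <;> simp [L2] at h1 h2 <;> linarith [hg (.inr j)]
      · rintro (⟨h1, h2⟩ | ⟨h1, h2⟩) <;> exfalso <;> simp [L2] at h1 h2 <;> linarith [hg (.inr j)]
    · refine ⟨?_, ?_⟩
      · rintro (⟨h1, h2⟩ | ⟨h1, h2⟩) <;> exfalso <;> simp [L1] at h1 h2 <;>
          rcases hfe (.inl i) with h' | h' <;> linarith
      · rintro (⟨h1, h2⟩ | ⟨h1, h2⟩) <;> simp [L2] at h1 h2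
        · simp [T, Lo, Hi, Bl, Bh, h1]
        · exfalso; linarith [hl (.inl i)]
    · have t1 : O.ang (.inl i) < t → O.ang (.inr j) < t →
          ((some i, some j) : Option (Fin m) × Option (Fin n)) ∈ T := by
        intro h1 h2
        simp [T, Lo, Hi, Bl, Bh, h1, h2]
      have t2 : t < O.ang (.inl i) → t < O.ang (.inr j) →
          ((some i, some j) : Option (Fin m) × Option (Fin n)) ∈ T := by
        intro h1 h2
        simp [T, Lo, Hi, Bl, Bh, h1, h2.le]
      have s1 : ((some i, some j) : Option (Fin m) × Option (Fin n)) ∈ S1 ↔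
        Btw κ (f (.inr j)) (f (.inl i)) := Iff.rfl
      have s2 : ((some i, some j) : Option (Fin m) × Option (Fin n)) ∈ S2 ↔
        Btw t (O.ang (.inr j)) (O.ang (.inl i)) := Iff.rfl
      rw [s1, s2]
      have g1 := hg (.inl i)
      have g2 := hg (.inr j)
      have l1 := hl (.inl i)
      have l2 := hl (.inr j)
      rcases hfd (.inl i) with ⟨h1, h2⟩ | ⟨h1, h2⟩ <;>
        rcases hfd (.inr j) with ⟨h3, h4⟩ | ⟨h3, h4⟩ <;> rw [h2, h4]
      · refine ⟨fun h => ⟨t1 h1 h3, ?_⟩, fun _ => t1 h1 h3⟩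
        rintro (⟨h5, h6⟩ | ⟨h5, h6⟩) <;> rcases h with ⟨h7, h8⟩ | ⟨h7, h8⟩ <;> linarith
      · refine ⟨?_, ?_⟩ <;> rintro (⟨h5, h6⟩ | ⟨h5, h6⟩) <;> exfalso <;> linarith
      · refine ⟨?_, ?_⟩ <;> rintro (⟨h5, h6⟩ | ⟨h5, h6⟩) <;> exfalso <;> linarith
      · refine ⟨fun h => ⟨t2 h1 h3, ?_⟩, fun _ => t2 h1 h3⟩
        rintro (⟨h5, h6⟩ | ⟨h5, h6⟩) <;> rcases h with ⟨h7, h8⟩ | ⟨h7, h8⟩ <;> linarith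
  have h12 : Disjoint S1 S2 := Set.disjoint_left.2 fun q h1 h2 => ((key q).1 h1).2 h2
  have hsub : S1 ∪ S2 ⊆ (T : Set _) := by
    rintro q (h | h)
    · exact ((key q).1 h).1
    · exact (key q).2 h
  have hcard : S1.ncard + S2.ncard ≤ T.card := by
    rw [← Set.ncard_union_eq h12, ← Set.ncard_coe_finset]
    exact Set.ncard_le_ncard hsub
  have hT : T.card ≤ (k + 1) * n + k := by
    have hLo : Lo.card ≤ k + 1 := Finset.card_image_le.trans hlo'
    have hHi : Hi.card ≤ k := Finset.card_image_le.trans hhi'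
    have hHi' : (insert none Hi).card ≤ k + 1 := (Finset.card_insert_le _ _).trans (by omega)
    have hB : Bl.card + Bh.card = n := by
      rw [Finset.card_image_of_injective _ (Option.some_injective _),
        Finset.card_image_of_injective _ (Option.some_injective _),
        Finset.card_filter_add_card_filter_not]
      simp
    calc T.card ≤ (Lo ×ˢ Bl).card + (insert none Hi ×ˢ Bh).card + (Hi ×ˢ {none}).card :=
          (Finset.card_union_le _ _).trans (Nat.add_le_add_right (Finset.card_union_le _ _) _)
      _ ≤ (k + 1) * Bl.card + (k + 1) * Bh.card + k * 1 := by
          simp only [Finset.card_product, Finset.card_singleton]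
          gcongr
      _ = (k + 1) * n + k := by rw [← Nat.mul_add, hB, mul_one]
  have htot : S1.ncard + S2.ncard ≤ 2 * (l * (k + 1) + k) + 1 := by
    calc _ ≤ (k + 1) * n + k := hcard.trans hT
      _ = _ := by rw [hn]; ring
  by_cases hcase : S1.ncard ≤ l * (k + 1) + k
  · exact ⟨false, L1, hcase⟩
  · exact ⟨true, L2, show S2.ncard ≤ _ by omega⟩

end CrAux

namespace CrAux
open Set

/-- concurrency determinant of three chords of the parabola -/
def chordDet {R : Type} [CommRing R] (g : Fin 6 → R) : R :=
  (g 0 + g 1) * (g 2 * g 3 - g 4 * g 5) - g 0 * g 1 * ((g 2 + g 3) - (g 4 + g 5)) +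
    ((g 2 + g 3) * (g 4 * g 5) - g 2 * g 3 * (g 4 + g 5))

theorem exists_generic (V : Type) [Finite V] : ∃ τ : V → ℝ, Function.Injective τ ∧
    ∀ g : Fin 6 → V, Function.Injective g → chordDet (τ ∘ g) ≠ 0 := by
  classical
  have := Fintype.ofFinite V
  let P : MvPolynomial V ℝ :=
    (∏ q ∈ Finset.univ.filter (fun q : V × V => q.1 ≠ q.2),
      (MvPolynomial.X q.1 - MvPolynomial.X q.2)) *
    ∏ g ∈ Finset.univ.filter (fun g : Fin 6 → V => Function.Injective g),
      chordDet (fun k => (MvPolynomial.X (g k) : MvPolynomial V ℝ))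
  have hP : P ≠ 0 := by
    apply mul_ne_zero
    · rw [Finset.prod_ne_zero_iff]
      rintro ⟨u, v⟩ huv h
      simp only [Finset.mem_filter, Finset.mem_univ, true_and] at huv
      have := congrArg (MvPolynomial.eval (fun w => if w = u then (1:ℝ) else 0)) h
      simp [huv.symm] at this
    · rw [Finset.prod_ne_zero_iff]
      intro g hg h
      simp only [Finset.mem_filter, Finset.mem_univ, true_and] at hg
      let vals : Fin 6 → ℝ := ![1, -1, 0, 3, 2, -2]
      have h2 := congrArg (MvPolynomial.eval (Function.extend g vals 0)) h
      simp only [chordDet, map_add, map_sub, map_mul, MvPolynomial.eval_X, hg.extend_apply,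
        map_zero] at h2
      rw [show vals 0 = 1 from rfl, show vals 1 = -1 from rfl, show vals 2 = 0 from rfl,
        show vals 3 = 3 from rfl, show vals 4 = 2 from rfl, show vals 5 = -2 from rfl] at h2
      norm_num at h2
  have hex : ∃ τ : V → ℝ, MvPolynomial.eval τ P ≠ 0 := by
    by_contra hcon
    push Not at hcon
    exact hP (MvPolynomial.funext fun τ => by rw [hcon, map_zero])
  obtain ⟨τ, hτ⟩ := hex
  rw [map_mul, map_prod, map_prod] at hτ
  have h1 := Finset.prod_ne_zero_iff.1 (left_ne_zero_of_mul hτ)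
  have h2 := Finset.prod_ne_zero_iff.1 (right_ne_zero_of_mul hτ)
  refine ⟨τ, ?_, ?_⟩
  · intro u v huv
    by_contra hne
    exact h1 (u, v) (by simpa using hne) (by simp [huv])
  · intro g hg h
    apply h2 g (by simpa using hg)
    simpa [chordDet] using h

theorem chord_line {a b : ℝ} {p : ℂ}
    (h : p ∈ segment ℝ (⟨a, a ^ 2⟩ : ℂ) ⟨b, b ^ 2⟩) : p.im = (a + b) * p.re - a * b := by
  obtain ⟨c, d, _, _, hcd, rfl⟩ := h
  simp
  have : d = 1 - c := by linarith
  subst this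
  ring

theorem inj_six {V : Type} {a b c d e f : V} (h1 : a ≠ b) (h2 : a ≠ c) (h3 : a ≠ d) (h4 : a ≠ e)
    (h5 : a ≠ f) (h6 : b ≠ c) (h7 : b ≠ d) (h8 : b ≠ e) (h9 : b ≠ f) (h10 : c ≠ d) (h11 : c ≠ e)
    (h12 : c ≠ f) (h13 : d ≠ e) (h14 : d ≠ f) (h15 : e ≠ f) :
    Function.Injective ![a, b, c, d, e, f] := by
  rw [Function.Injective]
  simp only [Fin.forall_fin_succ]
  simp [h1, h2, h3, h4, h5, h6, h7, h8, h9, h10, h11, h12, h13, h14, h15, h1.symm, h2.symm,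
    h3.symm, h4.symm, h5.symm, h6.symm, h7.symm, h8.symm, h9.symm, h10.symm, h11.symm, h12.symm,
    h13.symm, h14.symm, h15.symm]

theorem exists_straight {V ι : Type} [Finite V] (s t : ι → V) (hst : ∀ i, s i ≠ t i)
    (hinj : ∀ i j, s(s i, t i) = s(s j, t j) → i = j) : Nonempty (ISys s t) := by
  obtain ⟨τ, τi, τg⟩ := exists_generic V
  have two : ∀ i j, i ≠ j → ∀ p : ℂ, p.im = (τ (s i) + τ (t i)) * p.re - τ (s i) * τ (t i) →
      p.im = (τ (s j) + τ (t j)) * p.re - τ (s j) * τ (t j) →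
      τ (s i) + τ (t i) ≠ τ (s j) + τ (t j) := by
    intro i j hij p h1 h2 h
    apply hij
    apply hinj
    have hm : τ (s i) * τ (t i) = τ (s j) * τ (t j) := by rw [h] at h1; linarith
    have h3 : (τ (s i) - τ (s j)) * (τ (s i) - τ (t j)) = 0 := by
      have : τ (t i) = τ (s j) + τ (t j) - τ (s i) := by linarith
      rw [this] at hm
      linarith
    rw [Sym2.eq_iff]
    rcases mul_eq_zero.1 h3 with h4 | h4
    · exact Or.inl ⟨τi (by linarith), τi (by linarith)⟩
    · exact Or.inr ⟨τi (by linarith), τi (by linarith)⟩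
  have adj : ∀ i j, i ≠ j → (s i = s j ∨ s i = t j ∨ t i = s j ∨ t i = t j) →
      ∀ p : ℂ, p.im = (τ (s i) + τ (t i)) * p.re - τ (s i) * τ (t i) →
      p.im = (τ (s j) + τ (t j)) * p.re - τ (s j) * τ (t j) →
      ∃ v, p = ⟨τ v, τ v ^ 2⟩ := by
    intro i j hij ha p h1 h2
    have h := two i j hij p h1 h2
    have fin : ∀ a b d : ℝ, b ≠ d → p.im = (a + b) * p.re - a * b →
        p.im = (a + d) * p.re - a * d → p = ⟨a, a ^ 2⟩ := by
      intro a b d hbd e1 e2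
      have : (b - d) * (p.re - a) = 0 := by linarith
      rcases mul_eq_zero.1 this with h | h
      · exact absurd (by linarith) hbd
      · have hr : p.re = a := by linarith
        apply Complex.ext
        · exact hr
        · rw [e1, hr]; simp; ring
    rcases ha with e | e | e | e
    · refine ⟨s i, fin _ (τ (t i)) (τ (t j)) (fun h' => h (by rw [e, h'])) h1 ?_⟩
      rw [e]; exact h2
    · refine ⟨s i, fin _ (τ (t i)) (τ (s j)) (fun h' => h (by rw [e, h', add_comm])) h1 ?_⟩
      rw [e, h2]; ring
    · refine ⟨t i, fin _ (τ (s i)) (τ (t j)) (fun h' => h (by rw [e, h', add_comm])) ?_ ?_⟩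
      · rw [h1]; ring
      · rw [e, h2]
    · refine ⟨t i, fin _ (τ (s i)) (τ (s j)) (fun h' => h (by rw [e, h'])) ?_ ?_⟩
      · rw [h1]; ring
      · rw [e, h2]; ring
  refine ⟨{
    pos := fun v => ⟨τ v, τ v ^ 2⟩
    inj := fun u v h => τi (congrArg Complex.re h)
    S := fun i => segment ℝ ⟨τ (s i), τ (s i) ^ 2⟩ ⟨τ (t i), τ (t i) ^ 2⟩
    arc := fun i => isArc_segment fun h => hst i (τi (congrArg Complex.re h))
    avoid := ?_
    adj := fun i j hij ha p h1 h2 => adj i j hij ha p (chord_line h1) (chord_line h2)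
    once := ?_
    triple := ?_ }⟩
  · intro i v h1 h2 h
    have h3 := chord_line h
    simp only at h3
    have h4 : (τ v - τ (s i)) * (τ v - τ (t i)) = 0 := by linarith
    rcases mul_eq_zero.1 h4 with h5 | h5
    · exact h1 (τi (by linarith))
    · exact h2 (τi (by linarith))
  · intro i j hij p q p1 p2 q1 q2 _ _
    have p1 := chord_line p1
    have p2 := chord_line p2
    have q1 := chord_line q1
    have q2 := chord_line q2
    have h := two i j hij p p1 p2
    have h3 : (τ (s i) + τ (t i) - (τ (s j) + τ (t j))) * (p.re - q.re) = 0 := by linarith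
    rcases mul_eq_zero.1 h3 with h4 | h4
    · exact absurd (by linarith) h
    · have hr : p.re = q.re := by linarith
      apply Complex.ext hr
      rw [p1, q1, hr]
  · intro i j k hij hik hjk p h1 h2 h3
    have h1 := chord_line h1
    have h2 := chord_line h2
    have h3 := chord_line h3
    by_contra hv
    have nij : ¬ (s i = s j ∨ s i = t j ∨ t i = s j ∨ t i = t j) := fun ha =>
      hv (adj i j hij ha p h1 h2)
    have nik : ¬ (s i = s k ∨ s i = t k ∨ t i = s k ∨ t i = t k) := fun ha =>
      hv (adj i k hik ha p h1 h3)
    have njk : ¬ (s j = s k ∨ s j = t k ∨ t j = s k ∨ t j = t k) := fun ha =>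
      hv (adj j k hjk ha p h2 h3)
    push Not at nij nik njk
    refine τg ![s i, t i, s j, t j, s k, t k] ?_ ?_
    · obtain ⟨a1, a2, a3, a4⟩ := nij
      obtain ⟨b1, b2, b3, b4⟩ := nik
      obtain ⟨c1, c2, c3, c4⟩ := njk
      exact inj_six (hst i) a1 a2 b1 b2 a3 a4 b3 b4 (hst j) c1 c2 c3 c4 (hst k)
    · simp only [chordDet, Function.comp]
      simp
      linear_combination (-(τ (s j) + τ (t j) - (τ (s k) + τ (t k)))) * h1 +
        ((τ (s i) + τ (t i)) - (τ (s k) + τ (t k))) * h2 +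
        (-(τ (s i) + τ (t i)) + (τ (s j) + τ (t j))) * h3

end CrAux

namespace CrAux
open Set

variable {M N : Type}

theorem EE.ex {P : EE M N → Prop} :
    (∃ e, P e) ↔ (∃ c, P (.x c)) ∨ (∃ c, P (.y c)) ∨ ∃ i j, P (.f i j) := by
  constructor
  · rintro ⟨c | c | ⟨i, j⟩, h⟩
    · exact Or.inl ⟨_, h⟩
    · exact Or.inr (Or.inl ⟨_, h⟩)
    · exact Or.inr (Or.inr ⟨_, _, h⟩)
  · rintro (⟨c, h⟩ | ⟨c, h⟩ | ⟨i, j, h⟩) <;> exact ⟨_, h⟩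

theorem NE.ex {P : NE M N → Prop} :
    (∃ e, P e) ↔ P .xz ∨ P .xw ∨ P .zw ∨ ∃ e, P (.o e) := by
  constructor
  · rintro ⟨_ | _ | _ | e, h⟩
    · exact Or.inl h
    · exact Or.inr (Or.inl h)
    · exact Or.inr (Or.inr (Or.inl h))
    · exact Or.inr (Or.inr (Or.inr ⟨_, h⟩))
  · rintro (h | h | h | ⟨_, h⟩) <;> exact ⟨_, h⟩

instance [Finite M] [Finite N] : Finite (EE M N) := by
  let g : EE M N → (M ⊕ N) ⊕ (M ⊕ N) ⊕ (M × N) := fun e => match e with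
    | .x c => .inl c | .y c => .inr (.inl c) | .f i j => .inr (.inr (i, j))
  apply Finite.of_injective g
  rintro (c | c | ⟨i, j⟩) (c' | c' | ⟨i', j'⟩) h <;> simp_all [g]

instance [Finite M] [Finite N] : Finite (NE M N) := by
  let g : NE M N → Fin 3 ⊕ EE M N := fun e => match e with
    | .xz => .inl 0 | .xw => .inl 1 | .zw => .inl 2 | .o e => .inr e
  apply Finite.of_injective g
  rintro (_ | _ | _ | e) (_ | _ | _ | e') h <;> simp_all [g]

instance [Finite M] [Finite N] : Finite (OV M N) := by
  let g : OV M N → Fin 2 ⊕ (M ⊕ N) := fun e => match e with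
    | .x => .inl 0 | .y => .inl 1 | .b c => .inr c
  apply Finite.of_injective g
  rintro (_ | _ | e) (_ | _ | e') h <;> simp_all [g]

theorem os_inj : ∀ i j : Option (EE M N), s(os i, ot i) = s(os j, ot j) → i = j := by
  rintro (_ | c | c | ⟨a, b⟩) (_ | c' | c' | ⟨a', b'⟩) <;> simp [os, ot, es, et]

theorem es_inj : ∀ i j : EE M N, s(es i, et i) = s(es j, et j) → i = j := by
  rintro (c | c | ⟨a, b⟩) (c' | c' | ⟨a', b'⟩) <;> simp [es, et]

theorem ns_inj : ∀ i j : NE M N, s(ns i, nt i) = s(ns j, nt j) → i = j := by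
  rintro (_ | _ | _ | c | (c | c) | ⟨a, b⟩) (_ | _ | _ | c' | (c' | c') | ⟨a', b'⟩) <;>
    simp [ns, nt]

theorem os_ne : ∀ i : Option (EE M N), os i ≠ ot i := by
  rintro (_ | c | c | ⟨a, b⟩) <;> simp [os, ot, es, et]

variable (m n : ℕ)

def q4 : OV (Fin m) (Fin n) → Σ i : Fin 4, ![Fin 1, Fin 1, Fin m, Fin n] i
  | .x => ⟨0, (0 : Fin 1)⟩
  | .y => ⟨1, (0 : Fin 1)⟩
  | .b (.inl i) => ⟨2, i⟩
  | .b (.inr j) => ⟨3, j⟩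

def q3 : OV (Fin m) (Fin n) → Σ i : Fin 3, ![Fin 2, Fin m, Fin n] i
  | .x => ⟨0, (0 : Fin 2)⟩
  | .y => ⟨0, (1 : Fin 2)⟩
  | .b (.inl i) => ⟨1, i⟩
  | .b (.inr j) => ⟨2, j⟩

def r3 : NV (Fin m) (Fin n) → Σ i : Fin 3, ![Fin 1, Fin (m + 1), Fin (n + 1)] i
  | .x => ⟨0, (0 : Fin 1)⟩
  | .w => ⟨1, Fin.last m⟩
  | .z => ⟨2, Fin.last n⟩
  | .b (.inl i) => ⟨1, Fin.castSucc i⟩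
  | .b (.inr j) => ⟨2, Fin.castSucc j⟩

theorem q4_bij : Function.Bijective (q4 m n) := by
  constructor
  · rintro (_ | _ | (c | c)) (_ | _ | (c' | c')) h <;> first
      | rfl
      | exact absurd (Sigma.mk.inj_iff.1 h).1 (by decide)
      | (have h2 := eq_of_heq (Sigma.mk.inj_iff.1 h).2
         first
         | (cases h2; rfl)
         | exact absurd (show (0 : Fin 2) = 1 from h2) (by decide)
         | exact absurd (show (1 : Fin 2) = 0 from h2) (by decide)
         | exact absurd h2 (Fin.castSucc_ne_last _)
         | exact absurd h2.symm (Fin.castSucc_ne_last _)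
         | rw [Fin.castSucc_injective _ h2])
  · rintro ⟨i, c⟩
    fin_cases i
    · exact ⟨.x, congrArg (Sigma.mk 0) (Subsingleton.elim (α := Fin 1) _ _)⟩
    · exact ⟨.y, congrArg (Sigma.mk 1) (Subsingleton.elim (α := Fin 1) _ _)⟩
    · exact ⟨.b (.inl c), rfl⟩
    · exact ⟨.b (.inr c), rfl⟩

theorem q3_bij : Function.Bijective (q3 m n) := by
  constructor
  · rintro (_ | _ | (c | c)) (_ | _ | (c' | c')) h <;> first
      | rfl
      | exact absurd (Sigma.mk.inj_iff.1 h).1 (by decide)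
      | (have h2 := eq_of_heq (Sigma.mk.inj_iff.1 h).2
         first
         | (cases h2; rfl)
         | exact absurd (show (0 : Fin 2) = 1 from h2) (by decide)
         | exact absurd (show (1 : Fin 2) = 0 from h2) (by decide)
         | exact absurd h2 (Fin.castSucc_ne_last _)
         | exact absurd h2.symm (Fin.castSucc_ne_last _)
         | rw [Fin.castSucc_injective _ h2])
  · rintro ⟨i, c⟩
    fin_cases i
    · change Fin 2 at c
      fin_cases c
      · exact ⟨.x, rfl⟩
      · exact ⟨.y, rfl⟩
    · exact ⟨.b (.inl c), rfl⟩
    · exact ⟨.b (.inr c), rfl⟩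

theorem r3_bij : Function.Bijective (r3 m n) := by
  constructor
  · rintro (_ | _ | _ | (c | c)) (_ | _ | _ | (c' | c')) h <;> first
      | rfl
      | exact absurd (Sigma.mk.inj_iff.1 h).1 (by decide)
      | (have h2 := eq_of_heq (Sigma.mk.inj_iff.1 h).2
         first
         | (cases h2; rfl)
         | exact absurd (show (0 : Fin 2) = 1 from h2) (by decide)
         | exact absurd (show (1 : Fin 2) = 0 from h2) (by decide)
         | exact absurd h2 (Fin.castSucc_ne_last _)
         | exact absurd h2.symm (Fin.castSucc_ne_last _)
         | rw [Fin.castSucc_injective _ h2])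
  · rintro ⟨i, c⟩
    fin_cases i
    · exact ⟨.x, congrArg (Sigma.mk 0) (Subsingleton.elim (α := Fin 1) _ _)⟩
    · change Fin (m + 1) at c
      induction c using Fin.lastCases with
      | last => exact ⟨.w, rfl⟩
      | cast c => exact ⟨.b (.inl c), rfl⟩
    · change Fin (n + 1) at c
      induction c using Fin.lastCases with
      | last => exact ⟨.z, rfl⟩
      | cast c => exact ⟨.b (.inr c), rfl⟩

theorem q4_adj (a b) : (quadK 1 1 m n).Adj (q4 m n a) (q4 m n b) ↔
    ∃ i, (os i = a ∧ ot i = b) ∨ (os i = b ∧ ot i = a) := by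
  change (q4 m n a).1 ≠ (q4 m n b).1 ↔ _
  rw [Option.exists, EE.ex]
  rcases a with _ | _ | (c | c) <;> rcases b with _ | _ | (c' | c') <;> simp [q4, os, ot, es, et]

theorem q3_adj (a b) : (triK 2 m n).Adj (q3 m n a) (q3 m n b) ↔
    ∃ i, (es i = a ∧ et i = b) ∨ (es i = b ∧ et i = a) := by
  change (q3 m n a).1 ≠ (q3 m n b).1 ↔ _
  rw [EE.ex]
  rcases a with _ | _ | (c | c) <;> rcases b with _ | _ | (c' | c') <;> simp [q3, es, et]

theorem r3_adj (a b) : (triK 1 (m + 1) (n + 1)).Adj (r3 m n a) (r3 m n b) ↔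
    ∃ i, (ns i = a ∧ nt i = b) ∨ (ns i = b ∧ nt i = a) := by
  change (r3 m n a).1 ≠ (r3 m n b).1 ↔ _
  rw [NE.ex, EE.ex]
  rcases a with _ | _ | _ | (c | c) <;> rcases b with _ | _ | _ | (c' | c') <;>
    simp [r3, ns, nt]

theorem main_nat (k l : ℕ) (hm : m = 2 * k + 1) (hn : n = 2 * l + 1) :
    crossingNumber (triK 1 (m + 1) (n + 1)) + crossingNumber (triK 2 m n) ≤
      2 * crossingNumber (quadK 1 1 m n) + (l * (k + 1) + k) := by
  let σ4 := Equiv.ofBijective _ (q4_bij m n)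
  let σ3 := Equiv.ofBijective _ (q3_bij m n)
  let ρ3 := Equiv.ofBijective _ (r3_bij m n)
  obtain ⟨D₀⟩ := exists_straight (os (M := Fin m) (N := Fin n)) ot os_ne os_inj
  obtain ⟨D₁, hD₁, -⟩ := exists_drawing (G := quadK 1 1 m n) D₀ σ4 (q4_adj m n) os_inj
  obtain ⟨D₂, hD₂, hc⟩ : crossingNumber (quadK 1 1 m n) ∈
      {c | ∃ D : Drawing (quadK 1 1 m n), D.IsGood ∧ D.crNum = c} :=
    Nat.sInf_mem ⟨_, D₁, hD₁, rfl⟩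
  have : Finite (Σ i : Fin 4, ![Fin 1, Fin 1, Fin m, Fin n] i) := Finite.of_equiv _ σ4
  obtain ⟨D, hD⟩ := exists_isys (s := os (M := Fin m) (N := Fin n)) (t := ot) D₂ hD₂ σ4
    (fun i => (q4_adj m n _ _).2 ⟨i, Or.inl ⟨rfl, rfl⟩⟩) os_inj
  obtain ⟨O⟩ := exists_outer D
  obtain ⟨b, L, hL⟩ := exists_lifts hm hn O
  have h1 := L.new_cr
  have h2 := old_cr D
  have h3 : 2 * crossingNumber (triK 1 (m + 1) (n + 1)) ≤ L.newSys.cr :=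
    crossingNumber_le L.newSys ρ3 (r3_adj m n) ns_inj
  have h4 : 2 * crossingNumber (triK 2 m n) ≤ (restr D).cr :=
    crossingNumber_le (restr D) σ3 (q3_adj m n) es_inj
  omega

end CrAux

/-- If `m` and `n` are both odd positive integers, then
`cr(K_{1,1,m,n}) ≥ ½(cr(K_{1,m+1,n+1}) + cr(K_{2,m,n}) − ¼(m+1)(n+1) + 1)`. -/
theorem statement5 (m n : ℕ) (hm : 0 < m) (hn : 0 < n)
    (hmo : Odd m) (hno : Odd n) :
    (crossingNumber (quadK 1 1 m n) : ℝ) ≥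
      (1 / 2) * ((crossingNumber (triK 1 (m + 1) (n + 1)) : ℝ)
        + (crossingNumber (triK 2 m n) : ℝ)
        - (1 / 4) * ((m : ℝ) + 1) * ((n : ℝ) + 1) + 1) := by
  obtain ⟨k, hk⟩ := hmo
  obtain ⟨l, hl⟩ := hno
  have h := CrAux.main_nat m n k l hk hl
  have h' : (crossingNumber (triK 1 (m + 1) (n + 1)) : ℝ) + (crossingNumber (triK 2 m n) : ℝ) ≤
      2 * (crossingNumber (quadK 1 1 m n) : ℝ) + ((l : ℝ) * (k + 1) + k) := by exact_mod_cast h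
  have e1 : (m : ℝ) = 2 * k + 1 := by rw [hk]; push_cast; ring
  have e2 : (n : ℝ) = 2 * l + 1 := by rw [hl]; push_cast; ring
  rw [e1, e2]
  linarith
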